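/- Let p be a prime, e a positive integer, and q = p^e. Then the proportion of irreducible complex characters of GL(n, F_q) whose degree is divisible by p tends to 1/q as n → ∞: lim_{n→∞} #{χ ∈ Irr(GL(n,q)) : p divides χ(1)} / |Irr(GL(n,q))| = 1/q. -/

import Mathlib

open Matrix
def IsIrrChar (G : Type) [Group G] (f : G → ℂ) : Prop :=
  ∃ V : FDRep ℂ G, CategoryTheory.Simple V ∧ FDRep.character V = f
/-- `d` divides the algebraic number `z`, i.e. `z / d` is an algebraic integer. -/
def NatDvdAlg (d : ℕ) (z : ℂ) : Prop := IsIntegral ℤ (z / (d : ℂ))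

set_option linter.all false
namespace GLp
open Equiv (coe_mulRight mulRight ofBijective subtypeEquiv)
open Finset (card_univ induction_on mem_filter mem_univ mul_sum prod_congr smul_sum sum_add_distrib sum_boole sum_comm sum_congr sum_const sum_eq_single sum_eq_zero sum_insert sum_mul sum_range_succ sum_sub_distrib univ)
open Fintype (card_congr card_ne_zero card_prod card_subtype ofFinite sum_equiv sum_prod_type)
open Function (Injective Surjective)
open LinearEquiv (ofFinrankEq)
open LinearMap (coe_mk fst inl inr ker range snd toMatrix')
open Module (finrank finrank_zero_of_subsingleton)
open Submodule (finrank_quotient_add_finrank quotEquivOfEq smul_mem span_induction subset_span)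
open Finset.HasAntidiagonal (antidiagonal)
open scoped ComplexConjugate MonoidAlgebra ComplexOrder

section CharTheory
variable {G : Type} [Group G] [Fintype G]

def IrrR (G : Type) [Group G] (f : G → ℂ) : Prop :=
  ∃ (V : Type) (_ : AddCommGroup V) (_ : Module ℂ V) (_ : FiniteDimensional ℂ V)
    (ρ : Representation ℂ G V), ρ.IsIrreducible ∧ ρ.character = f

lemma char_inv_conj {V : Type} [AddCommGroup V] [Module ℂ V] [FiniteDimensional ℂ V]
    (ρ : Representation ℂ G V) (g : G) : ρ.character g⁻¹ = conj (ρ.character g) := by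
  classical
  let b := Module.finBasis ℂ V
  let M : G → Matrix _ _ ℂ := fun g => LinearMap.toMatrix b b (ρ g)
  have hM1 : M 1 = 1 := by simp [M]
  have hMm : ∀ g h, M (g * h) = M g * M h := by
    intro g h
    simp only [M, map_mul, Module.End.mul_eq_comp]
    exact LinearMap.toMatrix_comp b b b _ _
  have htr : ∀ g, ρ.character g = (M g).trace := by
    intro g
    simp [M, Representation.character, LinearMap.trace_eq_matrix_trace ℂ b]
  let H : Matrix _ _ ℂ := ∑ h, (M h)ᴴ * M h
  have hH : H.PosDef := by
    have : H = (M 1)ᴴ * M 1 + ∑ h ∈ Finset.univ.erase (1 : G), (M h)ᴴ * M h := by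
      simp only [H]; rw [Finset.add_sum_erase _ (fun h => (M h)ᴴ * M h) (mem_univ 1)]
    rw [this, hM1]
    simp only [conjTranspose_one, mul_one]
    apply Matrix.PosDef.add_posSemidef Matrix.PosDef.one
    apply Matrix.posSemidef_sum
    intro i _
    exact Matrix.posSemidef_conjTranspose_mul_self _
  have hinv : (M g)ᴴ * H * M g = H := by
    simp only [H, mul_sum, sum_mul]
    rw [← Equiv.sum_comp (mulRight g) (fun x => (M x)ᴴ * M x)]
    apply sum_congr rfl
    intro x _
    simp [hMm, Matrix.mul_assoc]
  have hHu : IsUnit H := hH.isUnit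
  have hdet : IsUnit H.det := (Matrix.isUnit_iff_isUnit_det _).1 hHu
  have hgi : M g * M g⁻¹ = 1 := by rw [← hMm]; simp [hM1]
  have : (M g)ᴴ * H = H * M g⁻¹ := by
    calc (M g)ᴴ * H = (M g)ᴴ * H * (M g * M g⁻¹) := by rw [hgi, mul_one]
      _ = _ := by rw [← Matrix.mul_assoc, hinv]
  have h2 : M g⁻¹ = H⁻¹ * ((M g)ᴴ * H) := by
    rw [this, Matrix.nonsing_inv_mul_cancel_left _ _ hdet]
  rw [htr, htr, h2, Matrix.trace_mul_comm, Matrix.mul_assoc, Matrix.mul_nonsing_inv _ hdet, mul_one,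
    Matrix.trace_conjTranspose]
  rfl

lemma schur_zero {V : Type} [AddCommGroup V] [Module ℂ V] [FiniteDimensional ℂ V]
    (ρ : Representation ℂ G V) (hρ : ρ.IsIrreducible) (T : V →ₗ[ℂ] V)
    (hT : ∀ g v, T (ρ g v) = ρ g (T v)) (h0 : LinearMap.trace ℂ V T = 0) : T = 0 := by
  haveI := hρ
  let f : Representation.IntertwiningMap ρ ρ := LinearMap.intertwiningMap_of_isIntertwiningMap ρ ρ T hT
  obtain ⟨c, hc⟩ := (Representation.IsIrreducible.algebraMap_intertwiningMap_bijective_of_isAlgClosed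
    (ρ := ρ)).2 f
  have hTc : T = c • (1 : V →ₗ[ℂ] V) := by
    ext v
    have := congrArg (fun h : Representation.IntertwiningMap ρ ρ => h.toLinearMap v) hc
    simpa [f, LinearMap.intertwiningMap_of_isIntertwiningMap, Algebra.algebraMap_eq_smul_one] using! this.symm
  rw [hTc] at h0 ⊢
  simp only [map_smul, LinearMap.trace_one, smul_eq_mul, mul_eq_zero, Nat.cast_eq_zero] at h0
  rcases h0 with h0 | h0
  · simp [h0]
  · have : Subsingleton V := Module.finrank_zero_iff.1 h0
    ext v; exact Subsingleton.elim _ _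

noncomputable def ip (f h : G → ℂ) : ℂ := (Fintype.card G : ℂ)⁻¹ * ∑ g, conj (f g) * h g

lemma card_ne : (Fintype.card G : ℂ) ≠ 0 := by exact_mod_cast card_ne_zero

lemma ip_rep {V W : Type} [AddCommGroup V] [Module ℂ V] [FiniteDimensional ℂ V]
    [AddCommGroup W] [Module ℂ W] [FiniteDimensional ℂ W]
    (ρ : Representation ℂ G V) (σ : Representation ℂ G W) :
    ip ρ.character σ.character = finrank ℂ (Representation.IntertwiningMap ρ σ) := by
  have : Invertible (Nat.card G : ℂ) := invertibleOfNonzero (by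
    rw [Nat.card_eq_fintype_card]; exact card_ne)
  rw [← Representation.card_inv_mul_sum_char_mul_char_eq_finrank, ip, Nat.card_eq_fintype_card]
  simp only [char_inv_conj, mul_comm]

lemma ip_irr {χ χ' : G → ℂ} (h : IrrR G χ) (h' : IrrR G χ') [Decidable (χ = χ')] :
    ip χ χ' = if χ = χ' then 1 else 0 := by
  obtain ⟨V, _, _, _, ρ, hρ, rfl⟩ := h
  obtain ⟨W, _, _, _, σ, hσ, rfl⟩ := h'
  haveI := hρ; haveI := hσ
  split_ifs with he
  · rw [← he, ip_rep]; simp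
  · rw [ip_rep]
    have : IsEmpty (Representation.Equiv ρ σ) := ⟨fun φ => he (Representation.char_iso φ)⟩
    simp [finrank_zero_of_subsingleton]

lemma IrrR.isIrrChar {f : G → ℂ} (h : IrrR G f) : IsIrrChar G f := by
  have hh := ip_irr h h
  obtain ⟨V, _, _, _, ρ, hρ, rfl⟩ := h
  refine ⟨FDRep.of ρ, ?_, rfl⟩
  rw [FDRep.simple_iff_char_is_norm_one]
  simp only [ip, if_true] at hh
  rw [inv_mul_eq_one₀ card_ne] at hh
  rw [Nat.card_eq_fintype_card, hh]
  refine sum_congr rfl fun g _ => ?_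
  show ρ.character g * ρ.character g⁻¹ = _
  rw [char_inv_conj, mul_comm]

def IsClass (f : G → ℂ) : Prop := ∀ g h, f (h * g * h⁻¹) = f g

lemma IrrR.isClass {f : G → ℂ} (h : IrrR G f) : IsClass f := by
  obtain ⟨V, _, _, _, ρ, hρ, rfl⟩ := h
  intro g h
  exact ρ.char_conj g h

lemma complete_zero {f : G → ℂ} (hf : IsClass f) (h : ∀ χ, IrrR G χ → ip χ f = 0) : f = 0 := by
  classical
  let z : ℂ[G] := ∑ g, MonoidAlgebra.single g (conj (f g))
  have key : ∀ S : Submodule ℂ[G] ℂ[G], IsSimpleModule ℂ[G] S → ∀ s ∈ S, z * s = 0 := by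
    intro S hS s hs
    haveI : FiniteDimensional ℂ ℂ[G] := inferInstance
    haveI : FiniteDimensional ℂ S :=
      FiniteDimensional.of_injective (S.subtype.restrictScalars ℂ) S.subtype_injective
    let ρ : Representation ℂ G S := Representation.ofModule' (k := ℂ) (G := G) S
    have hact : ∀ (r : ℂ[G]) (x : S), ρ.asAlgebraHom r x = r • x := by
      intro r x
      have : ρ.asAlgebraHom = Algebra.lsmul ℂ ℂ S := Equiv.apply_symm_apply (MonoidAlgebra.lift ℂ _ G) _
      rw [this]; rfl
    have hirr : ρ.IsIrreducible := by
      rw [Representation.irreducible_iff_isSimpleModule_asModule]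
      let e : ρ.asModule ≃ₗ[ℂ[G]] S :=
        { ρ.asModuleEquiv.toAddEquiv with
          map_smul' := fun r x => by
            show ρ.asModuleEquiv (r • x) = r • ρ.asModuleEquiv x
            rw [Representation.asModuleEquiv_map_smul, hact] }
      exact IsSimpleModule.congr e
    let T : S →ₗ[ℂ] S := ∑ g, conj (f g) • ρ g
    have hT : T = 0 := by
      apply schur_zero ρ hirr
      · intro g v
        simp only [T, LinearMap.sum_apply, LinearMap.smul_apply, map_sum, map_smul]
        rw [← Equiv.sum_comp (MulAut.conj g).toEquiv]
        refine sum_congr rfl fun x _ => ?_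
        simp only [MulEquiv.toEquiv_eq_coe, EquivLike.coe_coe, MulAut.conj_apply, hf x g]
        rw [← Module.End.mul_apply, ← Module.End.mul_apply, ← map_mul, ← map_mul]
        simp [mul_assoc]
      · have := h ρ.character ⟨S, inferInstance, inferInstance, inferInstance, ρ, hirr, rfl⟩
        simp only [ip, mul_eq_zero, inv_eq_zero, card_ne, false_or] at this
        simp only [T, map_sum, map_smul, smul_eq_mul]
        have h3 := congrArg conj this
        simp only [map_sum, map_mul, map_zero, Complex.conj_conj] at h3
        rw [← h3]
        exact sum_congr rfl fun g _ => mul_comm _ _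
    have h4 : ρ.asAlgebraHom z = T := by
      simp only [z, T, map_sum, Representation.asAlgebraHom_single]
    have h5 := hact z ⟨s, hs⟩
    rw [h4, hT] at h5
    have h7 := congrArg (Subtype.val) h5.symm
    simpa using h7
  have hz : z = 0 := by
    haveI : NeZero (Nat.card G : ℂ) := ⟨by rw [Nat.card_eq_fintype_card]; exact card_ne⟩
    have h1 : (1 : ℂ[G]) ∈ sSup {m : Submodule ℂ[G] ℂ[G] | IsSimpleModule ℂ[G] m} := by
      rw [IsSemisimpleModule.sSup_simples_eq_top]; trivial
    have : sSup {m : Submodule ℂ[G] ℂ[G] | IsSimpleModule ℂ[G] m} ≤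
        sSup {m : Submodule ℂ[G] ℂ[G] | IsSimpleModule ℂ[G] m} := le_rfl
    have h2 : ∀ x ∈ sSup {m : Submodule ℂ[G] ℂ[G] | IsSimpleModule ℂ[G] m}, z * x = 0 := by
      intro x hx
      rw [sSup_eq_iSup'] at hx
      refine Submodule.iSup_induction _ (motive := fun x => z * x = 0) hx ?_ (by simp) ?_
      · rintro ⟨S, hS⟩ x hx
        exact key S hS x hx
      · intro x y hx hy; rw [mul_add, hx, hy, add_zero]
    simpa using h2 1 h1
  ext g
  have := congrArg (fun w : ℂ[G] => w.coeff g) hz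
  simp only [z] at this
  simpa [MonoidAlgebra.coeff_sum, MonoidAlgebra.coeff_single, Finsupp.finsetSum_apply, Finsupp.single_apply] using this

lemma ip_add_right (f h k : G → ℂ) : ip f (h + k) = ip f h + ip f k := by
  simp [ip, mul_add, sum_add_distrib]
lemma ip_smul_right (f h : G → ℂ) (c : ℂ) : ip f (c • h) = c * ip f h := by
  simp only [ip, Pi.smul_apply, smul_eq_mul, mul_sum]
  exact sum_congr rfl fun g _ => by ring
lemma ip_sub_right (f h k : G → ℂ) : ip f (h - k) = ip f h - ip f k := by
  simp [ip, mul_sub, sum_sub_distrib]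
lemma ip_zero_right (f : G → ℂ) : ip f 0 = 0 := by simp [ip]
lemma ip_sum_right {ι : Type*} (s : Finset ι) (f : G → ℂ) (h : ι → G → ℂ) :
    ip f (∑ i ∈ s, h i) = ∑ i ∈ s, ip f (h i) := by
  classical
  induction s using induction_on with
  | empty => simp [ip_zero_right]
  | insert a s ha ih => rw [sum_insert ha, sum_insert ha, ip_add_right, ih]
lemma ip_conj (f h : G → ℂ) : conj (ip f h) = ip h f := by
  simp only [ip, map_mul, map_inv₀, map_natCast, map_sum, Complex.conj_conj]
  congr 1
  exact sum_congr rfl fun g _ => mul_comm _ _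

lemma irr_linInd : LinearIndependent ℂ (fun χ : {χ : G → ℂ // IrrR G χ} => χ.1) := by
  classical
  rw [linearIndependent_iff']
  intro s c hc χ hχ
  have := congrArg (ip χ.1) hc
  rw [ip_sum_right, ip_zero_right] at this
  simp only [ip_smul_right] at this
  rw [sum_eq_single χ] at this
  · simpa [ip_irr χ.2 χ.2] using this
  · intro b _ hb
    rw [ip_irr χ.2 b.2, if_neg, mul_zero]
    exact fun h => hb (Subtype.ext h.symm)
  · exact fun h => absurd hχ h

instance : Finite {χ : G → ℂ // IrrR G χ} := irr_linInd.finite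

noncomputable instance : Fintype {χ : G → ℂ // IrrR G χ} := ofFinite _

lemma expand {f : G → ℂ} (hf : IsClass f) :
    f = ∑ χ : {χ : G → ℂ // IrrR G χ}, ip χ.1 f • χ.1 := by
  classical
  rw [← sub_eq_zero]
  apply complete_zero
  · intro g h
    simp only [Pi.sub_apply, Finset.sum_apply, Pi.smul_apply]
    rw [hf g h]
    congr 1
    exact sum_congr rfl fun χ _ => by rw [χ.2.isClass g h]
  · intro χ hχ
    rw [ip_sub_right, ip_sum_right]
    simp only [ip_smul_right]
    rw [sum_eq_single ⟨χ, hχ⟩]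
    · simp [ip_irr hχ hχ]
    · intro b _ hb
      rw [ip_irr hχ b.2, if_neg, mul_zero]
      exact fun h => hb (Subtype.ext h.symm)
    · simp

lemma IsIrrChar.irrR {f : G → ℂ} (h : IsIrrChar G f) : IrrR G f := by
  classical
  by_contra hn
  obtain ⟨V, hV, rfl⟩ := h
  have hc : IsClass V.character := fun g h => V.char_conj g h
  have hself : ip V.character V.character = 1 := by
    have h1 := (FDRep.simple_iff_char_is_norm_one V).1 hV
    rw [ip, inv_mul_eq_one₀ card_ne, ← Nat.card_eq_fintype_card, ← h1]
    refine sum_congr rfl fun g _ => ?_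
    have h2 : V.character g⁻¹ = conj (V.character g) := char_inv_conj V.ρ g
    rw [h2, mul_comm]
  have h0 : V.character = 0 := by
    apply complete_zero hc
    intro χ hχ
    obtain ⟨W, hW, rfl⟩ := hχ.isIrrChar
    haveI := hV; haveI := hW
    have : Invertible (Nat.card G : ℂ) := invertibleOfNonzero (by
      rw [Nat.card_eq_fintype_card]; exact card_ne)
    have ho := FDRep.char_orthonormal V W
    rw [if_neg] at ho
    · rw [← ho, ip, Nat.card_eq_fintype_card]
      congr 1
      refine sum_congr rfl fun g _ => ?_
      have h2 : W.character g⁻¹ = conj (W.character g) := char_inv_conj W.ρ g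
      rw [h2, mul_comm]
    · rintro ⟨i⟩
      exact hn (by rw [FDRep.char_iso i]; exact hχ)
  rw [h0, ip_zero_right] at hself
  exact zero_ne_one hself

lemma isIrrChar_iff {f : G → ℂ} : IsIrrChar G f ↔ IrrR G f := ⟨IsIrrChar.irrR, IrrR.isIrrChar⟩

lemma card_irr : Nat.card {χ : G → ℂ // IrrR G χ} = Nat.card (ConjClasses G) := by
  classical
  let W : Submodule ℂ (G → ℂ) :=
    { carrier := {f | IsClass f}
      add_mem' := fun {a b} ha hb g h => by simp [ha g h, hb g h]
      zero_mem' := fun g h => rfl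
      smul_mem' := fun c a ha g h => by simp [ha g h] }
  let b : {χ : G → ℂ // IrrR G χ} → W := fun χ => ⟨χ.1, χ.2.isClass⟩
  have hb : LinearIndependent ℂ b := LinearIndependent.of_comp W.subtype irr_linInd
  have hs : ⊤ ≤ Submodule.span ℂ (Set.range b) := by
    rintro ⟨f, hf⟩ -
    have : (⟨f, hf⟩ : W) = ∑ χ : {χ : G → ℂ // IrrR G χ}, ip χ.1 f • b χ := by
      apply Subtype.ext
      rw [Submodule.coe_sum]
      exact expand hf
    rw [this]
    exact Submodule.sum_mem _ fun χ _ => smul_mem _ _ (subset_span ⟨χ, rfl⟩)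
  let B := Module.Basis.mk hb hs
  let e : W ≃ₗ[ℂ] (ConjClasses G → ℂ) :=
    { toFun := fun f => Quotient.lift f.1 (fun a b hab => by
        obtain ⟨c, hc⟩ := isConj_iff.1 hab
        rw [← hc]; exact (f.2 a c).symm)
      invFun := fun F => ⟨fun g => F (ConjClasses.mk g), fun g h => by
        show F _ = F _
        congr 1
        exact (ConjClasses.mk_eq_mk_iff_isConj.2 (isConj_iff.2 ⟨h, rfl⟩)).symm⟩
      map_add' := fun f g => by ext x; induction x using Quotient.inductionOn; rfl
      map_smul' := fun c g => by ext x; induction x using Quotient.inductionOn; rfl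
      left_inv := fun f => by ext x; rfl
      right_inv := fun F => by ext x; induction x using Quotient.inductionOn; rfl }
  haveI : Finite (ConjClasses G) := Quotient.finite _
  haveI := ofFinite (ConjClasses G)
  have h1 := Module.finrank_eq_card_basis B
  have h2 := e.finrank_eq
  rw [Module.finrank_fintype_fun_eq_card] at h2
  rw [Nat.card_eq_fintype_card, Nat.card_eq_fintype_card, ← h1, h2]

lemma parseval (f : G → ℂ) {h : G → ℂ} (hh : IsClass h) :
    ip f h = ∑ χ : {χ : G → ℂ // IrrR G χ}, conj (ip χ.1 f) * ip χ.1 h := by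
  conv_lhs => rw [expand hh]
  rw [ip_sum_right]
  refine sum_congr rfl fun χ _ => ?_
  rw [ip_smul_right, ip_conj, mul_comm]

lemma ip_self_eq_zero {f : G → ℂ} (h : ip f f = 0) : f = 0 := by
  simp only [ip, mul_eq_zero, inv_eq_zero, card_ne, false_or] at h
  have h2 : ∑ g, Complex.normSq (f g) = 0 := by
    have : ((∑ g, Complex.normSq (f g) : ℝ) : ℂ) = 0 := by
      rw [← h]; push_cast
      exact sum_congr rfl fun g _ => by rw [mul_comm, Complex.mul_conj]
    exact_mod_cast this
  rw [Finset.sum_eq_zero_iff_of_nonneg (fun g _ => Complex.normSq_nonneg _)] at h2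
  ext g
  simpa using h2 g (mem_univ g)
end CharTheory

structure Mo (F : Type) [Field F] where
  V : Type
  [acg : AddCommGroup V]
  [mod : Module F V]
  [fin : Finite V]
  T : V →ₗ[F] V

attribute [instance] Mo.acg Mo.mod Mo.fin

section Hall
variable {F : Type} [Field F]

def Iso (M N : Mo F) : Prop := ∃ e : M.V ≃ₗ[F] N.V, ∀ v, e (M.T v) = N.T (e v)

lemma Iso.refl (M : Mo F) : Iso M M := ⟨LinearEquiv.refl _ _, fun _ => rfl⟩
lemma Iso.symm {M N : Mo F} (h : Iso M N) : Iso N M := by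
  obtain ⟨e, he⟩ := h
  exact ⟨e.symm, fun v => by rw [LinearEquiv.symm_apply_eq, he]; simp⟩
lemma Iso.trans {M N K : Mo F} (h : Iso M N) (h' : Iso N K) : Iso M K := by
  obtain ⟨e, he⟩ := h
  obtain ⟨e', he'⟩ := h'
  exact ⟨e.trans e', fun v => by simp [he, he']⟩

def Inv {α : Type*} (f : Mo F → α) : Prop := ∀ M N, Iso M N → f M = f N

abbrev St (M : Mo F) : Type := {N : Submodule F M.V // ∀ v ∈ N, M.T v ∈ N}

def sub (M : Mo F) (N : St M) : Mo F := ⟨N.1, M.T.restrict N.2⟩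
instance finQ (M : Mo F) (N : Submodule F M.V) : Finite (M.V ⧸ N) := Finite.of_surjective _ (Submodule.mkQ_surjective N)
def quo (M : Mo F) (N : St M) : Mo F := ⟨M.V ⧸ N.1, N.1.mapQ N.1 M.T (fun v hv => N.2 v hv)⟩

noncomputable instance (M : Mo F) : Fintype (St M) := ofFinite _

noncomputable def hm (f g : Mo F → ℂ) (M : Mo F) : ℂ := ∑ N : St M, f (quo M N) * g (sub M N)

open Classical in
noncomputable def one (M : Mo F) : ℂ := if Subsingleton M.V then 1 else 0

def stMap {M M' : Mo F} (e : M.V ≃ₗ[F] M'.V) (he : ∀ v, e (M.T v) = M'.T (e v)) : St M ≃ St M' where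
  toFun N := ⟨N.1.map (e : M.V →ₗ[F] M'.V), by
    rintro _ ⟨v, hv, rfl⟩
    exact ⟨M.T v, N.2 v hv, he v⟩⟩
  invFun N := ⟨N.1.comap (e : M.V →ₗ[F] M'.V), fun v hv => by
    show e (M.T v) ∈ N.1
    rw [he]; exact N.2 _ hv⟩
  left_inv N := Subtype.ext (Submodule.comap_map_eq_of_injective e.injective _)
  right_inv N := Subtype.ext (Submodule.map_comap_eq_of_surjective e.surjective _)

lemma iso_quo {M M' : Mo F} (e : M.V ≃ₗ[F] M'.V) (he : ∀ v, e (M.T v) = M'.T (e v)) (N : St M)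
    (N' : St M') (h : N.1.map (e : M.V →ₗ[F] M'.V) = N'.1) :
    Iso (quo M N) (quo M' N') := by
  refine ⟨Submodule.Quotient.equiv N.1 N'.1 e h, fun v => ?_⟩
  obtain ⟨v, rfl⟩ := Submodule.Quotient.mk_surjective _ v
  show (Submodule.Quotient.mk (e (M.T v)) : M'.V ⧸ N'.1) = Submodule.Quotient.mk (M'.T (e v))
  rw [he]

lemma iso_sub {M M' : Mo F} (e : M.V ≃ₗ[F] M'.V) (he : ∀ v, e (M.T v) = M'.T (e v)) (N : St M)
    (N' : St M') (h : N.1.map (e : M.V →ₗ[F] M'.V) = N'.1) :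
    Iso (sub M N) (sub M' N') := by
  obtain ⟨N', hN'⟩ := N'
  subst h
  exact ⟨e.submoduleMap N.1, fun v => Subtype.ext (he v.1)⟩

lemma Inv.hm {f g : Mo F → ℂ} (hf : Inv f) (hg : Inv g) : Inv (hm f g) := by
  rintro M M' ⟨e, he⟩
  unfold GLp.hm
  refine sum_equiv (stMap e he) _ _ fun N => ?_
  rw [hf _ _ (iso_quo e he N (stMap e he N) rfl), hg _ _ (iso_sub e he N (stMap e he N) rfl)]

lemma Inv.one : Inv (one : Mo F → ℂ) := by
  rintro M M' ⟨e, he⟩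
  unfold GLp.one
  have : Subsingleton M.V ↔ Subsingleton M'.V := e.toEquiv.subsingleton_congr
  classical exact if_congr this rfl rfl

def botSt (M : Mo F) : St M := ⟨⊥, fun v hv => by rw [Submodule.mem_bot] at *; simp [hv]⟩
def topSt (M : Mo F) : St M := ⟨⊤, fun v hv => trivial⟩

lemma iso_quo_bot (M : Mo F) : Iso (quo M (botSt M)) M :=
  ⟨Submodule.quotEquivOfEqBot _ rfl, fun v => by
    obtain ⟨v, rfl⟩ := Submodule.Quotient.mk_surjective _ v
    rfl⟩
lemma iso_sub_top (M : Mo F) : Iso (sub M (topSt M)) M :=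
  ⟨Submodule.topEquiv, fun v => rfl⟩

lemma hm_one {f : Mo F → ℂ} (hf : Inv f) : hm f one = f := by
  ext M
  unfold hm
  rw [sum_eq_single (botSt M)]
  · rw [hf _ _ (iso_quo_bot M)]
    have : Subsingleton (sub M (botSt M)).V := by
      show Subsingleton (⊥ : Submodule F M.V); infer_instance
    simp [one, this]
  · intro N _ hN
    have : ¬ Subsingleton (sub M N).V := by
      intro h
      apply hN
      exact Subtype.ext ((Submodule.subsingleton_iff_eq_bot).1 h)
    simp [one, this]
  · simp

lemma one_hm {f : Mo F → ℂ} (hf : Inv f) : hm one f = f := by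
  ext M
  unfold hm
  rw [sum_eq_single (topSt M)]
  · rw [hf _ _ (iso_sub_top M)]
    have : Subsingleton (quo M (topSt M)).V := by
      show Subsingleton (M.V ⧸ (⊤ : Submodule F M.V)); infer_instance
    simp [one, this]
  · intro N _ hN
    have : ¬ Subsingleton (quo M N).V := by
      intro h
      apply hN
      exact Subtype.ext (Submodule.Quotient.subsingleton_iff.1 h)
    simp [one, this]
  · simp

/-! associativity -/
def imQ {M : Mo F} (N L : St M) : St (quo M N) := ⟨L.1.map N.1.mkQ, by
  rintro _ ⟨v, hv, rfl⟩
  exact ⟨M.T v, L.2 v hv, rfl⟩⟩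
def reS {M : Mo F} (L N : St M) : St (sub M L) := ⟨N.1.comap L.1.subtype, fun v hv => N.2 _ hv⟩

lemma iso_qq {M : Mo F} (N L : St M) (h : N.1 ≤ L.1) : Iso (quo (quo M N) (imQ N L)) (quo M L) := by
  refine ⟨Submodule.quotientQuotientEquivQuotient N.1 L.1 h, fun v => ?_⟩
  obtain ⟨v, rfl⟩ := Submodule.Quotient.mk_surjective _ v
  obtain ⟨v, rfl⟩ := Submodule.Quotient.mk_surjective _ v
  rfl

lemma iso_ss {M : Mo F} (L N : St M) (h : N.1 ≤ L.1) : Iso (sub (sub M L) (reS L N)) (sub M N) :=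
  ⟨Submodule.comapSubtypeEquivOfLe h, fun v => rfl⟩

lemma iso_sq {M : Mo F} (N L : St M) (h : N.1 ≤ L.1) :
    Iso (quo (sub M L) (reS L N)) (sub (quo M N) (imQ N L)) := by
  let φ : L.1 →ₗ[F] (L.1.map N.1.mkQ : Submodule F (M.V ⧸ N.1)) :=
    (N.1.mkQ.restrict (p := L.1) (q := L.1.map N.1.mkQ) fun v hv => ⟨v, hv, rfl⟩)
  have hs : Surjective φ := by
    rintro ⟨_, v, hv, rfl⟩
    exact ⟨⟨v, hv⟩, rfl⟩
  have hk : N.1.comap L.1.subtype = ker φ := by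
    ext v
    rw [LinearMap.mem_ker, Subtype.ext_iff]
    show v.1 ∈ N.1 ↔ (Submodule.Quotient.mk v.1 : M.V ⧸ N.1) = 0
    rw [Submodule.Quotient.mk_eq_zero]
  refine ⟨(quotEquivOfEq _ _ hk).trans (φ.quotKerEquivOfSurjective hs), fun v => ?_⟩
  obtain ⟨v, rfl⟩ := Submodule.Quotient.mk_surjective _ v
  rfl

open Classical in
lemma sum_St_quo {M : Mo F} (N : St M) (φ : St (quo M N) → ℂ) :
    ∑ K, φ K = ∑ L : St M, if N.1 ≤ L.1 then φ (imQ N L) else 0 := by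
  rw [← Finset.sum_filter]
  symm
  refine Finset.sum_bij' (fun L _ => imQ N L)
    (fun K _ => ⟨K.1.comap N.1.mkQ, fun v hv => by
      have := K.2 _ hv
      exact this⟩) ?_ ?_ ?_ ?_ ?_
  · simp
  · intro K _
    simp only [mem_filter, mem_univ, true_and]
    exact Submodule.le_comap_mkQ N.1 K.1
  · intro L hL
    simp only [mem_filter, mem_univ, true_and] at hL
    apply Subtype.ext
    show (L.1.map N.1.mkQ).comap N.1.mkQ = L.1
    rw [Submodule.comap_map_mkQ, sup_eq_right.2 hL]
  · intro K _
    apply Subtype.ext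
    exact Submodule.map_comap_eq_of_surjective (Submodule.mkQ_surjective _) _
  · simp

open Classical in
lemma sum_St_sub {M : Mo F} (L : St M) (φ : St (sub M L) → ℂ) :
    ∑ J, φ J = ∑ N : St M, if N.1 ≤ L.1 then φ (reS L N) else 0 := by
  rw [← Finset.sum_filter]
  symm
  refine Finset.sum_bij' (fun N _ => reS L N)
    (fun J _ => ⟨J.1.map L.1.subtype, by
      rintro _ ⟨v, hv, rfl⟩
      exact ⟨_, J.2 v hv, rfl⟩⟩) ?_ ?_ ?_ ?_ ?_
  · simp
  · intro J _
    simp only [mem_filter, mem_univ, true_and]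
    exact Submodule.map_subtype_le _ _
  · intro N hN
    simp only [mem_filter, mem_univ, true_and] at hN
    apply Subtype.ext
    show (N.1.comap L.1.subtype).map L.1.subtype = N.1
    rw [Submodule.map_comap_subtype, inf_eq_right.2 hN]
  · intro J _
    apply Subtype.ext
    exact Submodule.comap_map_eq_of_injective (Submodule.subtype_injective _) _
  · simp

lemma hm_assoc {f g h : Mo F → ℂ} (hf : Inv f) (hg : Inv g) (hh : Inv h) :
    hm (hm f g) h = hm f (hm g h) := by
  classical
  ext M
  unfold hm
  simp only [sum_mul, mul_sum, sum_St_quo, sum_St_sub]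
  rw [sum_comm]
  refine sum_congr rfl fun L _ => sum_congr rfl fun N _ => ?_
  split_ifs with hN
  · rw [hf _ _ (iso_qq N L hN), hg _ _ (iso_sq N L hN), hh _ _ (iso_ss L N hN), mul_assoc]
  · simp

lemma hm_add_left (f f' g : Mo F → ℂ) : hm (f + f') g = hm f g + hm f' g := by
  ext M; simp [hm, add_mul, sum_add_distrib]
lemma hm_add_right (f g g' : Mo F → ℂ) : hm f (g + g') = hm f g + hm f g' := by
  ext M; simp [hm, mul_add, sum_add_distrib]
lemma hm_smul_left (c : ℂ) (f g : Mo F → ℂ) : hm (c • f) g = c • hm f g := by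
  ext M; simp [hm, mul_sum, mul_assoc]
lemma hm_smul_right (c : ℂ) (f g : Mo F → ℂ) : hm f (c • g) = c • hm f g := by
  ext M; simp only [hm, Pi.smul_apply, smul_eq_mul, mul_sum]
  exact sum_congr rfl fun _ _ => by ring
lemma hm_zero_left (g : Mo F → ℂ) : hm 0 g = 0 := by ext M; simp [hm]
lemma hm_zero_right (g : Mo F → ℂ) : hm g 0 = 0 := by ext M; simp [hm]
lemma hm_sum_left {ι : Type*} (s : Finset ι) (f : ι → Mo F → ℂ) (g : Mo F → ℂ) :
    hm (∑ i ∈ s, f i) g = ∑ i ∈ s, hm (f i) g := by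
  classical
  induction s using induction_on with
  | empty => simp [hm_zero_left]
  | insert a s ha ih => rw [sum_insert ha, sum_insert ha, hm_add_left, ih]
lemma hm_sum_right {ι : Type*} (s : Finset ι) (f : ι → Mo F → ℂ) (g : Mo F → ℂ) :
    hm g (∑ i ∈ s, f i) = ∑ i ∈ s, hm g (f i) := by
  classical
  induction s using induction_on with
  | empty => simp [hm_zero_right]
  | insert a s ha ih => rw [sum_insert ha, sum_insert ha, hm_add_right, ih]
lemma hm_conj (f g : Mo F → ℂ) (M : Mo F) :
    conj (hm f g M) = hm (fun M => conj (f M)) (fun M => conj (g M)) M := by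
  simp [hm]
end Hall

abbrev Hm {F : Type} [Field F] (A B : Mo F) := A.V →ₗ[F] B.V
abbrev CF (F : Type) [Field F] := Mo F → ℂ

section Green
variable {F : Type} [Field F]

def Ex (A B : Mo F) (c : Hm A B) : Mo F :=
  ⟨A.V × B.V, (A.T.comp (fst F A.V B.V)).prod
    (B.T.comp (snd F A.V B.V) + c.comp (fst F A.V B.V))⟩

lemma Ex_T (A B : Mo F) (c : Hm A B) (a : A.V) (b : B.V) :
    (Ex A B c).T ((a, b) : A.V × B.V) = ((A.T a, B.T b + c a) : A.V × B.V) := rfl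

instance finHom (A B : Type) [AddCommGroup A] [Module F A] [AddCommGroup B] [Module F B]
    [Finite A] [Finite B] : Finite (A →ₗ[F] B) :=
  Finite.of_injective (fun f : A →ₗ[F] B => (f : A → B)) DFunLike.coe_injective

noncomputable instance fintHom (A B : Type) [AddCommGroup A] [Module F A] [AddCommGroup B] [Module F B]
    [Finite A] [Finite B] : Fintype (A →ₗ[F] B) := ofFinite _

noncomputable instance fintSub (A : Type) [AddCommGroup A] [Module F A]
    [Finite A] : Fintype (Submodule F A) := ofFinite _

noncomputable def av {ι : Type*} [Fintype ι] (φ : ι → ℂ) : ℂ := (Fintype.card ι : ℂ)⁻¹ * ∑ i, φ i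

noncomputable def De (f : CF F) (A B : Mo F) : ℂ := av fun c : Hm A B => f (Ex A B c)

lemma av_equiv {ι κ : Type*} [Fintype ι] [Fintype κ] (e : ι ≃ κ) (φ : ι → ℂ) (ψ : κ → ℂ)
    (h : ∀ i, φ i = ψ (e i)) : av φ = av ψ := by
  unfold av
  rw [card_congr e, sum_equiv e φ ψ h]

lemma av_surj {G H : Type*} [AddGroup G] [AddGroup H] [Fintype G] [Fintype H] (p : G →+ H)
    (hp : Surjective p) (φ : H → ℂ) : av (fun g => φ (p g)) = av φ := by
  classical
  have key : ∀ ψ : H → ℂ, ∑ g, ψ (p g) = (Fintype.card {g // p g = 0} : ℂ) * ∑ h, ψ h := by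
    intro ψ
    rw [← Finset.sum_fiberwise univ p (fun g => ψ (p g)), mul_sum]
    refine sum_congr rfl fun h _ => ?_
    obtain ⟨g0, rfl⟩ := hp h
    rw [sum_congr rfl (g := fun _ => ψ (p g0)) (by intro x hx; simp at hx; rw [hx])]
    rw [sum_const, nsmul_eq_mul]
    congr 2
    rw [← card_subtype]
    exact card_congr ⟨fun x => ⟨x.1 - g0, by simp [x.2]⟩, fun x => ⟨x.1 + g0, by simp [x.2]⟩,
      fun x => by simp, fun x => by simp⟩
  have h1 := key (fun _ => 1)
  have h2 := key φ
  simp only [sum_const, card_univ, nsmul_eq_mul, mul_one] at h1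
  unfold av
  rw [h2, h1]
  have : (Fintype.card {g // p g = 0} : ℂ) ≠ 0 := by
    intro h; rw [h, zero_mul] at h1
    exact absurd h1 (by exact_mod_cast card_ne_zero)
  field_simp

lemma av_prod {ι κ : Type*} [Fintype ι] [Fintype κ] (φ : ι → ℂ) (ψ : κ → ℂ) :
    av (fun x : ι × κ => φ x.1 * ψ x.2) = av φ * av ψ := by
  unfold av
  rw [card_prod, sum_prod_type, ← Finset.sum_mul_sum]
  push_cast
  rw [mul_inv]; ring

def NH {A B : Mo F} (A1 : Submodule F A.V) (B1 : Submodule F B.V) (H : Hm A B) :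
    Submodule F (A.V × B.V) :=
  A1.comap (fst F _ _) ⊓ B1.comap (snd F A.V B.V - H.comp (fst F _ _))

lemma mem_NH {A B : Mo F} {A1 : Submodule F A.V} {B1 : Submodule F B.V} {H : Hm A B}
    {a : A.V} {b : B.V} : (a, b) ∈ NH A1 B1 H ↔ a ∈ A1 ∧ b - H a ∈ B1 := by
  simp [NH]

abbrev SS {A B : Mo F} (A1 : Submodule F A.V) (B1 : Submodule F B.V) : Submodule F (Hm A B) :=
  Submodule.compatibleMaps A1 B1

lemma mem_SS {A B : Mo F} {A1 : Submodule F A.V} {B1 : Submodule F B.V} {c : Hm A B} :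
    c ∈ SS A1 B1 ↔ ∀ a ∈ A1, c a ∈ B1 := Iff.rfl

def pA {A B : Mo F} (N : Submodule F (A.V × B.V)) : Submodule F A.V := N.map (fst F _ _)
def pB {A B : Mo F} (N : Submodule F (A.V × B.V)) : Submodule F B.V := N.comap (inr F _ _)

lemma exists_NH {A B : Mo F} (N : Submodule F (A.V × B.V)) : ∃ H, N = NH (pA N) (pB N) H := by
  let φ : N →ₗ[F] pA N := (fst F A.V B.V).restrict fun v hv => ⟨v, hv, rfl⟩
  have hs : Surjective φ := by
    rintro ⟨_, v, hv, rfl⟩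
    exact ⟨⟨v, hv⟩, rfl⟩
  obtain ⟨s, hs⟩ := LinearMap.exists_rightInverse_of_surjective φ (LinearMap.range_eq_top.2 hs)
  have hs' : ∀ x, (s x).1.1 = x.1 := fun x => congrArg Subtype.val (LinearMap.congr_fun hs x)
  obtain ⟨H, hH⟩ := LinearMap.exists_extend ((snd F A.V B.V) ∘ₗ N.subtype ∘ₗ s)
  have hH' : ∀ x : pA N, H x.1 = (s x).1.2 := fun x => LinearMap.congr_fun hH x
  refine ⟨H, ?_⟩
  ext ⟨a, b⟩
  rw [mem_NH]
  have key : ∀ ha : a ∈ pA N, ((a, b) ∈ N ↔ b - H a ∈ pB N) := by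
    intro ha
    have h1 := (s ⟨a, ha⟩).2
    have h2 : (s ⟨a, ha⟩).1 = (a, H a) := Prod.ext (hs' _) (hH' _).symm
    rw [h2] at h1
    show _ ↔ ((0 : A.V), b - H a) ∈ N
    have h3 : ((0 : A.V), b - H a) = (a, b) - (a, H a) := by simp
    rw [h3, Submodule.sub_mem_iff_left _ h1]
  constructor
  · intro h
    have ha : a ∈ pA N := ⟨_, h, rfl⟩
    exact ⟨ha, (key ha).1 h⟩
  · rintro ⟨ha, h⟩
    exact (key ha).2 h

lemma pA_NH {A B : Mo F} (A1 : Submodule F A.V) (B1 : Submodule F B.V) (H : Hm A B) :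
    pA (NH A1 B1 H) = A1 := by
  ext a
  constructor
  · rintro ⟨⟨a, b⟩, h, rfl⟩
    exact (mem_NH.1 h).1
  · intro h
    exact ⟨(a, H a), mem_NH.2 ⟨h, by simp⟩, rfl⟩

lemma pB_NH {A B : Mo F} (A1 : Submodule F A.V) (B1 : Submodule F B.V) (H : Hm A B) :
    pB (NH A1 B1 H) = B1 := by
  ext b
  show ((0 : A.V), b) ∈ NH A1 B1 H ↔ _
  rw [mem_NH]; simp

lemma NH_eq_iff {A B : Mo F} (A1 : Submodule F A.V) (B1 : Submodule F B.V) (H H' : Hm A B) :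
    NH A1 B1 H = NH A1 B1 H' ↔ H - H' ∈ SS A1 B1 := by
  constructor
  · intro h a ha
    have : (a, H a) ∈ NH A1 B1 H' := h ▸ mem_NH.2 ⟨ha, by simp⟩
    simpa using (mem_NH.1 this).2
  · intro h
    ext ⟨a, b⟩
    rw [mem_NH, mem_NH]
    refine and_congr_right fun ha => ?_
    have h1 := mem_SS.1 h a ha
    have h2 : b - H' a = (b - H a) + (H a - H' a) := by abel
    rw [h2, Submodule.add_mem_iff_left]
    exact h1

open Classical in
lemma card_H {A B : Mo F} (A1 : Submodule F A.V) (B1 : Submodule F B.V) (H0 : Hm A B) :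
    Fintype.card {H // NH A1 B1 H = NH A1 B1 H0} = Nat.card (SS A1 B1) := by
  rw [Nat.card_eq_fintype_card]
  refine card_congr ⟨fun H => ⟨H.1 - H0, (NH_eq_iff _ _ _ _).1 H.2⟩,
    fun c => ⟨c.1 + H0, (NH_eq_iff _ _ _ _).2 (by simp [c.2])⟩, fun x => by simp, fun x => by simp⟩

open Classical in
lemma sum_sub {A B : Mo F} (φ : Submodule F (A.V × B.V) → ℂ) :
    ∑ N, φ N = ∑ A1 : Submodule F A.V, ∑ B1 : Submodule F B.V,
      (Nat.card (SS A1 B1) : ℂ)⁻¹ * ∑ H, φ (NH A1 B1 H) := by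
  have h1 : ∀ (A1 : Submodule F A.V) (B1 : Submodule F B.V),
      (Nat.card (SS A1 B1) : ℂ)⁻¹ * ∑ H, φ (NH A1 B1 H) =
      ∑ N, if pA N = A1 ∧ pB N = B1 then φ N else 0 := by
    intro A1 B1
    have h2 : ∑ H, φ (NH A1 B1 H) = ∑ N, ∑ H with NH A1 B1 H = N, φ N := by
      rw [← Finset.sum_fiberwise univ (fun H => NH A1 B1 H)]
      refine sum_congr rfl fun N _ => sum_congr rfl fun H hH => ?_
      rw [(Finset.mem_filter.1 hH).2]
    rw [h2, mul_sum]
    refine sum_congr rfl fun N _ => ?_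
    rw [sum_const, nsmul_eq_mul, ← card_subtype]
    split_ifs with h
    · obtain ⟨H0, hH0⟩ := exists_NH N
      rw [h.1, h.2] at hH0
      rw [hH0, card_H, ← mul_assoc, inv_mul_cancel₀, one_mul]
      exact_mod_cast Nat.card_pos.ne'
    · rw [Fintype.card_eq_zero_iff.2]
      · simp
      · refine ⟨fun x => h ?_⟩
        rw [← x.2]
        exact ⟨pA_NH _ _ _, pB_NH _ _ _⟩
  simp only [h1]
  rw [sum_congr rfl (fun A1 _ => sum_comm), sum_comm]
  refine sum_congr rfl fun N _ => ?_
  simp_rw [ite_and]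
  simp

def PrSt {A B : Mo F} (A1 : St A) (B1 : St B) (c : Hm A B) (hc : c ∈ SS A1.1 B1.1) :
    St (Ex A B c) := ⟨NH A1.1 B1.1 0, by
  rintro ⟨a, b⟩ h
  rw [Ex_T]
  replace h := mem_NH.1 h
  refine mem_NH.2 ⟨A1.2 _ h.1, ?_⟩
  simp only [LinearMap.zero_apply, sub_zero] at h ⊢
  exact B1.1.add_mem (B1.2 _ h.2) (mem_SS.1 hc _ h.1)⟩

lemma stable_NH {A B : Mo F} (A1 : Submodule F A.V) (B1 : Submodule F B.V) (H c : Hm A B) :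
    (∀ v ∈ NH A1 B1 H, (Ex A B c).T v ∈ NH A1 B1 H) ↔
    (∀ v ∈ A1, A.T v ∈ A1) ∧ (∀ v ∈ B1, B.T v ∈ B1) ∧
      c - (H ∘ₗ A.T - B.T ∘ₗ H) ∈ SS A1 B1 := by
  constructor
  · intro h
    have h1 : ∀ v ∈ B1, B.T v ∈ B1 := by
      intro v hv
      have := h ((0, v) : A.V × B.V) (mem_NH.2 (by simpa using hv))
      rw [Ex_T] at this
      simpa using (mem_NH.1 this).2
    have h2 : ∀ a ∈ A1, A.T a ∈ A1 ∧ (B.T (H a) + c a) - H (A.T a) ∈ B1 := by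
      intro a ha
      have := h ((a, H a) : A.V × B.V) (mem_NH.2 (by simpa using ha))
      rw [Ex_T] at this
      exact mem_NH.1 this
    refine ⟨fun v hv => (h2 v hv).1, h1, fun a ha => ?_⟩
    have := (h2 a ha).2
    have e : (c - (H ∘ₗ A.T - B.T ∘ₗ H)) a = (B.T (H a) + c a) - H (A.T a) := by simp; abel
    show (c - (H ∘ₗ A.T - B.T ∘ₗ H)) a ∈ B1
    rw [e]; exact this
  · rintro ⟨h1, h2, h3⟩ ⟨a, b⟩ h
    replace h := mem_NH.1 h
    rw [Ex_T]
    refine mem_NH.2 ⟨h1 _ h.1, ?_⟩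
    have e : B.T b + c a - H (A.T a) = B.T (b - H a) + (c - (H ∘ₗ A.T - B.T ∘ₗ H)) a := by simp; abel
    rw [e]
    exact B1.add_mem (h2 _ h.2) (mem_SS.1 h3 _ h.1)

def shear {A B : Mo F} (H : Hm A B) : (A.V × B.V) ≃ₗ[F] (A.V × B.V) where
  toFun x := (x.1, x.2 - H x.1)
  invFun x := (x.1, x.2 + H x.1)
  map_add' x y := by ext <;> simp; abel
  map_smul' r x := by ext <;> simp [smul_sub]
  left_inv x := by simp
  right_inv x := by simp

lemma shear_T {A B : Mo F} (H c : Hm A B) (v : A.V × B.V) :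
    shear H ((Ex A B c).T v) = (Ex A B (c - (H ∘ₗ A.T - B.T ∘ₗ H))).T (shear H v) := by
  obtain ⟨a, b⟩ := v
  show ((A.T a, B.T b + c a - H (A.T a)) : A.V × B.V) =
    (A.T a, B.T (b - H a) + (c - (H ∘ₗ A.T - B.T ∘ₗ H)) a)
  ext <;> simp; abel

lemma shear_NH {A B : Mo F} (A1 : Submodule F A.V) (B1 : Submodule F B.V) (H : Hm A B) :
    (NH A1 B1 H).map (shear H : (A.V × B.V) →ₗ[F] (A.V × B.V)) = NH A1 B1 0 := by
  ext ⟨a, b⟩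
  constructor
  · rintro ⟨⟨a', b'⟩, h, e⟩
    have e' : (a', b' - H a') = (a, b) := e
    rw [← e']
    exact mem_NH.2 (by simpa using mem_NH.1 h)
  · intro h
    refine ⟨(a, b + H a), mem_NH.2 ?_, ?_⟩
    · simpa using mem_NH.1 h
    · show (a, b + H a - H a) = (a, b)
      simp

def resC {A B : Mo F} (A1 : St A) (B1 : St B) (c : Hm A B) (hc : c ∈ SS A1.1 B1.1) :
    (sub A A1).V →ₗ[F] (sub B B1).V := c.restrict hc
def quoC {A B : Mo F} (A1 : St A) (B1 : St B) (c : Hm A B) (hc : c ∈ SS A1.1 B1.1) :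
    (quo A A1).V →ₗ[F] (quo B B1).V := A1.1.mapQ B1.1 c hc

lemma iso_sub_Ex {A B : Mo F} (A1 : St A) (B1 : St B) (c : Hm A B) (hc : c ∈ SS A1.1 B1.1) :
    Iso (sub (Ex A B c) (PrSt A1 B1 c hc)) (Ex (sub A A1) (sub B B1) (resC A1 B1 c hc)) := by
  have h : ∀ x : NH A1.1 B1.1 (0 : Hm A B), x.1.1 ∈ A1.1 ∧ x.1.2 ∈ B1.1 := by
    rintro ⟨⟨a, b⟩, hx⟩
    simpa using mem_NH.1 hx
  let e : (NH A1.1 B1.1 (0 : Hm A B)) ≃ₗ[F] (A1.1 × B1.1) :=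
    { toFun := fun x => (⟨x.1.1, (h x).1⟩, ⟨x.1.2, (h x).2⟩)
      invFun := fun y => ⟨(y.1.1, y.2.1), mem_NH.2 (by simp)⟩
      map_add' := fun x y => rfl
      map_smul' := fun r x => rfl
      left_inv := fun x => rfl
      right_inv := fun x => rfl }
  exact ⟨e, fun v => rfl⟩

lemma iso_quo_Ex {A B : Mo F} (A1 : St A) (B1 : St B) (c : Hm A B) (hc : c ∈ SS A1.1 B1.1) :
    Iso (quo (Ex A B c) (PrSt A1 B1 c hc)) (Ex (quo A A1) (quo B B1) (quoC A1 B1 c hc)) := by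
  let φ : (A.V × B.V) →ₗ[F] ((A.V ⧸ A1.1) × (B.V ⧸ B1.1)) := A1.1.mkQ.prodMap B1.1.mkQ
  have hs : Surjective φ := by
    rintro ⟨x, y⟩
    obtain ⟨x, rfl⟩ := A1.1.mkQ_surjective x
    obtain ⟨y, rfl⟩ := B1.1.mkQ_surjective y
    exact ⟨(x, y), rfl⟩
  have hk : NH A1.1 B1.1 (0 : Hm A B) = ker φ := by
    ext ⟨a, b⟩
    rw [mem_NH, LinearMap.mem_ker]
    simp [φ]
  refine ⟨(quotEquivOfEq _ _ hk).trans (φ.quotKerEquivOfSurjective hs), fun v => ?_⟩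
  obtain ⟨v, rfl⟩ := Submodule.Quotient.mk_surjective _ v
  rfl

lemma resquo_surj {A B : Mo F} (A1 : St A) (B1 : St B) (c1 : (sub A A1).V →ₗ[F] (sub B B1).V)
    (c2 : (quo A A1).V →ₗ[F] (quo B B1).V) :
    ∃ (c : Hm A B) (hc : c ∈ SS A1.1 B1.1), resC A1 B1 c hc = c1 ∧ quoC A1 B1 c hc = c2 := by
  let c1 : A1.1 →ₗ[F] B1.1 := c1
  let c2 : (A.V ⧸ A1.1) →ₗ[F] (B.V ⧸ B1.1) := c2
  obtain ⟨d1, hd1⟩ := LinearMap.exists_extend (B1.1.subtype ∘ₗ c1)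
  have hd1' : ∀ x : A1.1, d1 x.1 = (c1 x).1 := fun x => LinearMap.congr_fun hd1 x
  obtain ⟨s, hs⟩ := LinearMap.exists_rightInverse_of_surjective B1.1.mkQ B1.1.range_mkQ
  have hs' : ∀ y, B1.1.mkQ (s y) = y := fun y => LinearMap.congr_fun hs y
  let e : A.V →ₗ[F] (B.V ⧸ B1.1) := c2 ∘ₗ A1.1.mkQ - B1.1.mkQ ∘ₗ d1
  have he : ∀ a ∈ A1.1, e a = 0 := by
    intro a ha
    have h1 : A1.1.mkQ a = 0 := by simpa using ha
    have h2 : B1.1.mkQ (d1 a) = 0 := by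
      rw [hd1' ⟨a, ha⟩]; simp
    simp only [e, LinearMap.sub_apply, LinearMap.comp_apply, h1, h2]; simp
  let c := d1 + s ∘ₗ e
  have hca : ∀ x : A1.1, c x.1 = (c1 x).1 := by
    intro x
    simp [c, he _ x.2, hd1']
  have hc : c ∈ SS A1.1 B1.1 := by
    intro a ha
    show c a ∈ B1.1
    rw [hca ⟨a, ha⟩]; exact (c1 _).2
  refine ⟨c, hc, ?_, ?_⟩
  · ext x
    exact Subtype.ext (hca x)
  · refine LinearMap.ext fun x => ?_
    obtain ⟨x, rfl⟩ := A1.1.mkQ_surjective x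
    show B1.1.mkQ (c x) = c2 (A1.1.mkQ x)
    simp only [c, LinearMap.add_apply, map_add, LinearMap.comp_apply, hs']
    simp [e]

end Green

section Green2
variable {F : Type} [Field F]

open Classical in
lemma sum_dsub {α : Type*} [Fintype α] (P : α → Prop) [Fintype {x // P x}] (ψ : {x // P x} → ℂ) :
    ∑ x, ψ x = ∑ x, if h : P x then ψ ⟨x, h⟩ else 0 := by
  have : ∀ x : {x // P x}, ψ x = (fun x => if h : P x then ψ ⟨x, h⟩ else 0) x.1 := by
    intro x; simp [x.2]
  rw [Fintype.sum_congr _ _ this,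
    ← Finset.sum_subtype (s := Finset.univ.filter P) (by simp) (fun x => if h : P x then ψ ⟨x, h⟩ else 0),
    Finset.sum_filter]
  refine sum_congr rfl fun x _ => ?_
  by_cases h : P x <;> simp [h]

open Classical in
noncomputable def gphi (f g : CF F) (A B : Mo F) (c : Hm A B)
    (N : Submodule F (A.V × B.V)) : ℂ :=
  if h : ∀ v ∈ N, (Ex A B c).T v ∈ N then
    f (quo (Ex A B c) ⟨N, h⟩) * g (sub (Ex A B c) ⟨N, h⟩) else 0

lemma gphi_shear {f g : CF F} (hf : Inv f) (hg : Inv g) (A B : Mo F) (c H : Hm A B)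
    (A1 : Submodule F A.V) (B1 : Submodule F B.V) :
    gphi f g A B c (NH A1 B1 H) = gphi f g A B (c - (H ∘ₗ A.T - B.T ∘ₗ H)) (NH A1 B1 0) := by
  classical
  have e1 : (∀ v ∈ NH A1 B1 H, (Ex A B c).T v ∈ NH A1 B1 H) ↔
     (∀ v ∈ NH A1 B1 0, (Ex A B (c - (H ∘ₗ A.T - B.T ∘ₗ H))).T v ∈ NH A1 B1 0) := by
    rw [stable_NH, stable_NH]; simp
  unfold gphi
  by_cases h : ∀ v ∈ NH A1 B1 H, (Ex A B c).T v ∈ NH A1 B1 H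
  · rw [dif_pos h, dif_pos (e1.1 h)]
    rw [hf _ _ (iso_quo (M := Ex A B c) (M' := Ex A B (c - (H ∘ₗ A.T - B.T ∘ₗ H))) (shear H)
      (shear_T H c) ⟨_, h⟩ ⟨_, e1.1 h⟩ (shear_NH A1 B1 H)),
      hg _ _ (iso_sub (M := Ex A B c) (M' := Ex A B (c - (H ∘ₗ A.T - B.T ∘ₗ H))) (shear H)
      (shear_T H c) ⟨_, h⟩ ⟨_, e1.1 h⟩ (shear_NH A1 B1 H))]
  · rw [dif_neg h, dif_neg (mt e1.2 h)]

lemma sum_gphi {f g : CF F} (hf : Inv f) (hg : Inv g) (A B : Mo F)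
    (A1 : St A) (B1 : St B) :
    (Nat.card (SS A1.1 B1.1) : ℂ)⁻¹ * ∑ c, gphi f g A B c (NH A1.1 B1.1 0) =
      De f (quo A A1) (quo B B1) * De g (sub A A1) (sub B B1) := by
  classical
  haveI : Fintype (SS A1.1 B1.1) := ofFinite _
  have h1 : ∑ c, gphi f g A B c (NH A1.1 B1.1 0) = ∑ c : SS A1.1 B1.1,
      f (Ex (quo A A1) (quo B B1) (quoC A1 B1 c.1 c.2)) *
      g (Ex (sub A A1) (sub B B1) (resC A1 B1 c.1 c.2)) := by
    rw [sum_dsub (fun c => c ∈ SS A1.1 B1.1)]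
    refine sum_congr rfl fun c _ => ?_
    have e : (∀ v ∈ NH A1.1 B1.1 0, (Ex A B c).T v ∈ NH A1.1 B1.1 0) ↔ c ∈ SS A1.1 B1.1 := by
      rw [stable_NH]; simp
      exact ⟨fun h => h.2.2, fun h => ⟨A1.2, B1.2, h⟩⟩
    unfold gphi
    by_cases h : c ∈ SS A1.1 B1.1
    · rw [dif_pos h, dif_pos (e.2 h)]
      rw [← hf _ _ (iso_quo_Ex A1 B1 c h), ← hg _ _ (iso_sub_Ex A1 B1 c h)]
      rfl
    · rw [dif_neg h, dif_neg (mt e.1 h)]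
  let p : SS A1.1 B1.1 →+ ((quo A A1).V →ₗ[F] (quo B B1).V) × ((sub A A1).V →ₗ[F] (sub B B1).V) :=
    { toFun := fun c => (quoC A1 B1 c.1 c.2, resC A1 B1 c.1 c.2)
      map_zero' := by
        refine Prod.ext ?_ ?_
        · refine LinearMap.ext fun x => ?_
          obtain ⟨x, rfl⟩ := A1.1.mkQ_surjective x
          rfl
        · rfl
      map_add' := fun c d => by
        refine Prod.ext ?_ ?_
        · refine LinearMap.ext fun x => ?_
          obtain ⟨x, rfl⟩ := A1.1.mkQ_surjective x
          rfl
        · rfl }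
  have hp : Surjective p := by
    rintro ⟨c2, c1⟩
    obtain ⟨c, hc, h1, h2⟩ := resquo_surj A1 B1 c1 c2
    exact ⟨⟨c, hc⟩, Prod.ext h2 h1⟩
  have h2 := av_surj p hp (fun x => f (Ex (quo A A1) (quo B B1) x.1) * g (Ex (sub A A1) (sub B B1) x.2))
  rw [av_prod (fun c => f (Ex (quo A A1) (quo B B1) c)) (fun c => g (Ex (sub A A1) (sub B B1) c))] at h2
  unfold De
  rw [← h2, h1, Nat.card_eq_fintype_card]
  rfl

theorem green {f g : CF F} (hf : Inv f) (hg : Inv g) (A B : Mo F) :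
    De (hm f g) A B = ∑ A1 : St A, ∑ B1 : St B,
      De f (quo A A1) (quo B B1) * De g (sub A A1) (sub B B1) := by
  classical
  have h0 : ∀ c, hm f g (Ex A B c) = ∑ N : Submodule F (A.V × B.V), gphi f g A B c N := by
    intro c
    unfold hm
    rw [sum_dsub (fun N : Submodule F (Ex A B c).V => ∀ v ∈ N, (Ex A B c).T v ∈ N)]
    rfl
  have h1 : ∀ (A1 : Submodule F A.V) (B1 : Submodule F B.V),
      ∑ c, ∑ H, gphi f g A B c (NH A1 B1 H) =
        Fintype.card (Hm A B) * ∑ c, gphi f g A B c (NH A1 B1 0) := by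
    intro A1 B1
    rw [sum_comm]
    have : ∀ H, ∑ c, gphi f g A B c (NH A1 B1 H) = ∑ c, gphi f g A B c (NH A1 B1 0) := by
      intro H
      exact sum_equiv (Equiv.subRight (H ∘ₗ A.T - B.T ∘ₗ H)) _ _
        (fun c => gphi_shear hf hg A B c H A1 B1)
    simp [this]
  have h2 : De (hm f g) A B = ∑ A1 : Submodule F A.V, ∑ B1 : Submodule F B.V,
      (Nat.card (SS A1 B1) : ℂ)⁻¹ * ∑ c, gphi f g A B c (NH A1 B1 0) := by
    unfold De av
    simp only [h0, sum_sub]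
    rw [sum_comm, mul_sum]
    refine sum_congr rfl fun A1 _ => ?_
    rw [sum_comm, mul_sum]
    refine sum_congr rfl fun B1 _ => ?_
    rw [← mul_sum, h1]
    have : (Fintype.card (Hm A B) : ℂ) ≠ 0 := by exact_mod_cast card_ne_zero
    field_simp
  rw [h2, sum_dsub (fun N : Submodule F A.V => ∀ v ∈ N, A.T v ∈ N)]
  refine sum_congr rfl fun A1 _ => ?_
  have hz : ∀ B1 : Submodule F B.V, ¬ ((∀ v ∈ A1, A.T v ∈ A1) ∧ (∀ v ∈ B1, B.T v ∈ B1)) →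
      (Nat.card (SS A1 B1) : ℂ)⁻¹ * ∑ c, gphi f g A B c (NH A1 B1 0) = 0 := by
    intro B1 h
    rw [sum_eq_zero, mul_zero]
    intro c _
    unfold gphi
    rw [dif_neg]
    rw [stable_NH]
    exact fun h' => h ⟨h'.1, h'.2.1⟩
  split_ifs with hA
  · rw [sum_dsub (fun N : Submodule F B.V => ∀ v ∈ N, B.T v ∈ N)]
    refine sum_congr rfl fun B1 _ => ?_
    split_ifs with hB
    · exact sum_gphi hf hg A B ⟨A1, hA⟩ ⟨B1, hB⟩
    · exact hz B1 fun h => hB h.2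
  · exact sum_eq_zero fun B1 _ => hz B1 fun h => hA h.1

end Green2

section Adj
variable {F : Type} [Field F]

def Inv2 (Φ : Mo F → CF F) : Prop := ∀ A A' B B', Iso A A' → Iso B B' → Φ A B = Φ A' B'

lemma Inv2.left {Φ : Mo F → CF F} (h : Inv2 Φ) (B : Mo F) : Inv fun A => Φ A B :=
  fun A A' e => h _ _ _ _ e (Iso.refl _)
lemma Inv2.right {Φ : Mo F → CF F} (h : Inv2 Φ) (A : Mo F) : Inv fun B => Φ A B :=
  fun A A' e => h _ _ _ _ (Iso.refl _) e
lemma Inv.box {f g : CF F} (h : Inv f) (h' : Inv g) : Inv2 fun A B => f A * g B :=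
  fun A A' B B' e e' => by simp only [h _ _ e, h' _ _ e']
lemma Inv.conj {f : CF F} (h : Inv f) : Inv fun A => conj (f A) :=
  fun A A' e => by simp only [h _ _ e]

lemma De_inv {f : CF F} (hf : Inv f) : Inv2 (De f) := by
  rintro A A' B B' ⟨e, he⟩ ⟨e', he'⟩
  unfold De
  refine av_equiv (e.arrowCongr e').toEquiv _ _ fun c => ?_
  refine hf _ _ ⟨e.prodCongr e', fun v => ?_⟩
  obtain ⟨a, b⟩ := v
  show ((e (A.T a), e' (B.T b + c a)) : A'.V × B'.V) = (A'.T (e a), B'.T (e' b) + e' (c (e.symm (e a))))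
  simp [he, he']

lemma De_zero_left {f : CF F} (hf : Inv f) (A B : Mo F) (hA : Subsingleton A.V) :
    De f A B = f B := by
  have : ∀ c, f (Ex A B c) = f B := by
    intro c
    refine hf _ _ ⟨⟨snd F A.V B.V, fun b => (0, b), fun x => ?_, fun b => rfl⟩, fun v => ?_⟩
    · exact Prod.ext (Subsingleton.elim _ _) rfl
    · obtain ⟨a, b⟩ := v
      show B.T b + c a = B.T b
      rw [Subsingleton.elim a 0]; simp
  unfold De av
  simp only [this]
  have h : (Fintype.card (Hm A B) : ℂ) ≠ 0 := by exact_mod_cast card_ne_zero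
  simp only [sum_const, card_univ, nsmul_eq_mul]; field_simp

lemma De_zero_right {f : CF F} (hf : Inv f) (A B : Mo F) (hB : Subsingleton B.V) :
    De f A B = f A := by
  have : ∀ c, f (Ex A B c) = f A := by
    intro c
    refine hf _ _ ⟨⟨fst F A.V B.V, fun b => (b, 0), fun x => ?_, fun b => rfl⟩, fun v => ?_⟩
    · exact Prod.ext rfl (Subsingleton.elim _ _)
    · obtain ⟨a, b⟩ := v
      rfl
  unfold De av
  simp only [this]
  have h : (Fintype.card (Hm A B) : ℂ) ≠ 0 := by exact_mod_cast card_ne_zero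
  simp only [sum_const, card_univ, nsmul_eq_mul]; field_simp

noncomputable def hm2 (Φ : Mo F → CF F) (M : Mo F) : ℂ := ∑ N : St M, Φ (quo M N) (sub M N)

variable [Finite F]

abbrev std (n : ℕ) (T : (Fin n → F) →ₗ[F] (Fin n → F)) : Mo F := ⟨Fin n → F, T⟩

instance finEquiv (A B : Type) [AddCommGroup A] [Module F A] [AddCommGroup B] [Module F B]
    [Finite A] [Finite B] : Finite (A ≃ₗ[F] B) :=
  Finite.of_injective (fun f : A ≃ₗ[F] B => (f : A → B)) DFunLike.coe_injective

noncomputable instance fintEquiv (A B : Type) [AddCommGroup A] [Module F A] [AddCommGroup B] [Module F B]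
    [Finite A] [Finite B] : Fintype (A ≃ₗ[F] B) := ofFinite _

variable (F) in
noncomputable def gl (n : ℕ) : ℂ := Fintype.card ((Fin n → F) ≃ₗ[F] (Fin n → F))

lemma gl_ne (n : ℕ) : gl F n ≠ 0 := by
  have : Nonempty ((Fin n → F) ≃ₗ[F] (Fin n → F)) := ⟨LinearEquiv.refl _ _⟩
  unfold gl; exact_mod_cast card_ne_zero

noncomputable def Q (n : ℕ) (φ : CF F) : ℂ := (gl F n)⁻¹ * ∑ T, φ (std n T)

def N0 (a b : ℕ) : Submodule F ((Fin a → F) × (Fin b → F)) := ker (fst F _ _)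

lemma mem_N0 {a b : ℕ} {x : (Fin a → F) × (Fin b → F)} : x ∈ N0 (F := F) a b ↔ x.1 = 0 := Iff.rfl

lemma exists_k {V : Type} [AddCommGroup V] [Module F V] [Finite V] {a b : ℕ}
    (hV : finrank F V = a + b) (N : Submodule F V) (hN : finrank F N = b) :
    ∃ k : ((Fin a → F) × (Fin b → F)) ≃ₗ[F] V, (N0 a b).map (k : _ →ₗ[F] V) = N := by
  obtain ⟨N', hN'⟩ := Submodule.exists_isCompl N
  haveI : Module.Finite F V := Module.Finite.of_finite
  have h1 : finrank F N' = a := by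
    have := Submodule.finrank_add_eq_of_isCompl hN'
    omega
  have e1 : (Fin a → F) ≃ₗ[F] N' := ofFinrankEq _ _ (by simp [h1])
  have e2 : (Fin b → F) ≃ₗ[F] N := ofFinrankEq _ _ (by simp [hN])
  refine ⟨(e1.prodCongr e2).trans (Submodule.prodEquivOfIsCompl N' N hN'.symm), ?_⟩
  ext v
  constructor
  · rintro ⟨⟨x, y⟩, hx, rfl⟩
    have hx : x = 0 := hx
    subst hx
    simp
  · intro hv
    refine ⟨(0, e2.symm ⟨v, hv⟩), rfl, ?_⟩
    simp

open Classical in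
lemma card_k {V : Type} [AddCommGroup V] [Module F V] [Finite V] {a b : ℕ}
    (hV : finrank F V = a + b) (N : Submodule F V) (hN : finrank F N = b) :
    (Fintype.card {k : ((Fin a → F) × (Fin b → F)) ≃ₗ[F] V // (N0 a b).map (k : _ →ₗ[F] V) = N} : ℂ) =
      gl F a * gl F b * Fintype.card ((Fin a → F) →ₗ[F] (Fin b → F)) := by
  obtain ⟨k0, hk0⟩ := exists_k hV N hN
  unfold gl
  norm_cast
  rw [← card_prod, ← card_prod]
  symm
  refine Fintype.card_of_bijective (f := fun x =>
    ⟨(LinearEquiv.skewProd x.1.1 x.1.2 x.2).trans k0, ?_⟩) ⟨?_, ?_⟩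
  · rw [LinearEquiv.coe_trans, Submodule.map_comp, ← hk0]
    congr 1
    ext ⟨u, v⟩
    constructor
    · rintro ⟨⟨u', v'⟩, h, e⟩
      have h : u' = 0 := h
      subst h
      have := congrArg Prod.fst e
      simp at this
      exact this.symm
    · intro h
      have h : u = 0 := h
      subst h
      exact ⟨(0, x.1.2.symm v), rfl, by simp⟩
  · rintro ⟨⟨α, δ⟩, c⟩ ⟨⟨α', δ'⟩, c'⟩ h
    have h1 : ∀ u v, (α u, δ v + c u) = (α' u, δ' v + c' u) := by
      intro u v
      have := LinearEquiv.congr_fun (congrArg Subtype.val h) (u, v)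
      simpa using this
    have ha : α = α' := LinearEquiv.ext fun u => congrArg Prod.fst (h1 u 0)
    have hc : c = c' := LinearMap.ext fun u => by simpa using congrArg Prod.snd (h1 u 0)
    have hd : δ = δ' := LinearEquiv.ext fun v => by simpa using congrArg Prod.snd (h1 0 v)
    rw [ha, hc, hd]
  · rintro ⟨k, hk⟩
    let t : ((Fin a → F) × (Fin b → F)) ≃ₗ[F] ((Fin a → F) × (Fin b → F)) := k.trans k0.symm
    have ht : ∀ v, (t (0, v)).1 = 0 := by
      intro v
      have : k (0, v) ∈ (N0 a b).map (k0 : _ →ₗ[F] V) := by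
        rw [hk0, ← hk]; exact ⟨(0, v), rfl, rfl⟩
      obtain ⟨x, hx, e⟩ := this
      have : t (0, v) = x := by
        show k0.symm (k (0, v)) = x
        rw [← e]; simp
      rw [this]; exact hx
    let α0 : (Fin a → F) →ₗ[F] (Fin a → F) := fst F _ _ ∘ₗ t.toLinearMap ∘ₗ inl F _ _
    let δ0 : (Fin b → F) →ₗ[F] (Fin b → F) := snd F _ _ ∘ₗ t.toLinearMap ∘ₗ inr F _ _
    let c : (Fin a → F) →ₗ[F] (Fin b → F) := snd F _ _ ∘ₗ t.toLinearMap ∘ₗ inl F _ _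
    have hsplit : ∀ u v, t (u, v) = (α0 u, δ0 v + c u) := by
      intro u v
      have : ((u, v) : (Fin a → F) × (Fin b → F)) = (u, 0) + (0, v) := by simp
      rw [this, map_add]
      refine Prod.ext ?_ ?_
      · simp [ht, α0]
      · simp [δ0, c, add_comm]
    have hα : Surjective α0 := by
      intro x
      obtain ⟨⟨u, v⟩, h⟩ := t.surjective (x, 0)
      rw [hsplit] at h
      exact ⟨u, congrArg Prod.fst h⟩
    have hδ : Injective δ0 := by
      intro v v' h
      have : t (0, v) = t (0, v') := by rw [hsplit, hsplit, h]
      simpa using t.injective this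
    let α := LinearEquiv.ofBijective α0 ⟨(Finite.injective_iff_surjective).2 hα, hα⟩
    let δ := LinearEquiv.ofBijective δ0 ⟨hδ, (Finite.injective_iff_surjective).1 hδ⟩
    refine ⟨⟨⟨α, δ⟩, c⟩, Subtype.ext (LinearEquiv.ext fun x => ?_)⟩
    obtain ⟨u, v⟩ := x
    show k0 (α0 u, δ0 v + c u) = k (u, v)
    rw [← hsplit]; simp [t]

open Classical in
noncomputable def psi (Φ : Mo F → CF F) (h : CF F) (V : Type) [AddCommGroup V] [Module F V] [Finite V]
    (N : Submodule F V) : ℂ :=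
  ∑ T : {T : V →ₗ[F] V // ∀ v ∈ N, T v ∈ N}, 
    Φ (quo ⟨V, T.1⟩ ⟨N, T.2⟩) (sub ⟨V, T.1⟩ ⟨N, T.2⟩) * h ⟨V, T.1⟩

lemma psi_k {Φ : Mo F → CF F} (hΦ : Inv2 Φ) {h : CF F} (hh : Inv h) {V : Type} [AddCommGroup V]
    [Module F V] [Finite V] {a b : ℕ} (k : ((Fin a → F) × (Fin b → F)) ≃ₗ[F] V) :
    psi Φ h V ((N0 a b).map (k : _ →ₗ[F] V)) =
      ∑ S, ∑ T, ∑ c, Φ (std a S) (std b T) * h (Ex (std a S) (std b T) c) := by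
  classical
  unfold psi
  have hR : (∑ S, ∑ T, ∑ c, Φ (std a S) (std b T) * h (Ex (std a S) (std b T) c)) =
      ∑ x : (((Fin a → F) →ₗ[F] (Fin a → F)) × ((Fin b → F) →ₗ[F] (Fin b → F))) ×
        ((Fin a → F) →ₗ[F] (Fin b → F)), Φ (std a x.1.1) (std b x.1.2) * h (Ex (std a x.1.1) (std b x.1.2) x.2) := by
    rw [sum_prod_type, sum_prod_type]
  rw [hR]
  symm
  let tri : ((((Fin a → F) →ₗ[F] (Fin a → F)) × ((Fin b → F) →ₗ[F] (Fin b → F))) × ((Fin a → F) →ₗ[F] (Fin b → F))) →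
      (((Fin a → F) × (Fin b → F)) →ₗ[F] ((Fin a → F) × (Fin b → F))) := fun x =>
    (x.1.1 ∘ₗ fst F _ _).prod (x.1.2 ∘ₗ snd F _ _ + x.2 ∘ₗ fst F _ _)
  have htri : ∀ x u v, tri x (u, v) = (x.1.1 u, x.1.2 v + x.2 u) := fun _ _ _ => rfl
  have hst : ∀ x, ∀ v ∈ (N0 a b).map (k : _ →ₗ[F] V),
      (k.toLinearMap ∘ₗ tri x ∘ₗ k.symm.toLinearMap) v ∈ (N0 a b).map (k : _ →ₗ[F] V) := by
    rintro x _ ⟨⟨u, v⟩, hu, rfl⟩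
    have hu : u = 0 := hu
    subst hu
    refine ⟨tri x (0, v), ?_, by simp⟩
    rw [htri]; simp [mem_N0]
  have hk : ∀ x (w : (Fin a → F) × (Fin b → F)), k (tri x w) = (k.toLinearMap ∘ₗ tri x ∘ₗ k.symm.toLinearMap) (k w) := by
    intro x w; simp
  refine Fintype.sum_bijective (fun x => ⟨k.toLinearMap ∘ₗ tri x ∘ₗ k.symm.toLinearMap, hst x⟩) ⟨?_, ?_⟩ _ _ ?_
  · intro x y hxy
    have h1 : ∀ w, tri x w = tri y w := by
      intro w
      apply k.injective
      rw [hk, hk]; exact LinearMap.congr_fun (congrArg Subtype.val hxy) (k w)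
    have h2 : ∀ u v, (x.1.1 u, x.1.2 v + x.2 u) = (y.1.1 u, y.1.2 v + y.2 u) := fun u v => h1 (u, v)
    have ha : x.1.1 = y.1.1 := LinearMap.ext fun u => congrArg Prod.fst (h2 u 0)
    have hc : x.2 = y.2 := LinearMap.ext fun u => by simpa using congrArg Prod.snd (h2 u 0)
    have hd : x.1.2 = y.1.2 := LinearMap.ext fun v => by simpa using congrArg Prod.snd (h2 0 v)
    exact Prod.ext (Prod.ext ha hd) hc
  · rintro ⟨T, hT⟩
    let t := k.symm.toLinearMap ∘ₗ T ∘ₗ k.toLinearMap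
    have ht : ∀ v, (t (0, v)).1 = 0 := by
      intro v
      obtain ⟨x, hx, e⟩ := hT (k (0, v)) ⟨(0, v), rfl, rfl⟩
      have : t (0, v) = x := by
        show k.symm (T (k (0, v))) = x
        rw [← e]; simp
      rw [this]; exact hx
    let α0 : (Fin a → F) →ₗ[F] (Fin a → F) := fst F _ _ ∘ₗ t ∘ₗ inl F _ _
    let δ0 : (Fin b → F) →ₗ[F] (Fin b → F) := snd F _ _ ∘ₗ t ∘ₗ inr F _ _
    let c : (Fin a → F) →ₗ[F] (Fin b → F) := snd F _ _ ∘ₗ t ∘ₗ inl F _ _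
    have hsplit : ∀ u v, t (u, v) = (α0 u, δ0 v + c u) := by
      intro u v
      have : ((u, v) : (Fin a → F) × (Fin b → F)) = (u, 0) + (0, v) := by simp
      rw [this, map_add]
      refine Prod.ext ?_ ?_
      · simp [ht, α0]
      · simp [δ0, c, add_comm]
    refine ⟨⟨⟨α0, δ0⟩, c⟩, Subtype.ext (LinearMap.ext fun x => ?_)⟩
    obtain ⟨⟨u, v⟩, rfl⟩ := k.surjective x
    rw [← hk]
    show k (α0 u, δ0 v + c u) = T (k (u, v))
    rw [← hsplit]
    simp [t]
  · rintro ⟨⟨S, T⟩, c⟩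
    have hc : c ∈ SS (A := std a S) (B := std b T) ⊥ ⊤ := fun x _ => trivial
    let P0 : St (Ex (std a S) (std b T) c) := ⟨N0 a b, by
      rintro ⟨u, v⟩ hu
      have hu : u = 0 := hu
      subst hu
      show S 0 = 0
      simp⟩
    let M' : Mo F := ⟨V, k.toLinearMap ∘ₗ tri ⟨⟨S, T⟩, c⟩ ∘ₗ k.symm.toLinearMap⟩
    have e1 : Iso (Ex (std a S) (std b T) c) M' := ⟨k, hk ⟨⟨S, T⟩, c⟩⟩
    have e2 : Iso (quo (Ex (std a S) (std b T) c) P0) (quo M' ⟨_, hst _⟩) :=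
      iso_quo (M := Ex (std a S) (std b T) c) (M' := M') k (hk ⟨⟨S, T⟩, c⟩) P0 ⟨_, hst _⟩ rfl
    have e3 : Iso (sub (Ex (std a S) (std b T) c) P0) (sub M' ⟨_, hst _⟩) :=
      iso_sub (M := Ex (std a S) (std b T) c) (M' := M') k (hk ⟨⟨S, T⟩, c⟩) P0 ⟨_, hst _⟩ rfl
    have e4 : Iso (std a S) (quo (Ex (std a S) (std b T) c) P0) := by
      apply Iso.symm
      refine ⟨(fst F (Fin a → F) (Fin b → F)).quotKerEquivOfSurjective LinearMap.fst_surjective, fun v => ?_⟩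
      obtain ⟨v, rfl⟩ := Submodule.Quotient.mk_surjective _ v
      rfl
    have e5 : Iso (std b T) (sub (Ex (std a S) (std b T) c) P0) := by
      refine ⟨⟨(inr F (Fin a → F) (Fin b → F)).codRestrict (N0 a b) (fun v => rfl),
        fun x => x.1.2, fun x => rfl, ?_⟩, fun v => ?_⟩
      · rintro ⟨⟨u, v⟩, hu⟩
        have hu : u = 0 := hu
        subst hu
        rfl
      · apply Subtype.ext
        show ((0 : Fin a → F), T v) = (S 0, T v + c 0)
        simp
    show Φ (std a S) (std b T) * h (Ex (std a S) (std b T) c) = _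
    rw [hh _ _ e1, hΦ _ _ _ _ (e4.trans e2) (e5.trans e3)]

theorem adj {Φ : Mo F → CF F} (hΦ : Inv2 Φ) {h : CF F} (hh : Inv h) (n : ℕ) :
    Q n (fun M => hm2 Φ M * h M) = ∑ x ∈ antidiagonal n,
      Q x.1 (fun A => Q x.2 (fun B => Φ A B * De h A B)) := by
  classical
  have h1 : ∀ T, hm2 Φ (std n T) * h (std n T) = ∑ N : Submodule F (Fin n → F),
      if hN : ∀ v ∈ N, T v ∈ N then Φ (quo (std n T) ⟨N, hN⟩) (sub (std n T) ⟨N, hN⟩) * h (std n T) else 0 := by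
    intro T
    unfold hm2
    rw [sum_mul]
    convert sum_dsub (fun N : Submodule F (Fin n → F) => ∀ v ∈ N, T v ∈ N)
      (fun N => Φ (quo (std n T) N) (sub (std n T) N) * h (std n T))
  have h2 : ∀ N : Submodule F (Fin n → F), psi Φ h (Fin n → F) N = ∑ T : (Fin n → F) →ₗ[F] (Fin n → F),
      if hN : ∀ v ∈ N, T v ∈ N then Φ (quo (std n T) ⟨N, hN⟩) (sub (std n T) ⟨N, hN⟩) * h (std n T) else 0 := by
    intro N
    unfold psi
    rw [sum_dsub (fun T : (Fin n → F) →ₗ[F] (Fin n → F) => ∀ v ∈ N, T v ∈ N)]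
  have h3 : Q n (fun M => hm2 Φ M * h M) = (gl F n)⁻¹ * ∑ N, psi Φ h (Fin n → F) N := by
    unfold Q
    simp only [h1, h2]
    rw [sum_comm]
  have h4 : ∀ x ∈ antidiagonal n,
      ∑ N ∈ Finset.univ.filter (fun N : Submodule F (Fin n → F) => (n - finrank F N, finrank F N) = x), psi Φ h (Fin n → F) N =
      gl F n * Q x.1 (fun A => Q x.2 (fun B => Φ A B * De h A B)) := by
    rintro ⟨a, b⟩ hab
    rw [Finset.HasAntidiagonal.mem_antidiagonal] at hab
    simp only at hab
    subst hab
    have hfil : (Finset.univ.filter fun N : Submodule F (Fin (a + b) → F) =>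
        (a + b - finrank F N, finrank F N) = (a, b)) =
        Finset.univ.filter fun N : Submodule F (Fin (a + b) → F) => finrank F N = b := by
      ext N; simp; omega
    rw [hfil]
    set P : ℂ := gl F a * gl F b * Fintype.card ((Fin a → F) →ₗ[F] (Fin b → F)) with hP
    have hP0 : P ≠ 0 := by
      refine mul_ne_zero (mul_ne_zero (gl_ne _) (gl_ne _)) ?_
      exact_mod_cast card_ne_zero
    set W := ∑ S, ∑ T, ∑ c, Φ (std a S) (std b T) * h (Ex (std a S) (std b T) c) with hW
    have hk1 : ∑ k : ((Fin a → F) × (Fin b → F)) ≃ₗ[F] (Fin (a + b) → F),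
        psi Φ h _ ((N0 a b).map (k : _ →ₗ[F] (Fin (a + b) → F))) = gl F (a + b) * W := by
      rw [sum_congr rfl fun k _ => psi_k hΦ hh k, sum_const, nsmul_eq_mul]
      congr 1
      unfold gl
      obtain ⟨k0⟩ : Nonempty (((Fin a → F) × (Fin b → F)) ≃ₗ[F] (Fin (a + b) → F)) :=
        ⟨ofFinrankEq _ _ (by simp)⟩
      rw [card_univ]
      norm_cast
      exact card_congr ⟨fun k => k0.symm.trans k, fun k => k0.trans k, fun k => by ext; simp,
        fun k => by ext; simp⟩
    have hk2 : ∑ k : ((Fin a → F) × (Fin b → F)) ≃ₗ[F] (Fin (a + b) → F),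
        psi Φ h _ ((N0 a b).map (k : _ →ₗ[F] (Fin (a + b) → F))) =
        ∑ N ∈ Finset.univ.filter (fun N : Submodule F (Fin (a + b) → F) => finrank F N = b), P * psi Φ h _ N := by
      rw [← Finset.sum_fiberwise_of_maps_to (s := univ)
        (t := Finset.univ.filter fun N : Submodule F (Fin (a + b) → F) => finrank F N = b)
        (g := fun k : ((Fin a → F) × (Fin b → F)) ≃ₗ[F] (Fin (a + b) → F) => (N0 a b).map (k : _ →ₗ[F] (Fin (a + b) → F)))]
      · refine sum_congr rfl fun N hN => ?_
        rw [sum_congr rfl (g := fun _ => psi Φ h _ N)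
          (by intro k hk; rw [(Finset.mem_filter.1 hk).2]), sum_const, nsmul_eq_mul,
          ← card_subtype, card_k (by simp) N (Finset.mem_filter.1 hN).2]
      · intro k _
        simp only [mem_filter, mem_univ, true_and]
        rw [LinearEquiv.finrank_map_eq]
        have := LinearMap.finrank_range_add_finrank_ker (fst F (Fin a → F) (Fin b → F))
        rw [LinearMap.range_eq_top.2 LinearMap.fst_surjective] at this
        simp at this
        exact this
    rw [← mul_sum, hk1] at hk2
    have hres : Q a (fun A => Q b (fun B => Φ A B * De h A B)) = P⁻¹ * W := by
      unfold Q De av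
      rw [hW, hP]
      simp only [mul_sum, mul_inv]
      refine sum_congr rfl fun S _ => sum_congr rfl fun T _ => sum_congr rfl fun c _ => ?_
      ring
    show _ = gl F (a + b) * Q a (fun A => Q b (fun B => Φ A B * De h A B))
    rw [hres]
    field_simp
    rw [hk2]; ring
  rw [h3, ← Finset.sum_fiberwise_of_maps_to (s := univ) (t := antidiagonal n)
    (g := fun N : Submodule F (Fin n → F) => (n - finrank F N, finrank F N)),
    sum_congr rfl h4, ← mul_sum, ← mul_assoc, inv_mul_cancel₀ (gl_ne n), one_mul]
  intro N _
  rw [Finset.HasAntidiagonal.mem_antidiagonal]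
  have : finrank F N ≤ n := by simpa using Submodule.finrank_le N
  simp; omega

end Adj

section BG
variable {F : Type} [Field F]

def xx (M : Mo F) : Module.End F M.V := M.T - 1
lemma xx_apply (M : Mo F) (v : M.V) : xx M v = M.T v - v := rfl
lemma T_eq (M : Mo F) (v : M.V) : M.T v = xx M v + v := by simp [xx_apply]

def Unip (M : Mo F) : Prop := ∃ k, ∀ v, (xx M ^ k) v = 0

lemma xx_pow_succ (M : Mo F) (k : ℕ) (v : M.V) : (xx M ^ (k+1)) v = xx M ((xx M ^ k) v) := by
  rw [pow_succ']; rfl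
lemma xx_pow_add (M : Mo F) (k l : ℕ) (v : M.V) : (xx M ^ (k+l)) v = (xx M ^ k) ((xx M ^ l) v) := by
  rw [pow_add]; rfl
lemma xx_zero_of_le {M : Mo F} {k l : ℕ} (h : k ≤ l) {v : M.V} (hv : (xx M ^ k) v = 0) : (xx M ^ l) v = 0 := by
  obtain ⟨m, rfl⟩ := Nat.exists_eq_add_of_le' h
  rw [xx_pow_add, hv, map_zero]

def cyc (M : Mo F) (v : M.V) : St M := ⟨Submodule.span F (Set.range fun i : ℕ => (xx M ^ i) v), by
  intro w hw
  induction hw using span_induction with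
  | mem x hx =>
    obtain ⟨i, rfl⟩ := hx
    rw [T_eq]
    refine Submodule.add_mem _ (subset_span ⟨i+1, ?_⟩) (subset_span ⟨i, rfl⟩)
    exact xx_pow_succ _ _ _
  | zero => simp
  | add x y _ _ hx hy => rw [map_add]; exact Submodule.add_mem _ hx hy
  | smul a x _ hx => rw [map_smul]; exact smul_mem _ _ hx⟩

lemma mem_cyc (M : Mo F) (v : M.V) : v ∈ (cyc M v).1 := subset_span ⟨0, rfl⟩

lemma xx_mem {M : Mo F} (N : St M) {v : M.V} (hv : v ∈ N.1) : xx M v ∈ N.1 :=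
  N.1.sub_mem (N.2 v hv) hv
lemma xx_pow_mem {M : Mo F} (N : St M) (k : ℕ) {v : M.V} (hv : v ∈ N.1) : (xx M ^ k) v ∈ N.1 := by
  induction k with
  | zero => exact hv
  | succ k ih => rw [xx_pow_succ]; exact xx_mem N ih

lemma iso_xx {M M' : Mo F} (e : M.V ≃ₗ[F] M'.V) (he : ∀ v, e (M.T v) = M'.T (e v)) (k : ℕ) (v : M.V) :
    e ((xx M ^ k) v) = (xx M' ^ k) (e v) := by
  induction k with
  | zero => rfl
  | succ k ih => rw [xx_pow_succ, xx_pow_succ, ← ih, xx_apply, xx_apply, map_sub, he]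

lemma unip_iso {M M' : Mo F} (h : Iso M M') : Unip M ↔ Unip M' := by
  have : ∀ {M M' : Mo F}, Iso M M' → Unip M → Unip M' := by
    rintro M M' ⟨e, he⟩ ⟨k, hk⟩
    refine ⟨k, fun v => ?_⟩
    obtain ⟨v, rfl⟩ := e.surjective v
    rw [← iso_xx e he, hk, map_zero]
  exact ⟨this h, this h.symm⟩

def sbv {M : Mo F} (N : St M) : (sub M N).V →ₗ[F] M.V := N.1.subtype
def mkv {M : Mo F} (N : St M) : M.V →ₗ[F] (quo M N).V := N.1.mkQ
lemma sbv_inj {M : Mo F} (N : St M) : Injective (sbv N) := N.1.subtype_injective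
lemma sbv_ex {M : Mo F} (N : St M) {v : M.V} (hv : v ∈ N.1) : ∃ w, sbv N w = v := ⟨⟨v, hv⟩, rfl⟩
lemma sbv_range {M : Mo F} (N : St M) : range (sbv N) = N.1 := Submodule.range_subtype _
lemma mkv_surj {M : Mo F} (N : St M) : Surjective (mkv N) := N.1.mkQ_surjective
lemma mkv_zero {M : Mo F} (N : St M) {v : M.V} : mkv N v = 0 ↔ v ∈ N.1 := Submodule.Quotient.mk_eq_zero _
lemma sbv_T {M : Mo F} (N : St M) (v) : sbv N ((sub M N).T v) = M.T (sbv N v) := rfl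
lemma mkv_T {M : Mo F} (N : St M) (v) : mkv N (M.T v) = (quo M N).T (mkv N v) := rfl

lemma sub_xx {M : Mo F} (N : St M) (k : ℕ) (v : (sub M N).V) :
    sbv N ((xx (sub M N) ^ k) v) = (xx M ^ k) (sbv N v) := by
  induction k with
  | zero => rfl
  | succ k ih =>
    rw [xx_pow_succ, xx_pow_succ, ← ih, xx_apply, xx_apply, map_sub, sbv_T]

lemma quo_xx {M : Mo F} (N : St M) (k : ℕ) (v : M.V) :
    (xx (quo M N) ^ k) (mkv N v) = mkv N ((xx M ^ k) v) := by
  induction k with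
  | zero => rfl
  | succ k ih =>
    rw [xx_pow_succ, ih, xx_pow_succ, xx_apply, xx_apply, map_sub, mkv_T]

lemma Unip.sub {M : Mo F} (h : Unip M) (N : St M) : Unip (sub M N) := by
  obtain ⟨k, hk⟩ := h
  refine ⟨k, fun v => sbv_inj N ?_⟩
  rw [sub_xx, hk, map_zero]
lemma Unip.quo {M : Mo F} (h : Unip M) (N : St M) : Unip (quo M N) := by
  obtain ⟨k, hk⟩ := h
  refine ⟨k, fun v => ?_⟩
  obtain ⟨v, rfl⟩ := mkv_surj N v
  rw [quo_xx, hk, map_zero]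
lemma Unip.of {M : Mo F} (N : St M) (hq : Unip (GLp.quo M N)) (hs : Unip (GLp.sub M N)) : Unip M := by
  obtain ⟨k, hk⟩ := hq
  obtain ⟨l, hl⟩ := hs
  refine ⟨l + k, fun v => ?_⟩
  rw [xx_pow_add]
  have h1 : (xx M ^ k) v ∈ N.1 := by
    have := hk (mkv N v)
    rwa [quo_xx, mkv_zero] at this
  obtain ⟨w, hw⟩ := sbv_ex N h1
  rw [← hw, ← sub_xx, hl, map_zero]

open Classical in
noncomputable def be (M : Mo F) : ℂ := if Unip M then (Nat.card {v : M.V // (cyc M v).1 = ⊤} : ℂ) else 0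

noncomputable def rk (M : Mo F) : ℕ := finrank F (M.V ⧸ range (xx M))

variable (F) in
noncomputable def qq : ℂ := (Nat.card F : ℂ)

variable (F) in
noncomputable def PP (r : ℕ) : ℂ := ∏ i ∈ Finset.range r, (1 - qq F ^ (i + 1))

open Classical in
noncomputable def ga (M : Mo F) : ℂ := if Unip M then PP F (rk M) else 0

lemma cyc_iso {M M' : Mo F} (e : M.V ≃ₗ[F] M'.V) (he : ∀ v, e (M.T v) = M'.T (e v)) (v : M.V) :
    (cyc M' (e v)).1 = (cyc M v).1.map (e : M.V →ₗ[F] M'.V) := by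
  unfold cyc
  simp only [Submodule.map_span]
  congr 1
  ext w
  constructor
  · rintro ⟨i, rfl⟩
    exact ⟨_, ⟨i, rfl⟩, iso_xx e he i v⟩
  · rintro ⟨_, ⟨i, rfl⟩, rfl⟩
    exact ⟨i, (iso_xx e he i v).symm⟩

lemma Inv.be : Inv (be : CF F) := by
  rintro M M' h
  have hu := unip_iso h
  obtain ⟨e, he⟩ := h
  unfold GLp.be
  by_cases hM : Unip M
  swap
  · rw [if_neg hM, if_neg (fun h => hM (hu.2 h))]
  rw [if_pos hM, if_pos (hu.1 hM)]
  congr 1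
  refine Nat.card_congr (e.toEquiv.subtypeEquiv fun v => ?_)
  show _ ↔ (cyc M' (e v)).1 = ⊤
  rw [cyc_iso e he]
  constructor
  · intro h; rw [h]; simp
  · intro h
    have := congrArg (Submodule.comap (e : M.V →ₗ[F] M'.V)) h
    rwa [Submodule.comap_map_eq_of_injective e.injective, Submodule.comap_top] at this

lemma rk_iso {M M' : Mo F} (h : Iso M M') : rk M = rk M' := by
  obtain ⟨e, he⟩ := h
  unfold rk
  refine LinearEquiv.finrank_eq (Submodule.Quotient.equiv _ _ e ?_)
  ext w
  constructor
  · rintro ⟨_, ⟨v, rfl⟩, rfl⟩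
    exact ⟨e v, by have := iso_xx e he 1 v; simpa using this.symm⟩
  · rintro ⟨v, rfl⟩
    obtain ⟨v, rfl⟩ := e.surjective v
    exact ⟨_, ⟨v, rfl⟩, by have := iso_xx e he 1 v; simpa using this⟩

lemma Inv.ga : Inv (ga : CF F) := by
  rintro M M' h
  unfold GLp.ga
  have hu := unip_iso h
  by_cases hM : Unip M
  · rw [if_pos hM, if_pos (hu.1 hM), rk_iso h]
  · rw [if_neg hM, if_neg (fun h => hM (hu.2 h))]

lemma be_sub {M : Mo F} (hM : Unip M) (N : St M) : be (sub M N) = Nat.card {v : M.V // cyc M v = N} := by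
  unfold be
  rw [if_pos (hM.sub N)]
  congr 1
  have key : ∀ w : (sub M N).V, (cyc (sub M N) w).1 = ⊤ ↔ cyc M (sbv N w) = N := by
    intro w
    have h : (cyc M (sbv N w)).1 = (cyc (sub M N) w).1.map (sbv N) := by
      unfold cyc
      simp only
      rw [Submodule.map_span]
      congr 1
      ext z
      constructor
      · rintro ⟨i, rfl⟩
        exact ⟨_, ⟨i, rfl⟩, sub_xx N i w⟩
      · rintro ⟨_, ⟨i, rfl⟩, rfl⟩
        exact ⟨i, (sub_xx N i w).symm⟩
    rw [← Subtype.coe_inj, h]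
    have ht : (⊤ : Submodule F (sub M N).V).map (sbv N) = N.1 := by rw [Submodule.map_top, sbv_range]
    constructor
    · intro h; rw [h, ht]
    · intro h
      apply Submodule.map_injective_of_injective (sbv_inj N)
      rw [h, ht]
  refine Nat.card_congr (ofBijective (fun w => ⟨sbv N w.1, (key w.1).1 w.2⟩) ⟨?_, ?_⟩)
  · intro w w' h
    have h' : sbv N w.1 = sbv N w'.1 := congrArg (fun z : {v : M.V // cyc M v = N} => z.1) h
    exact Subtype.ext (sbv_inj N h')
  · rintro ⟨v, hv⟩
    obtain ⟨w, rfl⟩ := sbv_ex N (v := v) (by have := mem_cyc M v; rwa [hv] at this)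
    exact ⟨⟨w, (key w).2 hv⟩, rfl⟩

lemma hm_be {M : Mo F} (hM : Unip M) [Fintype M.V] (f : CF F) :
    hm f be M = ∑ v, f (quo M (cyc M v)) := by
  classical
  unfold hm
  rw [← Finset.sum_fiberwise_of_maps_to (s := univ) (t := univ) (g := fun v => cyc M v) (by simp)]
  refine sum_congr rfl fun N _ => ?_
  rw [be_sub hM, sum_congr rfl (g := fun _ => f (quo M N)) (by
    intro v hv; rw [(Finset.mem_filter.1 hv).2]), sum_const, nsmul_eq_mul, mul_comm,
    ← card_subtype, Nat.card_eq_fintype_card]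

lemma xx_range_quo {M : Mo F} (N : St M) : rk (quo M N) =
    finrank F (M.V ⧸ (N.1 ⊔ range (xx M))) := by
  unfold rk
  have h : range (xx (quo M N)) = (range (xx M)).map (mkv N) := by
    ext w
    constructor
    · rintro ⟨v, rfl⟩
      obtain ⟨v, rfl⟩ := mkv_surj N v
      exact ⟨_, ⟨v, rfl⟩, rfl⟩
    · rintro ⟨_, ⟨v, rfl⟩, rfl⟩
      exact ⟨mkv N v, rfl⟩
  rw [h]
  exact LinearEquiv.finrank_eq (Submodule.quotientQuotientEquivQuotientSup _ _)

lemma cyc_sup (M : Mo F) (v : M.V) : (cyc M v).1 ⊔ range (xx M) =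
    Submodule.span F {v} ⊔ range (xx M) := by
  apply le_antisymm
  · refine sup_le (Submodule.span_le.2 ?_) le_sup_right
    rintro _ ⟨i, rfl⟩
    cases i with
    | zero => exact Submodule.mem_sup_left (Submodule.mem_span_singleton_self v)
    | succ i => exact Submodule.mem_sup_right ⟨(xx M ^ i) v, (xx_pow_succ M i v).symm⟩
  · refine sup_le ?_ le_sup_right
    rw [Submodule.span_singleton_le_iff_mem]
    exact Submodule.mem_sup_left (mem_cyc M v)

instance (M : Mo F) : Module.Finite F M.V := Module.Finite.of_finite

lemma rk_quo_mem {M : Mo F} {v : M.V} (hv : v ∈ range (xx M)) : rk (quo M (cyc M v)) = rk M := by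
  rw [xx_range_quo, cyc_sup, sup_eq_right.2 ((Submodule.span_singleton_le_iff_mem _ _).2 hv)]
  rfl

lemma rk_quo_not {M : Mo F} {v : M.V} (hv : v ∉ range (xx M)) : rk (quo M (cyc M v)) + 1 = rk M := by
  rw [xx_range_quo, cyc_sup, rk]
  have h1 := finrank_quotient_add_finrank (Submodule.span F {v} ⊔ range (xx M))
  have h2 := finrank_quotient_add_finrank (range (xx M))
  have h3 : finrank F ↥(Submodule.span F {v} ⊔ range (xx M)) =
      finrank F (range (xx M)) + 1 := by
    rw [sup_comm]; exact Submodule.finrank_sup_span_singleton hv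
  omega

variable [Finite F]

lemma card_V (V : Type) [AddCommGroup V] [Module F V] [Finite V] : (Nat.card V : ℂ) = qq F ^ finrank F V := by
  have : Module.Finite F V := Module.Finite.of_finite
  unfold qq
  rw [Module.natCard_eq_pow_finrank (K := F) (V := V)]
  push_cast; rfl

lemma unip_rk_zero {M : Mo F} (h : Unip M) (hr : rk M = 0) : Subsingleton M.V := by
  obtain ⟨k, hk⟩ := h
  have hs : range (xx M) = ⊤ := by
    have : Subsingleton (M.V ⧸ range (xx M)) := Module.finrank_zero_iff.1 hr
    exact Submodule.Quotient.subsingleton_iff.1 this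
  have hs : Surjective (xx M) := LinearMap.range_eq_top.1 hs
  have hs' : Surjective (xx M ^ k) := by
    rw [Module.End.coe_pow]; exact hs.iterate k
  refine ⟨fun a b => ?_⟩
  obtain ⟨a, rfl⟩ := hs' a
  obtain ⟨b, rfl⟩ := hs' b
  rw [hk, hk]

theorem ga_be : hm ga be = (one : CF F) := by
  classical
  ext M
  by_cases hM : Unip M
  swap
  · have h1 : one M = 0 := by
      unfold one
      rw [if_neg]
      intro h
      exact hM ⟨0, fun v => Subsingleton.elim _ _⟩
    rw [h1]
    unfold hm
    refine sum_eq_zero fun N _ => ?_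
    by_contra h
    have h := mul_ne_zero_iff.1 h
    have hq : Unip (quo M N) := by
      by_contra h'; exact h.1 (if_neg h')
    have hs : Unip (sub M N) := by
      by_contra h'; exact h.2 (if_neg h')
    exact hM (Unip.of N hq hs)
  letI := ofFinite M.V
  rw [hm_be hM]
  by_cases h0 : Subsingleton M.V
  · rw [one, if_pos h0]
    haveI : Unique M.V := ⟨⟨0⟩, fun a => Subsingleton.elim _ _⟩
    rw [Fintype.sum_unique, ga, if_pos (hM.quo _)]
    have : rk (quo M (cyc M default)) = 0 := by
      rw [xx_range_quo]
      have : Subsingleton (M.V ⧸ ((cyc M default).1 ⊔ range (xx M))) :=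
        Function.Surjective.subsingleton (Submodule.Quotient.mk_surjective _)
      exact finrank_zero_of_subsingleton
    rw [this]; simp [PP]
  · rw [one, if_neg h0]
    have hr : rk M ≠ 0 := fun h => h0 (unip_rk_zero hM h)
    obtain ⟨r, hr⟩ := Nat.exists_eq_succ_of_ne_zero hr
    have hv : ∀ v, ga (quo M (cyc M v)) = if v ∈ range (xx M) then PP F (r+1) else PP F r := by
      intro v
      rw [ga, if_pos (hM.quo _)]
      split_ifs with h
      · rw [rk_quo_mem h, hr]
      · have := rk_quo_not h
        rw [show rk (quo M (cyc M v)) = r by omega]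
    simp only [hv]
    rw [Finset.sum_ite, sum_const, sum_const, nsmul_eq_mul, nsmul_eq_mul]
    have c1 : ((Finset.univ.filter fun v => v ∈ range (xx M)).card : ℂ) =
        qq F ^ finrank F (range (xx M)) := by
      rw [← card_V, ← card_subtype, Nat.card_eq_fintype_card]
    have c2 : ((Finset.univ.filter fun v => v ∈ range (xx M)).card : ℂ) +
        ((Finset.univ.filter fun v => ¬ v ∈ range (xx M)).card : ℂ) = 
        qq F ^ finrank F M.V := by
      rw [← card_V, Nat.card_eq_fintype_card]
      exact_mod_cast Finset.card_filter_add_card_filter_not (s := univ) (fun v => v ∈ range (xx M))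
    have h2 := finrank_quotient_add_finrank (range (xx M))
    have h2 : r + 1 + finrank F (range (xx M)) = finrank F M.V := by
      rw [← h2, ← Nat.succ_eq_add_one, ← hr]; rfl
    rw [← h2, c1] at c2
    rw [c1, eq_sub_of_add_eq' c2, PP, PP, Finset.prod_range_succ]
    ring

end BG

section UN
variable {F : Type} [Field F]

lemma unip_pow {M : Mo F} (h : Unip M) (v : M.V) : (xx M ^ finrank F M.V) v = 0 := by
  obtain ⟨k, hk⟩ := h
  have := Module.End.ker_pow_le_ker_pow_finrank (xx M) k
  exact this (show v ∈ ker (xx M ^ k) from hk v)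

lemma cyc_span {M : Mo F} (h : Unip M) {v : M.V} (hv : (cyc M v).1 = ⊤) {n : ℕ} (hn : finrank F M.V = n) :
    ⊤ ≤ Submodule.span F (Set.range fun i : Fin n => (xx M ^ (i : ℕ)) v) := by
  rw [← hv]
  refine Submodule.span_le.2 ?_
  rintro _ ⟨i, rfl⟩
  by_cases hi : i < n
  · exact subset_span ⟨⟨i, hi⟩, rfl⟩
  · have : (xx M ^ i) v = 0 := xx_zero_of_le (not_lt.1 hi) (hn ▸ unip_pow h v)
    simp only [this]
    exact Submodule.zero_mem _

noncomputable def cyB {M : Mo F} (h : Unip M) {v : M.V} (hv : (cyc M v).1 = ⊤) {n : ℕ}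
    (hn : finrank F M.V = n) : Module.Basis (Fin n) F M.V :=
  basisOfTopLeSpanOfCardEqFinrank _ (cyc_span h hv hn) (by simp [hn])

lemma cyB_apply {M : Mo F} (h : Unip M) {v : M.V} (hv : (cyc M v).1 = ⊤) {n : ℕ}
    (hn : finrank F M.V = n) (i : Fin n) : cyB h hv hn i = (xx M ^ (i : ℕ)) v := by
  unfold cyB; rw [coe_basisOfTopLeSpanOfCardEqFinrank]

lemma cy_iso {M M' : Mo F} (h : Unip M) (h' : Unip M') {v : M.V} {v' : M'.V} (hv : (cyc M v).1 = ⊤)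
    (hv' : (cyc M' v').1 = ⊤) (hn : finrank F M.V = finrank F M'.V) :
    ∃ e : M.V ≃ₗ[F] M'.V, (∀ w, e (M.T w) = M'.T (e w)) ∧ e v = v' := by
  set n := finrank F M'.V with hn'
  let e := (cyB h hv hn).equiv (cyB h' hv' rfl) (Equiv.refl _)
  have he : ∀ i : Fin n, e ((xx M ^ (i : ℕ)) v) = (xx M' ^ (i : ℕ)) v' := by
    intro i
    rw [← cyB_apply h hv hn, ← cyB_apply h' hv' rfl]
    simp [e]
  have hall : ∀ i : ℕ, e ((xx M ^ i) v) = (xx M' ^ i) v' := by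
    intro i
    by_cases hi : i < n
    · exact he ⟨i, hi⟩
    · rw [xx_zero_of_le (not_lt.1 hi) (hn ▸ unip_pow h v), xx_zero_of_le (not_lt.1 hi) (unip_pow h' v'), map_zero]
  refine ⟨e, fun w => ?_, hall 0⟩
  have : (e : M.V →ₗ[F] M'.V) ∘ₗ (xx M) = xx M' ∘ₗ (e : M.V →ₗ[F] M'.V) := by
    refine (cyB h hv hn).ext fun i => ?_
    rw [cyB_apply]
    show e (xx M ((xx M ^ (i : ℕ)) v)) = xx M' (e ((xx M ^ (i : ℕ)) v))
    rw [← xx_pow_succ, hall, hall, xx_pow_succ]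
  have := LinearMap.congr_fun this w
  have this : e (xx M w) = xx M' (e w) := this
  rw [T_eq, map_add, this, ← T_eq]

def shf (n : ℕ) : (Fin n → F) →ₗ[F] (Fin n → F) where
  toFun f := fun j => if h : j.1 = 0 then 0 else f ⟨j.1 - 1, by omega⟩
  map_add' f g := by ext j; simp only [Pi.add_apply]; split_ifs <;> simp
  map_smul' c f := by ext j; simp only [Pi.smul_apply, RingHom.id_apply]; split_ifs <;> simp

def e0 (n : ℕ) : Fin n → F := fun j => if j.1 = 0 then 1 else 0

lemma shf_e0 (n i : ℕ) : ((shf n : Module.End F (Fin n → F)) ^ i) (e0 n) = fun j => if j.1 = i then 1 else 0 := by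
  induction i with
  | zero => rfl
  | succ i ih =>
    rw [pow_succ', Module.End.mul_apply, ih]
    ext j
    show (if h : j.1 = 0 then (0 : F) else if j.1 - 1 = i then 1 else 0) = _
    split_ifs <;> first | rfl | omega

lemma shf_pow (n i : ℕ) (f : Fin n → F) (j : Fin n) (h : j.1 < i) : ((shf n : Module.End F (Fin n → F)) ^ i) f j = 0 := by
  induction i generalizing j with
  | zero => omega
  | succ i ih =>
    rw [pow_succ', Module.End.mul_apply]
    show (if h : j.1 = 0 then (0 : F) else ((shf n : Module.End F (Fin n → F)) ^ i) f ⟨j.1 - 1, by omega⟩) = 0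
    split_ifs with h0
    · rfl
    · exact ih _ (by simp; omega)

variable [Finite F]

def un (n : ℕ) : Mo F := std n (shf n + LinearMap.id)

lemma un_xx (n : ℕ) : xx (un n : Mo F) = (shf n : Module.End F (Fin n → F)) := by
  exact add_sub_cancel_right (shf n) LinearMap.id

lemma un_unip (n : ℕ) : Unip (un n : Mo F) := ⟨n, fun v => by
  rw [un_xx]
  funext j
  exact shf_pow n n v j j.2⟩

lemma un_cyc (n : ℕ) : (cyc (un n : Mo F) (e0 n : Fin n → F)).1 = ⊤ := by
  rw [eq_top_iff]
  have : (⊤ : Submodule F (Fin n → F)) = Submodule.span F (Set.range (Pi.basisFun F (Fin n))) := ((Pi.basisFun F (Fin n)).span_eq).symm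
  refine this.le.trans (Submodule.span_mono ?_)
  rintro _ ⟨i, rfl⟩
  refine ⟨i.1, ?_⟩
  simp only [un_xx]
  refine (shf_e0 n i.1).trans (funext fun j => ?_)
  simp [Pi.basisFun_apply, Pi.single_apply, Fin.ext_iff]

lemma un_finrank (n : ℕ) : finrank F (un n : Mo F).V = n := by
  show finrank F (Fin n → F) = n
  simp

lemma iso_un {M : Mo F} (h : Unip M) {v : M.V} (hv : (cyc M v).1 = ⊤) : Iso M (un (finrank F M.V)) := by
  obtain ⟨e, he, _⟩ := cy_iso h (un_unip _) hv (un_cyc _) (un_finrank (F := F) _).symm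
  exact ⟨e, he⟩

lemma be_mul {f : CF F} (hf : Inv f) (M : Mo F) : be M * f M = be M * f (un (finrank F M.V)) := by
  by_cases h : be M = 0
  · simp [h]
  have hu : Unip M := by
    by_contra h'; exact h (if_neg h')
  have : ∃ v, (cyc M v).1 = ⊤ := by
    by_contra h'
    apply h
    rw [be, if_pos hu]
    have : IsEmpty {v : M.V // (cyc M v).1 = ⊤} := ⟨fun v => h' ⟨v.1, v.2⟩⟩
    simp
  obtain ⟨v, hv⟩ := this
  rw [hf _ _ (iso_un hu hv)]

lemma Q_be (n : ℕ) : Q n (be : CF F) = 1 := by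
  classical
  letI : Fintype F := ofFinite F
  have h1 : ∀ T : (Fin n → F) →ₗ[F] (Fin n → F), be (std n T) =
      (Fintype.card {v : Fin n → F // Unip (std n T) ∧ (cyc (std n T) v).1 = ⊤} : ℂ) := by
    intro T
    unfold be
    by_cases h : Unip (std n T)
    · rw [if_pos h, ← Nat.card_eq_fintype_card]
      simp [h]
    · rw [if_neg h]
      simp [h]
  unfold Q
  simp only [h1]
  rw [← Nat.cast_sum, ← Fintype.card_sigma]
  have key : Fintype.card ((Fin n → F) ≃ₗ[F] (Fin n → F)) =
      Fintype.card (Σ T : (Fin n → F) →ₗ[F] (Fin n → F), {v : Fin n → F // Unip (std n T) ∧ (cyc (std n T) v).1 = ⊤}) := by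
    let U : (Fin n → F) →ₗ[F] (Fin n → F) := shf n + LinearMap.id
    let TT : ((Fin n → F) ≃ₗ[F] (Fin n → F)) → ((Fin n → F) →ₗ[F] (Fin n → F)) := fun k =>
      k.toLinearMap ∘ₗ U ∘ₗ k.symm.toLinearMap
    have hk : ∀ k, ∀ w : Fin n → F, k (U w) = TT k (k w) := by intro k w; simp [TT]
    have hsig : ∀ (x y : (Σ T : (Fin n → F) →ₗ[F] (Fin n → F), {v : Fin n → F // Unip (std n T) ∧ (cyc (std n T) v).1 = ⊤})),
        x.1 = y.1 → x.2.1 = y.2.1 → x = y := by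
      rintro ⟨T, v⟩ ⟨T', v'⟩ (h : T = T') h'
      subst h
      have : v = v' := Subtype.ext h'
      rw [this]
    have hiso : ∀ k, Iso (un n : Mo F) (std n (TT k)) := fun k => ⟨k, hk k⟩
    refine Fintype.card_of_bijective (f := fun k => ⟨TT k, k (e0 n), (unip_iso (hiso k)).1 (un_unip n), ?_⟩) ⟨?_, ?_⟩
    · have := cyc_iso (M := un n) (M' := std n (TT k)) k (hk k) (e0 n)
      rw [un_cyc] at this
      refine this.trans ?_
      rw [Submodule.map_top]
      exact LinearMap.range_eq_top.2 k.surjective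
    · intro k k' h
      have hT : TT k = TT k' := congrArg Sigma.fst h
      have he : k (e0 n) = k' (e0 n) := congrArg (fun z : (Σ T : (Fin n → F) →ₗ[F] (Fin n → F), {v : Fin n → F // Unip (std n T) ∧ (cyc (std n T) v).1 = ⊤}) => z.2.1) h
      have h2 : ∀ w ∈ (cyc (un n : Mo F) (e0 n : Fin n → F)).1, k w = k' w := by
        intro w hw
        induction hw using span_induction with
        | mem x hx =>
          obtain ⟨i, rfl⟩ := hx
          have a1 := iso_xx (M := un n) (M' := std n (TT k)) k (hk k) i (e0 n)
          have a2 := iso_xx (M := un n) (M' := std n (TT k')) k' (hk k') i (e0 n)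
          refine a1.trans (Eq.trans ?_ a2.symm)
          rw [hT]
          exact congrArg _ he
        | zero => exact (map_zero k).trans (map_zero k').symm
        | add x y _ _ hx hy => exact (map_add k x y).trans ((congrArg₂ _ hx hy).trans (map_add k' x y).symm)
        | smul a x _ hx => exact (map_smul k a x).trans ((congrArg _ hx).trans (map_smul k' a x).symm)
      refine LinearEquiv.ext fun w => h2 w ?_
      rw [un_cyc]; trivial
    · rintro ⟨T, v, hu, hv⟩
      obtain ⟨e, he, hev⟩ := cy_iso (M := (un n : Mo F)) (M' := std n T) (un_unip n) hu (un_cyc n) hv rfl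
      refine ⟨e, ?_⟩
      have : TT e = T := by
        refine LinearMap.ext fun w => ?_
        obtain ⟨w, rfl⟩ := e.surjective w
        exact (hk e w).symm.trans (he w)
      exact hsig _ _ this hev
  rw [← key]
  exact inv_mul_cancel₀ (gl_ne n)

lemma Q_be_mul {f : CF F} (hf : Inv f) (n : ℕ) : Q n (fun M => be M * f M) = f (un n) := by
  have : Q n (fun M : Mo F => be M * f M) = Q n (be : CF F) * f (un n) := by
    unfold Q
    rw [mul_assoc, sum_mul]
    congr 1
    refine sum_congr rfl fun T _ => ?_
    refine (be_mul hf _).trans ?_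
    congr 2
    exact congrArg (un (F := F)) (by simp : finrank F (Fin n → F) = n)
  rw [this, Q_be, one_mul]

def exm {A B : Mo F} (c : Hm A B) (a : A.V) (b : B.V) : (Ex A B c).V := ((a, b) : A.V × B.V)
def exf {A B : Mo F} (c : Hm A B) : (Ex A B c).V →ₗ[F] A.V := fst F A.V B.V
def exi {A B : Mo F} (c : Hm A B) : B.V →ₗ[F] (Ex A B c).V := inr F A.V B.V
lemma exi_inj {A B : Mo F} (c : Hm A B) : Injective (exi c) := LinearMap.inr_injective
lemma exf_surj {A B : Mo F} (c : Hm A B) : Surjective (exf c) := LinearMap.fst_surjective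
lemma exf_zero {A B : Mo F} (c : Hm A B) {w : (Ex A B c).V} (h : exf c w = 0) : ∃ b, w = exi c b :=
  ⟨(show A.V × B.V from w).2, Prod.ext h rfl⟩
lemma exf_xx {A B : Mo F} (c : Hm A B) (k : ℕ) (w : (Ex A B c).V) : exf c ((xx (Ex A B c) ^ k) w) = (xx A ^ k) (exf c w) := by
  induction k with
  | zero => rfl
  | succ k ih => rw [xx_pow_succ, xx_pow_succ, ← ih]; rfl
lemma exi_xx {A B : Mo F} (c : Hm A B) (k : ℕ) (b : B.V) : (xx (Ex A B c) ^ k) (exi c b) = exi c ((xx B ^ k) b) := by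
  induction k with
  | zero => rfl
  | succ k ih =>
    rw [xx_pow_succ, xx_pow_succ, ih]
    refine Prod.ext ?_ ?_
    · show A.T 0 - 0 = 0
      simp
    · show B.T ((xx B ^ k) b) + c 0 - (xx B ^ k) b = B.T ((xx B ^ k) b) - (xx B ^ k) b
      simp

lemma Ex_xx (A B : Mo F) (a : A.V) (k : ℕ) : ∃ p : (Hm A B) →+ B.V,
    (∀ c b, (xx (Ex A B c) ^ k) (exm c a b) = exm c ((xx A ^ k) a) ((xx B ^ k) b + p c)) ∧
    (∀ c, (∀ j, j + 1 < k → c ((xx A ^ j) a) = 0) → ∀ l, l + 1 = k → p c = c ((xx A ^ l) a)) ∧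
    (∀ c, (∀ j, j < k → c ((xx A ^ j) a) = 0) → p c = 0) := by
  induction k with
  | zero =>
    refine ⟨0, fun c b => ?_, by simp, by simp⟩
    exact Prod.ext rfl (add_zero b).symm
  | succ k ih =>
    obtain ⟨p, h1, h2, h3⟩ := ih
    let ev : (Hm A B) →+ B.V := ⟨⟨fun c => c ((xx A ^ k) a), rfl⟩, fun _ _ => rfl⟩
    refine ⟨(xx B).toAddMonoidHom.comp p + ev, fun c b => ?_, ?_, ?_⟩
    · rw [xx_pow_succ, h1, xx_apply]
      refine Prod.ext ?_ ?_
      · show A.T ((xx A ^ k) a) - (xx A ^ k) a = (xx A ^ (k+1)) a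
        rw [xx_pow_succ, xx_apply]
      · show B.T ((xx B ^ k) b + p c) + c ((xx A ^ k) a) - ((xx B ^ k) b + p c) = (xx B ^ (k+1)) b + (xx B (p c) + c ((xx A ^ k) a))
        rw [xx_pow_succ, xx_apply, xx_apply, map_add]; abel
    · intro c hc l hl
      obtain rfl : l = k := by omega
      show xx B (p c) + c _ = _
      rw [h3 c fun j hj => hc j (by omega)]
      simp
    · intro c hc
      show xx B (p c) + c _ = _
      rw [h3 c fun j hj => hc j (by omega), hc k (by omega)]
      simp

lemma unip_Ex (A B : Mo F) (c : Hm A B) : Unip (Ex A B c) ↔ Unip A ∧ Unip B := by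
  constructor
  · rintro ⟨k, hk⟩
    refine ⟨⟨k, fun a => ?_⟩, ⟨k, fun b => ?_⟩⟩
    · have := exf_xx c k (exm c a 0)
      rw [hk, map_zero] at this
      exact this.symm
    · have := exi_xx c k b
      rw [hk] at this
      exact exi_inj c (this.symm.trans (map_zero _).symm)
  · rintro ⟨⟨k, hk⟩, ⟨l, hl⟩⟩
    refine ⟨l + k, fun w => ?_⟩
    rw [xx_pow_add]
    have h1 := exf_xx c k w
    rw [hk] at h1
    obtain ⟨b, hb⟩ := exf_zero c h1
    rw [hb, exi_xx, hl, map_zero]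

lemma gen_Ex {A B : Mo F} (c : Hm A B) (hA : Unip A) (a : A.V) (b : B.V) (ha : (cyc A a).1 = ⊤)
    (β : B.V) (hβ : (xx (Ex A B c) ^ finrank F A.V) (exm c a b) = exi c β) :
    (cyc (Ex A B c) (exm c a b)).1 = ⊤ ↔ (cyc B β).1 = ⊤ := by
  set n := finrank F A.V with hn
  set C := cyc (Ex A B c) (exm c a b) with hC
  constructor
  · intro h
    rw [eq_top_iff]
    intro b' _
    have h1 : ∀ w ∈ C.1, ∃ t : Fin n → F, ∃ b0 ∈ (cyc B β).1, w = (∑ i, t i • (xx (Ex A B c) ^ (i : ℕ)) (exm c a b)) + exi c b0 := by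
      intro w hw
      induction hw using span_induction with
      | mem x hx =>
        obtain ⟨i, rfl⟩ := hx
        by_cases hi : i < n
        · refine ⟨Pi.single ⟨i, hi⟩ 1, 0, Submodule.zero_mem _, ?_⟩
          rw [map_zero, add_zero, sum_eq_single ⟨i, hi⟩]
          · simp
          · intro j _ hj; simp [hj]
          · simp
        · refine ⟨0, (xx B ^ (i - n)) β, xx_pow_mem _ _ (mem_cyc _ _), ?_⟩
          have : i = (i - n) + n := by omega
          rw [← exi_xx, ← hβ, ← xx_pow_add, ← this]
          simp
      | zero => exact ⟨0, 0, Submodule.zero_mem _, by simp⟩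
      | add x y _ _ hx hy =>
        obtain ⟨t, b0, h0, rfl⟩ := hx
        obtain ⟨t', b0', h0', rfl⟩ := hy
        refine ⟨t + t', b0 + b0', Submodule.add_mem _ h0 h0', ?_⟩
        simp only [Pi.add_apply, add_smul, sum_add_distrib, map_add]; abel
      | smul s x _ hx =>
        obtain ⟨t, b0, h0, rfl⟩ := hx
        refine ⟨s • t, s • b0, smul_mem _ _ h0, ?_⟩
        simp only [Pi.smul_apply, smul_add, smul_sum, map_smul, smul_smul, smul_eq_mul]
    obtain ⟨t, b0, h0, h2⟩ := h1 (exi c b') (by rw [h]; trivial)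
    have h3 := congrArg (exf c) h2
    have e1 : exf c (exi c b') = 0 := rfl
    have e2 : exf c (exi c b0) = 0 := rfl
    rw [map_add, e1, e2, add_zero, map_sum] at h3
    have h4 : ∑ i, t i • (cyB hA ha hn.symm) i = 0 := by
      rw [h3]
      refine sum_congr rfl fun i _ => ?_
      rw [map_smul, exf_xx, cyB_apply]; rfl
    have h5 := Fintype.linearIndependent_iff.1 (cyB hA ha hn.symm).linearIndependent t h4
    have : b' = b0 := by
      apply exi_inj c
      rw [h2]
      simp [h5]
    rw [this]; exact h0
  · intro h
    have hB : ∀ b', exi c b' ∈ C.1 := by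
      intro b'
      have : b' ∈ (cyc B β).1 := by rw [h]; trivial
      induction this using span_induction with
      | mem x hx =>
        obtain ⟨i, rfl⟩ := hx
        simp only
        rw [← exi_xx, ← hβ]
        exact xx_pow_mem _ _ (xx_pow_mem _ _ (mem_cyc _ _))
      | zero => rw [map_zero]; exact Submodule.zero_mem _
      | add x y _ _ hx hy => rw [map_add]; exact Submodule.add_mem _ hx hy
      | smul s x _ hx => rw [map_smul]; exact smul_mem _ _ hx
    rw [eq_top_iff]
    intro w _
    have h1 : ∀ a' ∈ (cyc A a).1, ∃ w ∈ C.1, exf c w = a' := by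
      intro a' ha'
      induction ha' using span_induction with
      | mem x hx =>
        obtain ⟨i, rfl⟩ := hx
        exact ⟨_, xx_pow_mem C i (mem_cyc _ _), exf_xx c i _⟩
      | zero => exact ⟨0, Submodule.zero_mem _, map_zero _⟩
      | add x y _ _ hx hy =>
        obtain ⟨u, hu, rfl⟩ := hx
        obtain ⟨v, hv, rfl⟩ := hy
        exact ⟨u + v, Submodule.add_mem _ hu hv, map_add _ _ _⟩
      | smul s x _ hx =>
        obtain ⟨u, hu, rfl⟩ := hx
        exact ⟨s • u, smul_mem _ _ hu, map_smul _ _ _⟩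
    obtain ⟨w', hw', h2⟩ := h1 (exf c w) (by rw [ha]; trivial)
    obtain ⟨b', hb'⟩ := exf_zero c (w := w - w') (by rw [map_sub, h2, sub_self])
    rw [← sub_add_cancel w w', hb']
    exact Submodule.add_mem _ (hB b') hw'

lemma gen_fst {A B : Mo F} (c : Hm A B) (a : A.V) (b : B.V) (h : (cyc (Ex A B c) (exm c a b)).1 = ⊤) :
    (cyc A a).1 = ⊤ := by
  rw [eq_top_iff]
  intro a' _
  have h1 : ∀ w ∈ (cyc (Ex A B c) (exm c a b)).1, exf c w ∈ (cyc A a).1 := by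
    intro w hw
    induction hw using span_induction with
    | mem x hx =>
      obtain ⟨i, rfl⟩ := hx
      simp only
      rw [exf_xx]
      exact xx_pow_mem _ _ (mem_cyc _ _)
    | zero => rw [map_zero]; exact Submodule.zero_mem _
    | add x y _ _ hx hy => rw [map_add]; exact Submodule.add_mem _ hx hy
    | smul s x _ hx => rw [map_smul]; exact smul_mem _ _ hx
  exact h1 (exm c a' 0) (by rw [h]; trivial)

open Classical in
lemma be_eq_sum {M : Mo F} (h : Unip M) [Fintype M.V] : be M = ∑ v : M.V, if (cyc M v).1 = ⊤ then (1:ℂ) else 0 := by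
  rw [be, if_pos h, sum_boole, Nat.card_eq_fintype_card, card_subtype]

lemma one_of_sub {M : Mo F} (h : Subsingleton M.V) : be M = 1 := by
  have hu : Unip M := ⟨0, fun v => Subsingleton.elim _ _⟩
  rw [be, if_pos hu]
  have : ∀ v : M.V, (cyc M v).1 = ⊤ := fun v => by
    rw [eq_top_iff]; intro x _; rw [Subsingleton.elim x v]; exact mem_cyc _ _
  simp only [this]
  have : Unique {v : M.V // True} := ⟨⟨⟨0, trivial⟩⟩, fun x => Subsingleton.elim _ _⟩
  simp

lemma av_mul_left {ι : Type*} [Fintype ι] (a : ℂ) (φ : ι → ℂ) : av (fun i => a * φ i) = a * av φ := by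
  unfold av; rw [← mul_sum]; ring

lemma av_sum {ι κ : Type*} [Fintype ι] (s : Finset κ) (φ : ι → κ → ℂ) : av (fun i => ∑ k ∈ s, φ i k) = ∑ k ∈ s, av fun i => φ i k := by
  unfold av; rw [sum_comm, mul_sum]

theorem De_be (A B : Mo F) : De be A B = be A * be B := by
  classical
  by_cases hs : Subsingleton A.V
  · rw [De_zero_left Inv.be A B hs, one_of_sub hs, one_mul]
  by_cases hu : Unip A ∧ Unip B
  swap
  · have : ∀ c, be (Ex A B c) = 0 := fun c => by rw [be, if_neg]; rwa [unip_Ex]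
    unfold De
    simp only [this]
    rw [not_and_or] at hu
    rcases hu with hu | hu
    · rw [be, if_neg hu]; simp [av]
    · rw [mul_comm, be, if_neg hu]; simp [av]
  obtain ⟨hA, hB⟩ := hu
  letI := ofFinite A.V
  letI := ofFinite B.V
  rw [be_eq_sum hA, sum_mul]
  have h1 : De be A B = ∑ a : A.V, ∑ b : B.V, av fun c : Hm A B => if (cyc (Ex A B c) (exm c a b)).1 = ⊤ then (1:ℂ) else 0 := by
    unfold De
    rw [← Fintype.sum_prod_type' (f := fun a b => av fun c : Hm A B => if (cyc (Ex A B c) (exm c a b)).1 = ⊤ then (1:ℂ) else 0), ← av_sum]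
    congr 1
    funext c
    letI : Fintype (Ex A B c).V := inferInstanceAs (Fintype (A.V × B.V))
    rw [be_eq_sum ((unip_Ex A B c).2 ⟨hA, hB⟩)]
    exact sum_congr rfl fun w _ => rfl
  rw [h1]
  refine sum_congr rfl fun a _ => ?_
  by_cases ha : (cyc A a).1 = ⊤
  swap
  · rw [if_neg ha, zero_mul]
    refine sum_eq_zero fun b _ => ?_
    unfold av
    rw [sum_eq_zero, mul_zero]
    intro c _
    rw [if_neg fun h => ha (gen_fst c a b h)]
  rw [if_pos ha, one_mul]
  obtain ⟨p, p1, p2, -⟩ := Ex_xx A B a (finrank F A.V)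
  have hβ : ∀ c b, (xx (Ex A B c) ^ finrank F A.V) (exm c a b) = exi c ((xx B ^ finrank F A.V) b + p c) := by
    intro c b; rw [p1, unip_pow hA]; rfl
  have hps : Surjective p := by
    intro β
    have hpos : 0 < finrank F A.V := by
      rw [not_subsingleton_iff_nontrivial] at hs
      exact Module.finrank_pos
    let c := (cyB hA ha rfl).constr F (fun i => if i.1 + 1 = finrank F A.V then β else 0)
    have hc : ∀ i : Fin (finrank F A.V), c ((xx A ^ i.1) a) = if i.1 + 1 = finrank F A.V then β else 0 := by
      intro i; rw [← cyB_apply hA ha rfl i]; exact Module.Basis.constr_basis _ _ _ _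
    refine ⟨c, ?_⟩
    rw [p2 c (fun j hj => ?_) (finrank F A.V - 1) (by omega)]
    · have := hc ⟨finrank F A.V - 1, by omega⟩
      rw [if_pos (by simp; omega)] at this
      exact this
    · have := hc ⟨j, by omega⟩
      rw [if_neg (by simp; omega)] at this
      exact this
  have h2 : ∀ b : B.V, (av fun c : Hm A B => if (cyc (Ex A B c) (exm c a b)).1 = ⊤ then (1:ℂ) else 0) = (Fintype.card B.V : ℂ)⁻¹ * be B := by
    intro b
    have e1 : (fun c : Hm A B => if (cyc (Ex A B c) (exm c a b)).1 = ⊤ then (1:ℂ) else 0) =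
      fun c => (fun β => if (cyc B ((xx B ^ finrank F A.V) b + β)).1 = ⊤ then (1:ℂ) else 0) (p c) := by
      funext c
      exact if_congr (gen_Ex c hA a b ha _ (hβ c b)) rfl rfl
    rw [e1, av_surj p hps (fun β => if (cyc B ((xx B ^ finrank F A.V) b + β)).1 = ⊤ then (1:ℂ) else 0), be_eq_sum hB]
    unfold av
    congr 1
    exact sum_equiv (Equiv.addLeft ((xx B ^ finrank F A.V) b)) _ _ fun β => rfl
  simp only [h2]
  rw [sum_const, card_univ, nsmul_eq_mul, ← mul_assoc, mul_inv_cancel₀, one_mul]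
  exact_mod_cast card_ne_zero

end UN

section HA
variable {F : Type} [Field F] [Finite F]

lemma De_one (A B : Mo F) : De one A B = one A * one B := by
  have : ∀ c, one (Ex A B c) = one A * one B := by
    intro c
    have : Subsingleton (Ex A B c).V ↔ Subsingleton A.V ∧ Subsingleton B.V := by
      constructor
      · intro h
        exact ⟨(exf_surj c).subsingleton, (exi_inj c).subsingleton⟩
      · rintro ⟨h, h'⟩
        exact inferInstanceAs (Subsingleton (A.V × B.V))
    unfold one
    by_cases h : Subsingleton A.V <;> by_cases h' : Subsingleton B.V
    · rw [if_pos (this.2 ⟨h, h'⟩), if_pos h, if_pos h', mul_one]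
    · rw [if_neg (fun h0 => h' (this.1 h0).2), if_neg h', mul_zero]
    · rw [if_neg (fun h0 => h (this.1 h0).1), if_neg h, zero_mul]
    · rw [if_neg (fun h0 => h (this.1 h0).1), if_neg h, zero_mul]
  unfold De av
  simp only [this]
  rw [sum_const, card_univ, nsmul_eq_mul, ← mul_assoc, inv_mul_cancel₀, one_mul]
  exact_mod_cast card_ne_zero

lemma ga_sub {M : Mo F} (h : Subsingleton M.V) : ga M = 1 := by
  have hu : Unip M := ⟨0, fun v => Subsingleton.elim _ _⟩
  have : rk M = 0 := by
    unfold rk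
    have : Subsingleton (M.V ⧸ range (xx M)) := inferInstance
    exact finrank_zero_of_subsingleton
  rw [ga, if_pos hu, this]; simp [PP]

lemma quo_finrank_le (A : Mo F) (N : St A) : finrank F (quo A N).V ≤ finrank F A.V :=
  LinearMap.finrank_le_finrank_of_surjective (f := mkv N) (mkv_surj N)

lemma quo_finrank_lt (A : Mo F) (N : St A) (h : N ≠ botSt A) : finrank F (quo A N).V < finrank F A.V := by
  have h1 : N.1 ≠ ⊥ := fun h' => h (Subtype.ext h')
  have := finrank_quotient_add_finrank N.1
  have h2 : 0 < finrank F N.1 := by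
    rw [Nat.pos_iff_ne_zero]; intro h3; exact h1 (Submodule.finrank_eq_zero.1 h3)
  show finrank F (A.V ⧸ N.1) < _
  omega

lemma sub_bot (A : Mo F) : Subsingleton (sub A (botSt A)).V := by
  show Subsingleton (⊥ : Submodule F A.V)
  infer_instance

theorem De_ga (A B : Mo F) : De ga A B = ga A * ga B := by
  classical
  induction hn : finrank F A.V + finrank F B.V using Nat.strong_induction_on generalizing A B with
  | _ n ih =>
  subst hn
  by_cases hs : Subsingleton A.V ∧ Subsingleton B.V
  · rw [De_zero_left Inv.ga A B hs.1, ga_sub hs.1, one_mul]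
  have h0 : one A * one B = 0 := by
    unfold one
    by_cases h : Subsingleton A.V <;> by_cases h' : Subsingleton B.V <;> simp [h, h'] at hs ⊢
  have g1 := green (Inv.ga (F := F)) Inv.be A B
  rw [ga_be, De_one, h0] at g1
  have g2 : ∑ A1 : St A, ∑ B1 : St B, (ga (quo A A1) * ga (quo B B1)) * De be (sub A A1) (sub B B1) = 0 := by
    have e1 : hm ga be A * hm ga be B = 0 := by rw [ga_be]; exact h0
    rw [← e1]
    unfold hm
    rw [Finset.sum_mul_sum]
    refine sum_congr rfl fun A1 _ => sum_congr rfl fun B1 _ => ?_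
    rw [De_be]; ring
  have g3 : ∑ x : St A × St B, (De ga (quo A x.1) (quo B x.2) - ga (quo A x.1) * ga (quo B x.2)) * De be (sub A x.1) (sub B x.2) = 0 := by
    rw [sum_prod_type]
    simp only [sub_mul, sum_sub_distrib]
    rw [← g1, g2, sub_zero]
  rw [sum_eq_single (botSt A, botSt B)] at g3
  · rw [De_zero_left Inv.be _ _ (sub_bot A), one_of_sub (sub_bot B), mul_one, sub_eq_zero] at g3
    rw [De_inv Inv.ga _ _ _ _ (iso_quo_bot A) (iso_quo_bot B), Inv.ga _ _ (iso_quo_bot A), Inv.ga _ _ (iso_quo_bot B)] at g3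
    exact g3
  · rintro ⟨A1, B1⟩ _ hne
    rw [ih _ ?_ (quo A A1) (quo B B1) rfl, sub_self, zero_mul]
    have a1 := quo_finrank_le A A1
    have b1 := quo_finrank_le B B1
    by_cases hA : A1 = botSt A
    · have := quo_finrank_lt B B1 (fun h => hne (by rw [hA, h]))
      omega
    · have := quo_finrank_lt A A1 hA
      omega
  · simp

lemma Q_congr (n : ℕ) {f g : CF F} (h : ∀ T, f (std n T) = g (std n T)) : Q n f = Q n g := by
  unfold Q; simp only [h]
lemma Q_mul_left (n : ℕ) (a : ℂ) (f : CF F) : Q n (fun M => a * f M) = a * Q n f := by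
  unfold Q; rw [← mul_sum]; ring
lemma Q_mul_right (n : ℕ) (a : ℂ) (f : CF F) : Q n (fun M => f M * a) = Q n f * a := by
  unfold Q; rw [← sum_mul]; ring
lemma Q_sum {κ : Type*} (n : ℕ) (s : Finset κ) (f : κ → CF F) : Q n (fun M => ∑ k ∈ s, f k M) = ∑ k ∈ s, Q n (f k) := by
  unfold Q; rw [sum_comm, mul_sum]
lemma Q_sub (n : ℕ) (f g : CF F) : Q n (fun M => f M - g M) = Q n f - Q n g := by
  unfold Q; rw [sum_sub_distrib]; ring
lemma Q_swap (n m : ℕ) (f : Mo F → CF F) : Q n (fun A => Q m (fun B => f A B)) = Q m (fun B => Q n (fun A => f A B)) := by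
  unfold Q
  simp only [← mul_sum]
  rw [sum_comm]; ring
lemma Q_zero (n : ℕ) {f : CF F} (h : ∀ T, f (std n T) = 0) : Q n f = 0 := by
  unfold Q; simp [h]
lemma Q_conj (n : ℕ) (f : CF F) : conj (Q n f) = Q n (fun M => conj (f M)) := by
  unfold Q; rw [map_mul, map_inv₀, map_sum]; congr 2; unfold gl; simp

lemma adj_hm {f g h : CF F} (hf : Inv f) (hg : Inv g) (hh : Inv h) (n : ℕ) :
    Q n (fun M => hm f g M * h M) = ∑ x ∈ antidiagonal n,
      Q x.1 (fun A => Q x.2 (fun B => f A * g B * De h A B)) :=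
  adj (Inv.box hf hg) hh n

lemma mult_of_De {h : CF F} (hh : Inv h) (hD : ∀ A B, De h A B = h A * h B) {f g : CF F} (hf : Inv f) (hg : Inv g) (n : ℕ) :
    Q n (fun M => h M * hm f g M) = ∑ x ∈ antidiagonal n,
      Q x.1 (fun A => h A * f A) * Q x.2 (fun B => h B * g B) := by
  have : (fun M => h M * hm f g M) = fun M => hm f g M * h M := by funext M; ring
  rw [this, adj_hm hf hg hh]
  refine sum_congr rfl fun x _ => ?_
  rw [← Q_mul_right]
  refine Q_congr _ fun T => ?_
  rw [← Q_mul_left]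
  refine Q_congr _ fun T' => ?_
  rw [hD]; ring

noncomputable def al (n : ℕ) (f : CF F) : ℂ := Q n (fun M => ga M * f M)
noncomputable def ep (n : ℕ) (f : CF F) : ℂ := Q n (fun M => be M * f M)

lemma al_hm {f g : CF F} (hf : Inv f) (hg : Inv g) (n : ℕ) : al n (hm f g) = ∑ x ∈ antidiagonal n, al x.1 f * al x.2 g :=
  mult_of_De Inv.ga De_ga hf hg n
lemma ep_hm {f g : CF F} (hf : Inv f) (hg : Inv g) (n : ℕ) : ep n (hm f g) = ∑ x ∈ antidiagonal n, ep x.1 f * ep x.2 g :=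
  mult_of_De Inv.be De_be hf hg n
lemma ep_eq {f : CF F} (hf : Inv f) (n : ℕ) : ep n f = f (un n) := Q_be_mul hf n
lemma al_be (n : ℕ) : al n (be : CF F) = ga (un n : Mo F) := by
  rw [← ep_eq Inv.ga]; exact Q_congr (F := F) n (f := fun M => ga M * be M) (g := fun M => be M * ga M) fun T => mul_comm _ _

lemma Q_eq_zero_deg (f : CF F) : Q 0 f = f (std 0 0) := by
  unfold Q
  have hu : Unique ((Fin 0 → F) →ₗ[F] (Fin 0 → F)) := ⟨⟨0⟩, fun x => LinearMap.ext fun v => Subsingleton.elim _ _⟩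
  have h1 : gl F 0 = 1 := by
    unfold gl
    have : Unique ((Fin 0 → F) ≃ₗ[F] (Fin 0 → F)) := ⟨⟨LinearEquiv.refl _ _⟩, fun x => LinearEquiv.ext fun v => Subsingleton.elim _ _⟩
    rw [Fintype.card_eq_one_iff.2 ⟨default, fun x => Subsingleton.elim _ _⟩]; simp
  rw [h1, inv_one, one_mul]
  rw [Fintype.sum_eq_single 0 (fun x hx => absurd (Subsingleton.elim _ _) hx)]

lemma one_std (n : ℕ) (T) : one (std n T : Mo F) = if n = 0 then 1 else 0 := by
  unfold one
  have key : Subsingleton (Fin n → F) ↔ n = 0 := ?_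
  · by_cases h : n = 0
    · rw [if_pos h]; exact if_pos (key.2 h)
    · rw [if_neg h]; exact if_neg (fun h' => h (key.1 h'))
  constructor
  · intro h
    by_contra h0
    have : Nonempty (Fin n) := ⟨⟨0, by omega⟩⟩
    exact not_subsingleton (Fin n → F) h
  · rintro rfl; infer_instance

lemma sub_std0 (T) : Subsingleton (std 0 T : Mo F).V := by
  show Subsingleton (Fin 0 → F)
  infer_instance

lemma al_one (n : ℕ) : al n (one : CF F) = if n = 0 then 1 else 0 := by
  unfold al
  split_ifs with h
  · subst h
    rw [Q_eq_zero_deg, one_std, if_pos rfl, ga_sub (sub_std0 _), mul_one]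
  · exact Q_zero _ fun T => by simp only [one_std, if_neg h, mul_zero]

lemma ep_one (n : ℕ) : ep n (one : CF F) = if n = 0 then 1 else 0 := by
  unfold ep
  split_ifs with h
  · subst h
    rw [Q_eq_zero_deg, one_std, if_pos rfl, one_of_sub (sub_std0 _), mul_one]
  · exact Q_zero _ fun T => by simp only [one_std, if_neg h, mul_zero]

lemma ga_un (n : ℕ) : ga (un n : Mo F) = if n = 0 then 1 else 1 - qq F := by
  split_ifs with h
  · subst h; exact ga_sub (sub_std0 _)
  · have hn : (e0 n : Fin n → F) ∉ range (xx (un n : Mo F)) := by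
      rintro ⟨w, hw⟩
      rw [un_xx] at hw
      have := congrFun hw ⟨0, by omega⟩
      have e1 : shf n w ⟨0, by omega⟩ = (0 : F) := by simp [shf]
      have e2 : (e0 n : Fin n → F) ⟨0, by omega⟩ = 1 := by simp [e0]
      exact zero_ne_one (e1.symm.trans (this.trans e2))
    have h1 := rk_quo_not (M := un n) hn
    have h2 : rk (quo (un n) (cyc (un n : Mo F) (e0 n : Fin n → F))) = 0 := by
      unfold rk
      have : Subsingleton (quo (un n) (cyc (un n : Mo F) (e0 n : Fin n → F))).V :=
        Submodule.Quotient.subsingleton_iff.2 (un_cyc n)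
      have : Subsingleton ((quo (un n) (cyc (un n : Mo F) (e0 n : Fin n → F))).V ⧸ range (xx (quo (un n) (cyc (un n : Mo F) (e0 n : Fin n → F))))) := inferInstance
      exact finrank_zero_of_subsingleton
    rw [ga, if_pos (un_unip n), ← h1, h2]
    simp [PP]

variable (F) in
noncomputable def NN (n : ℕ) : ℂ := if n = 0 then 1 else (qq F - 1) * qq F ^ (n - 1)

lemma NN_rec {q : ℂ} {a c : ℕ → ℂ} (h : ∀ n, ∑ x ∈ antidiagonal n, a x.1 * c x.2 = if n = 0 then 1 else 0)
    (hc : ∀ n, c n = if n = 0 then 1 else 1 - q) (n : ℕ) : a n = if n = 0 then 1 else (q - 1) * q ^ (n - 1) := by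
  have h1 : ∀ n, ∑ i ∈ Finset.range (n+1), a i = q ^ n := by
    intro n
    induction n with
    | zero =>
      have := h 0
      simp [hc] at this
      simp [this]
    | succ n ih =>
      have := h (n+1)
      rw [Finset.Nat.sum_antidiagonal_eq_sum_range_succ_mk, sum_range_succ] at this
      rw [sum_congr rfl (g := fun i => a i * (1 - q)) (fun i hi => by rw [hc, if_neg]; simp at hi; omega), ← sum_mul, ih, hc] at this
      simp at this
      rw [sum_range_succ, ih, pow_succ]
      linear_combination this
  rcases n with _ | n
  · have := h1 0; simp at this; simp [this]
  · have a1 := h1 (n+1)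
    rw [sum_range_succ, h1 n] at a1
    simp; rw [pow_succ] at a1; linear_combination a1

theorem al_ga (n : ℕ) : al n (ga : CF F) = NN F n := by
  refine NN_rec (a := fun n => al n (ga : CF F)) (c := fun n => al n (be : CF F)) (fun n => ?_) (fun n => ?_) n
  · rw [← al_hm Inv.ga Inv.be, ga_be, al_one]
  · rw [al_be, ga_un]

theorem ep_be (n : ℕ) : ep n (be : CF F) = NN F n := by
  refine NN_rec (a := fun n => ep n (be : CF F)) (c := fun n => ep n (ga : CF F)) (fun n => ?_) (fun n => ?_) n
  · have := ep_hm (F := F) Inv.ga Inv.be n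
    rw [ga_be, ep_one] at this
    rw [this, ← Finset.Nat.sum_antidiagonal_swap]
    exact sum_congr rfl fun x _ => mul_comm _ _
  · rw [ep_eq Inv.ga, ga_un]

end HA

section EX
variable {F : Type} [Field F] [Finite F]

variable (F) in
abbrev LG (n : ℕ) : Type := (Fin n → F) ≃ₗ[F] (Fin n → F)

def gm {n : ℕ} (g : LG F n) : Mo F := std n (g : (Fin n → F) →ₗ[F] (Fin n → F))

structure Cl (n : ℕ) (f : CF F) : Prop where
  inv : Inv f
  supp : ∀ M, f M ≠ 0 → finrank F M.V = n ∧ Injective M.T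

def res (n : ℕ) (f : CF F) : LG F n → ℂ := fun g => f (gm g)

lemma gm_conj {n : ℕ} (g h : LG F n) : Iso (gm (h * g * h⁻¹)) (gm g) := by
  refine Iso.symm ⟨h, fun v => ?_⟩
  show h (g v) = h (g (h⁻¹ (h v)))
  have : h⁻¹ (h v) = v := h.symm_apply_apply v
  rw [this]

lemma conj_of_iso {n : ℕ} {g g' : LG F n} (h : Iso (gm g) (gm g')) : ∃ k : LG F n, k * g * k⁻¹ = g' := by
  obtain ⟨e, he⟩ := h
  let e' : LG F n := e
  refine ⟨e', ?_⟩
  rw [mul_inv_eq_iff_eq_mul]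
  exact LinearEquiv.ext he

lemma exists_gm {n : ℕ} {M : Mo F} (hn : finrank F M.V = n) (h : Injective M.T) :
    ∃ g : LG F n, Iso M (gm g) := by
  let e : M.V ≃ₗ[F] (Fin n → F) := ofFinrankEq _ _ (by simp [hn])
  let t : M.V ≃ₗ[F] M.V := LinearEquiv.ofInjectiveEndo M.T h
  refine ⟨e.symm.trans (t.trans e), e, fun v => ?_⟩
  show e (M.T v) = e (t (e.symm (e v)))
  simp [t]

lemma gm_finrank {n : ℕ} (g : LG F n) : finrank F (gm g).V = n := by
  show finrank F (Fin n → F) = n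
  simp
lemma gm_inj {n : ℕ} (g : LG F n) : Injective (gm g).T := g.injective

lemma res_class {n : ℕ} {f : CF F} (hf : Inv f) : IsClass (res n f) := fun g h => hf _ _ (gm_conj g h)

lemma Cl.ext {n : ℕ} {f f' : CF F} (hf : Cl n f) (hf' : Cl n f') (h : res n f = res n f') : f = f' := by
  funext M
  by_cases hM : finrank F M.V = n ∧ Injective M.T
  · obtain ⟨g, hg⟩ := exists_gm hM.1 hM.2
    rw [hf.inv _ _ hg, hf'.inv _ _ hg]
    exact congrFun h g
  · have h1 : f M = 0 := by by_contra h0; exact hM (hf.supp M h0)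
    have h2 : f' M = 0 := by by_contra h0; exact hM (hf'.supp M h0)
    rw [h1, h2]

open Classical in
noncomputable def ext {n : ℕ} (χ : LG F n → ℂ) (M : Mo F) : ℂ :=
  if h : ∃ g : LG F n, Iso M (gm g) then χ h.choose else 0

lemma ext_gm {n : ℕ} {χ : LG F n → ℂ} (hχ : IsClass χ) {M : Mo F} {g : LG F n} (h : Iso M (gm g)) : ext χ M = χ g := by
  have h' : ∃ g : LG F n, Iso M (gm g) := ⟨g, h⟩
  rw [ext, dif_pos h']
  obtain ⟨k, hk⟩ := conj_of_iso (h'.choose_spec.symm.trans h)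
  rw [← hk, hχ]

lemma cl_ext {n : ℕ} {χ : LG F n → ℂ} (hχ : IsClass χ) : Cl n (ext χ) := by
  constructor
  · intro M N h
    by_cases h' : ∃ g : LG F n, Iso N (gm g)
    · obtain ⟨g, hg⟩ := h'
      rw [ext_gm hχ hg, ext_gm hχ (h.trans hg)]
    · rw [ext, ext, dif_neg h', dif_neg]
      rintro ⟨g, hg⟩; exact h' ⟨g, h.symm.trans hg⟩
  · intro M hM
    by_cases h' : ∃ g : LG F n, Iso M (gm g)
    · obtain ⟨g, e, he⟩ := h'
      refine ⟨e.finrank_eq.trans (gm_finrank g), ?_⟩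
      intro x y hxy
      apply e.injective
      apply gm_inj g
      rw [← he, ← he, hxy]
    · exact absurd (dif_neg h') hM

lemma res_ext {n : ℕ} {χ : LG F n → ℂ} (hχ : IsClass χ) : res n (ext χ) = χ := by
  funext g; exact ext_gm hχ (Iso.refl _)

lemma Cl.add {n : ℕ} {f g : CF F} (hf : Cl n f) (hg : Cl n g) : Cl n (f + g) :=
  ⟨fun M N h => by simp [hf.inv M N h, hg.inv M N h], fun M hM => by
    by_cases h : f M = 0
    · apply hg.supp; intro h'; apply hM; simp [h, h']
    · exact hf.supp M h⟩
lemma Cl.smul {n : ℕ} {f : CF F} (c : ℂ) (hf : Cl n f) : Cl n (c • f) :=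
  ⟨fun M N h => by simp [hf.inv M N h], fun M hM => hf.supp M (by intro h; apply hM; simp [h])⟩
lemma Cl.zero {n : ℕ} : Cl n (0 : CF F) := ⟨fun _ _ _ => rfl, fun M hM => absurd rfl hM⟩
lemma Cl.sum {n : ℕ} {ι : Type*} (s : Finset ι) {f : ι → CF F} (hf : ∀ i ∈ s, Cl n (f i)) : Cl n (∑ i ∈ s, f i) := by
  classical
  induction s using induction_on with
  | empty => simpa using Cl.zero
  | insert a s ha ih =>
    rw [sum_insert ha]
    exact (hf a (by simp)).add (ih fun i hi => hf i (by simp [hi]))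

lemma Cl.expand {n : ℕ} {f : CF F} (hf : Cl n f) :
    f = ∑ χ : {χ : LG F n → ℂ // IrrR (LG F n) χ}, ip χ.1 (res n f) • GLp.ext χ.1 := by
  refine hf.ext (Cl.sum _ fun χ _ => (cl_ext χ.2.isClass).smul _) ?_
  conv_lhs => rw [GLp.expand (res_class (n := n) hf.inv)]
  funext g
  simp only [Finset.sum_apply, res, Pi.smul_apply]
  refine sum_congr rfl fun χ _ => ?_
  rw [show GLp.ext χ.1 (gm g) = χ.1 g from congrFun (res_ext χ.2.isClass) g]

lemma Cl.hm {a b : ℕ} {f g : CF F} (hf : Cl a f) (hg : Cl b g) : Cl (a + b) (hm f g) := by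
  refine ⟨Inv.hm hf.inv hg.inv, fun M hM => ?_⟩
  obtain ⟨N, -, hN⟩ := Finset.exists_ne_zero_of_sum_ne_zero hM
  have h1 := hf.supp _ (left_ne_zero_of_mul hN)
  have h2 := hg.supp _ (right_ne_zero_of_mul hN)
  constructor
  · rw [← h1.1, ← h2.1]
    exact (finrank_quotient_add_finrank N.1).symm
  · rw [← LinearMap.ker_eq_bot, LinearMap.ker_eq_bot']
    intro v hv
    have h3 : mkv N v = 0 := by
      apply h1.2
      rw [← mkv_T, hv, map_zero, map_zero]
    obtain ⟨w, rfl⟩ := sbv_ex N (mkv_zero N |>.1 h3)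
    have : w = 0 := by
      apply h2.2
      apply sbv_inj N
      rw [sbv_T, hv, map_zero, map_zero]
    rw [this, map_zero]

lemma cl_one : Cl 0 (one : CF F) := by
  refine ⟨Inv.one, fun M hM => ?_⟩
  have : Subsingleton M.V := by
    by_contra h; exact hM (if_neg h)
  exact ⟨finrank_zero_of_subsingleton, fun x y _ => Subsingleton.elim _ _⟩

lemma Cl.std_zero {n m : ℕ} {f : CF F} (hf : Cl n f) (h : m ≠ n) (T) : f (std m T) = 0 := by
  by_contra h0
  apply h
  have := (hf.supp _ h0).1
  rw [← this]; show m = finrank F (Fin m → F); simp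

lemma Q_group {n : ℕ} {f : CF F} (hf : ∀ M, f M ≠ 0 → Injective M.T) :
    Q n f = (Fintype.card (LG F n) : ℂ)⁻¹ * ∑ g : LG F n, f (gm g) := by
  classical
  unfold Q gl
  congr 1
  symm
  refine Finset.sum_of_injOn (fun g : LG F n => (g : (Fin n → F) →ₗ[F] (Fin n → F))) ?_ ?_ ?_ ?_
  · intro g _ g' _ h; exact LinearEquiv.toLinearMap_injective h
  · intro _ _; simp
  · intro T _ hT
    by_contra h0
    have hi := hf _ h0
    exact hT ⟨LinearEquiv.ofInjectiveEndo T hi, by simp, by ext; simp⟩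
  · intro g _; rfl

lemma Q_ip {n : ℕ} {f : CF F} (hf : Cl n f) (h : CF F) :
    Q n (fun M => conj (f M) * h M) = ip (res n f) (res n h) := by
  rw [Q_group]
  · rfl
  · intro M hM
    refine (hf.supp M ?_).2
    intro h0; apply hM; simp [h0]

lemma av_nat {P G1 G2 G3 : Type} [Group P] [Fintype P] [Group G1] [Group G2] [Group G3] 
    (h1 : P →* G1) (h2 : P →* G2) (h3 : P →* G3) {χ1 : G1 → ℂ} {χ2 : G2 → ℂ} {χ3 : G3 → ℂ} (c1 : IrrR G1 χ1) (c2 : IrrR G2 χ2)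
    (c3 : IrrR G3 χ3) : ∃ k : ℕ, (Fintype.card P : ℂ)⁻¹ * ∑ x : P, conj (χ1 (h1 x) * χ2 (h2 x)) * χ3 (h3 x) = k := by
  obtain ⟨V, _, _, _, ρ, hρ, rfl⟩ := c1
  obtain ⟨V2, _, _, _, ρ2, hρ2, rfl⟩ := c2
  obtain ⟨V3, _, _, _, ρ3, hρ3, rfl⟩ := c3
  let r1 : Representation ℂ P V := ρ.comp h1
  let r2 : Representation ℂ P V2 := ρ2.comp h2
  let r3 : Representation ℂ P V3 := ρ3.comp h3
  refine ⟨_, ((ip_rep (r1.tprod r2) r3).symm.trans ?_).symm⟩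
  rw [Representation.char_tensor]
  rfl

def Pab (a b : ℕ) : Subgroup (LG F a × LG F b × (((Fin a → F) × (Fin b → F)) ≃ₗ[F] ((Fin a → F) × (Fin b → F)))) where
  carrier := {x | (∀ w, (x.2.2 w).1 = x.1 w.1) ∧ ∀ v, x.2.2 (0, v) = (0, x.2.1 v)}
  mul_mem' := by
    rintro ⟨α, δ, k⟩ ⟨α', δ', k'⟩ ⟨h1, h2⟩ ⟨h1', h2'⟩
    refine ⟨fun w => ?_, fun v => ?_⟩
    · show (k (k' w)).1 = α (α' w.1)
      rw [h1, h1']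
    · show k (k' (0, v)) = (0, δ (δ' v))
      rw [h2', h2]
  one_mem' := ⟨fun w => rfl, fun v => rfl⟩
  inv_mem' := by
    rintro ⟨α, δ, k⟩ ⟨h1, h2⟩
    simp only at h1 h2
    refine ⟨fun w => ?_, fun v => ?_⟩
    · show (k.symm w).1 = α.symm w.1
      rw [LinearEquiv.eq_symm_apply, ← h1, LinearEquiv.apply_symm_apply]
    · show k.symm (0, v) = (0, δ.symm v)
      rw [LinearEquiv.symm_apply_eq, h2, LinearEquiv.apply_symm_apply]

noncomputable def exE {a b : ℕ} (α : LG F a) (δ : LG F b) (c : (Fin a → F) →ₗ[F] (Fin b → F)) :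
    ((Fin a → F) × (Fin b → F)) ≃ₗ[F] ((Fin a → F) × (Fin b → F)) :=
  LinearEquiv.ofInjectiveEndo (LinearMap.prod (α.toLinearMap ∘ₗ fst F (Fin a → F) (Fin b → F))
    (δ.toLinearMap ∘ₗ snd F (Fin a → F) (Fin b → F) + c ∘ₗ fst F (Fin a → F) (Fin b → F))) (by
    have key : ∀ w : (Fin a → F) × (Fin b → F), ((α w.1, δ w.2 + c w.1) : (Fin a → F) × (Fin b → F)) = 0 → w = 0 := by
      rintro ⟨u, v⟩ h
      have h1 : α u = 0 := congrArg Prod.fst h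
      have h2 : δ v + c u = 0 := congrArg Prod.snd h
      have hu : u = 0 := by simpa using h1
      subst hu
      simp at h2
      rw [h2]; rfl
    rw [← LinearMap.ker_eq_bot, LinearMap.ker_eq_bot']
    intro w hw
    exact key w hw)

lemma exE_apply {a b : ℕ} (α : LG F a) (δ : LG F b) (c : (Fin a → F) →ₗ[F] (Fin b → F)) (w) :
    exE α δ c w = (α w.1, δ w.2 + c w.1) := rfl

noncomputable def PabE (a b : ℕ) : (LG F a × LG F b × ((Fin a → F) →ₗ[F] (Fin b → F))) ≃ Pab (F := F) a b where
  toFun x := ⟨(x.1, x.2.1, exE x.1 x.2.1 x.2.2), ⟨fun w => rfl, fun v => by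
    show exE x.1 x.2.1 x.2.2 (0, v) = (0, x.2.1 v)
    rw [exE_apply]; simp⟩⟩
  invFun y := (y.1.1, y.1.2.1, snd F (Fin a → F) (Fin b → F) ∘ₗ y.1.2.2.toLinearMap ∘ₗ inl F (Fin a → F) (Fin b → F))
  left_inv := by
    rintro ⟨α, δ, c⟩
    refine Prod.ext rfl (Prod.ext rfl ?_)
    refine LinearMap.ext fun u => ?_
    show (exE α δ c (u, 0)).2 = c u
    rw [exE_apply]; simp
  right_inv := by
    rintro ⟨⟨α, δ, k⟩, h1, h2⟩
    refine Subtype.ext (Prod.ext rfl (Prod.ext rfl ?_))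
    refine LinearEquiv.ext fun w => ?_
    obtain ⟨u, v⟩ := w
    simp only at h1 h2
    have e1 : k (u, v) = k (u, 0) + k (0, v) := by rw [← map_add]; simp
    show exE α δ _ (u, v) = k (u, v)
    rw [exE_apply, e1, h2]
    refine Prod.ext ?_ ?_
    · show α u = (k (u, 0)).1 + 0
      rw [h1, add_zero]
    · show δ v + (k (u, 0)).2 = (k (u, 0)).2 + δ v
      rw [add_comm]

theorem hm_nat {a b : ℕ} {χ1 : LG F a → ℂ} {χ2 : LG F b → ℂ} {χ : LG F (a + b) → ℂ} (c1 : IrrR _ χ1) (c2 : IrrR _ χ2)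
    (c : IrrR _ χ) : ∃ k : ℕ, ip χ (res (a + b) (hm (ext χ1) (ext χ2))) = k := by
  classical
  letI : Fintype (Pab (F := F) a b) := Fintype.ofEquiv _ (PabE a b)
  let e : ((Fin a → F) × (Fin b → F)) ≃ₗ[F] (Fin (a + b) → F) := ofFinrankEq _ _ (by simp)
  let h3 : Pab (F := F) a b →* LG F (a + b) :=
    { toFun := fun x => e.symm.trans (x.1.2.2.trans e)
      map_one' := by ext; simp
      map_mul' := fun x y => by
        refine LinearEquiv.ext fun w => ?_
        show e (x.1.2.2 (y.1.2.2 (e.symm w))) = e (x.1.2.2 (e.symm (e (y.1.2.2 (e.symm w)))))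
        simp }
  obtain ⟨k, hk⟩ := av_nat ((MonoidHom.fst _ _).comp (Pab (F := F) a b).subtype)
    ((MonoidHom.fst _ _).comp ((MonoidHom.snd _ _).comp (Pab (F := F) a b).subtype)) h3 c1 c2 c
  refine ⟨k, ?_⟩
  have hc1 := cl_ext c1.isClass
  have hc2 := cl_ext c2.isClass
  have hc := cl_ext c.isClass
  rw [← ip_conj, ← Complex.conj_natCast, ← hk]
  congr 1
  nth_rw 1 [← res_ext c.isClass]
  rw [← Q_ip (hc1.hm hc2)]
  have e1 : (fun M => conj (hm (ext χ1) (ext χ2) M) * ext χ M) = fun M => hm (fun M => conj (ext χ1 M)) (fun M => conj (ext χ2 M)) M * ext χ M := by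
    funext M; rw [hm_conj]
  rw [e1, adj_hm hc1.inv.conj hc2.inv.conj hc.inv, sum_eq_single (a, b)]
  · have e2 : Q a (fun A => Q b (fun B => conj (ext χ1 A) * conj (ext χ2 B) * De (ext χ) A B)) =
      (Fintype.card (LG F a) : ℂ)⁻¹ * ∑ α : LG F a, (Fintype.card (LG F b) : ℂ)⁻¹ * ∑ δ : LG F b, (Fintype.card ((Fin a → F) →ₗ[F] (Fin b → F)) : ℂ)⁻¹ * ∑ c, conj (χ1 α * χ2 δ) * ext χ (Ex (gm α) (gm δ) c) := by
      rw [Q_group]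
      · congr 1
        refine sum_congr rfl fun α _ => ?_
        rw [Q_group]
        · congr 1
          refine sum_congr rfl fun δ _ => ?_
          rw [ext_gm c1.isClass (Iso.refl _), ext_gm c2.isClass (Iso.refl _), map_mul, ← mul_sum, mul_left_comm]
          rfl
        · intro M hM
          refine (hc2.supp M ?_).2
          intro h0; apply hM; simp [h0]
      · intro M hM
        refine (hc1.supp M ?_).2
        intro h0; apply hM; simp only [h0, map_zero, zero_mul]
        exact Q_zero _ fun _ => rfl
    simp only
    rw [e2]
    rw [← card_congr (PabE (F := F) a b), ← sum_equiv (PabE (F := F) a b) _ _ (fun x => rfl)]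
    rw [sum_prod_type]
    simp only [sum_prod_type, card_prod, Nat.cast_mul, mul_inv, ← mul_sum, mul_assoc]
    congr 3
    refine sum_congr rfl fun α _ => sum_congr rfl fun δ _ => ?_
    show (_ * _) = _
    rw [mul_sum]
    refine sum_congr rfl fun d _ => ?_
    congr 1
    refine ext_gm (M := Ex (gm α) (gm δ) d) (g := e.symm.trans ((exE α δ d).trans e)) c.isClass ⟨e, fun w => ?_⟩
    have hw : ∀ w : (Fin a → F) × (Fin b → F), e ((exE α δ d) w) = e ((exE α δ d) (e.symm (e w))) := by
      intro w; rw [LinearEquiv.symm_apply_apply]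
    exact hw w
  · rintro ⟨i, j⟩ hij hne
    by_cases hi : i = a
    · have hj : j ≠ b := by intro hj; exact hne (by rw [hi, hj])
      refine Q_zero _ fun T => Q_zero _ fun T' => ?_
      rw [hc2.std_zero hj]; simp
    · refine Q_zero _ fun T => Q_zero _ fun T' => ?_
      rw [hc1.std_zero hi]; simp
  · intro h; exact absurd (by simp) h

structure IntC (n : ℕ) (f : CF F) : Prop extends Cl n f where
  coef : ∀ χ : LG F n → ℂ, IrrR _ χ → ∃ k : ℤ, ip χ (res n f) = k

lemma IntC.add {n : ℕ} {f g : CF F} (hf : IntC n f) (hg : IntC n g) : IntC n (f + g) := by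
  refine ⟨hf.toCl.add hg.toCl, fun χ hχ => ?_⟩
  obtain ⟨k, hk⟩ := hf.coef χ hχ
  obtain ⟨l, hl⟩ := hg.coef χ hχ
  refine ⟨k + l, ?_⟩
  rw [show res n (f + g) = res n f + res n g from rfl, ip_add_right, hk, hl]; push_cast; rfl
lemma IntC.zsmul {n : ℕ} {f : CF F} (m : ℤ) (hf : IntC n f) : IntC n ((m : ℂ) • f) := by
  refine ⟨hf.toCl.smul _, fun χ hχ => ?_⟩
  obtain ⟨k, hk⟩ := hf.coef χ hχ
  refine ⟨m * k, ?_⟩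
  rw [show res n ((m : ℂ) • f) = (m : ℂ) • res n f from rfl, ip_smul_right, hk]; push_cast; rfl
lemma IntC.zero {n : ℕ} : IntC n (0 : CF F) := by
  refine ⟨Cl.zero, fun χ hχ => ⟨0, ?_⟩⟩
  rw [show res n (0 : CF F) = 0 from rfl, ip_zero_right]; simp
lemma IntC.sum {n : ℕ} {ι : Type*} (s : Finset ι) {f : ι → CF F} (hf : ∀ i ∈ s, IntC n (f i)) : IntC n (∑ i ∈ s, f i) := by
  classical
  induction s using induction_on with
  | empty => simpa using IntC.zero
  | insert a s ha ih =>
    rw [sum_insert ha]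
    exact (hf a (by simp)).add (ih fun i hi => hf i (by simp [hi]))

lemma hm_expand {a b : ℕ} {f g : CF F} (hf : Cl a f) (hg : Cl b g) :
    hm f g = ∑ χ1 : {χ : LG F a → ℂ // IrrR (LG F a) χ}, ∑ χ2 : {χ : LG F b → ℂ // IrrR (LG F b) χ},
      (ip χ1.1 (res a f) * ip χ2.1 (res b g)) • hm (ext χ1.1) (ext χ2.1) := by
  conv_lhs => rw [hf.expand, hg.expand]
  rw [hm_sum_left]
  refine sum_congr rfl fun χ1 _ => ?_
  rw [hm_sum_right]
  refine sum_congr rfl fun χ2 _ => ?_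
  rw [hm_smul_left, hm_smul_right, smul_smul]

lemma IntC_hm_irr {a b : ℕ} {χ1 : LG F a → ℂ} {χ2 : LG F b → ℂ} (c1 : IrrR _ χ1) (c2 : IrrR _ χ2) :
    IntC (a + b) (hm (ext χ1) (ext χ2)) :=
  ⟨(cl_ext c1.isClass).hm (cl_ext c2.isClass), fun χ hχ => by
    obtain ⟨k, hk⟩ := hm_nat c1 c2 hχ
    exact ⟨k, by rw [hk]; simp⟩⟩

lemma IntC.hm {a b : ℕ} {f g : CF F} (hf : IntC a f) (hg : IntC b g) : IntC (a + b) (hm f g) := by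
  rw [hm_expand hf.toCl hg.toCl]
  refine IntC.sum _ fun χ1 _ => IntC.sum _ fun χ2 _ => ?_
  obtain ⟨k, hk⟩ := hf.coef χ1.1 χ1.2
  obtain ⟨l, hl⟩ := hg.coef χ2.1 χ2.2
  rw [hk, hl, ← Int.cast_mul]
  exact (IntC_hm_irr χ1.2 χ2.2).zsmul _

structure PosC (n : ℕ) (f : CF F) : Prop extends Cl n f where
  coef : ∀ χ : LG F n → ℂ, IrrR _ χ → ∃ k : ℕ, ip χ (res n f) = k

lemma PosC.add {n : ℕ} {f g : CF F} (hf : PosC n f) (hg : PosC n g) : PosC n (f + g) := by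
  refine ⟨hf.toCl.add hg.toCl, fun χ hχ => ?_⟩
  obtain ⟨k, hk⟩ := hf.coef χ hχ
  obtain ⟨l, hl⟩ := hg.coef χ hχ
  refine ⟨k + l, ?_⟩
  rw [show res n (f + g) = res n f + res n g from rfl, ip_add_right, hk, hl]; push_cast; rfl
lemma PosC.nsmul {n : ℕ} {f : CF F} (m : ℕ) (hf : PosC n f) : PosC n ((m : ℂ) • f) := by
  refine ⟨hf.toCl.smul _, fun χ hχ => ?_⟩
  obtain ⟨k, hk⟩ := hf.coef χ hχ
  refine ⟨m * k, ?_⟩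
  rw [show res n ((m : ℂ) • f) = (m : ℂ) • res n f from rfl, ip_smul_right, hk]; push_cast; rfl
lemma PosC.zero {n : ℕ} : PosC n (0 : CF F) := by
  refine ⟨Cl.zero, fun χ hχ => ⟨0, ?_⟩⟩
  rw [show res n (0 : CF F) = 0 from rfl, ip_zero_right]; simp
lemma PosC.sum {n : ℕ} {ι : Type*} (s : Finset ι) {f : ι → CF F} (hf : ∀ i ∈ s, PosC n (f i)) : PosC n (∑ i ∈ s, f i) := by
  classical
  induction s using induction_on with
  | empty => simpa using PosC.zero
  | insert a s ha ih =>
    rw [sum_insert ha]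
    exact (hf a (by simp)).add (ih fun i hi => hf i (by simp [hi]))
lemma PosC_hm_irr {a b : ℕ} {χ1 : LG F a → ℂ} {χ2 : LG F b → ℂ} (c1 : IrrR _ χ1) (c2 : IrrR _ χ2) :
    PosC (a + b) (hm (ext χ1) (ext χ2)) :=
  ⟨(cl_ext c1.isClass).hm (cl_ext c2.isClass), fun χ hχ => hm_nat c1 c2 hχ⟩
lemma PosC.hm {a b : ℕ} {f g : CF F} (hf : PosC a f) (hg : PosC b g) : PosC (a + b) (hm f g) := by
  rw [hm_expand hf.toCl hg.toCl]
  refine PosC.sum _ fun χ1 _ => PosC.sum _ fun χ2 _ => ?_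
  obtain ⟨k, hk⟩ := hf.coef χ1.1 χ1.2
  obtain ⟨l, hl⟩ := hg.coef χ2.1 χ2.2
  rw [hk, hl, ← Nat.cast_mul]
  exact (PosC_hm_irr χ1.2 χ2.2).nsmul _
lemma PosC.int {n : ℕ} {f : CF F} (hf : PosC n f) : IntC n f :=
  ⟨hf.toCl, fun χ hχ => by obtain ⟨k, hk⟩ := hf.coef χ hχ; exact ⟨k, by rw [hk]; simp⟩⟩

lemma PosC_irr {n : ℕ} {χ : LG F n → ℂ} (c : IrrR _ χ) : PosC n (ext χ) := by
  classical
  refine ⟨cl_ext c.isClass, fun ξ hξ => ?_⟩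
  rw [res_ext c.isClass, ip_irr hξ c]
  split_ifs
  · exact ⟨1, by simp⟩
  · exact ⟨0, by simp⟩

end EX

section WH
variable {F : Type} [Field F] [Fintype F] [DecidableEq F]

lemma av_pair {ι κ : Type*} [Fintype ι] [Fintype κ] (φ : ι → κ → ℂ) :
    av (fun x : ι × κ => φ x.1 x.2) = av fun i => av fun j => φ i j := by
  unfold av
  rw [sum_prod_type, card_prod, ← mul_sum, ← mul_assoc, Nat.cast_mul, mul_inv]

lemma av_congr {ι : Type*} [Fintype ι] {φ ψ : ι → ℂ} (h : ∀ i, φ i = ψ i) : av φ = av ψ := by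
  rw [funext h]
lemma av_swap {ι κ : Type*} [Fintype ι] [Fintype κ] (φ : ι → κ → ℂ) :
    av (fun i => av fun j => φ i j) = av fun j => av fun i => φ i j := by
  rw [← av_pair, ← av_pair (fun j i => φ i j)]
  exact av_equiv (Equiv.prodComm _ _) _ _ fun _ => rfl
lemma av_mul_right {ι : Type*} [Fintype ι] (a : ℂ) (φ : ι → ℂ) : av (fun i => φ i * a) = av φ * a := by
  unfold av; rw [← sum_mul, mul_assoc]
lemma av_add {ι : Type*} [Fintype ι] (φ ψ : ι → ℂ) : av (fun i => φ i + ψ i) = av φ + av ψ := by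
  unfold av; rw [sum_add_distrib, mul_add]
lemma av_const {ι : Type*} [Fintype ι] [Nonempty ι] (a : ℂ) : av (fun _ : ι => a) = a := by
  unfold av
  rw [sum_const, nsmul_eq_mul, ← mul_assoc, card_univ, inv_mul_cancel₀, one_mul]
  exact_mod_cast card_ne_zero
lemma av_pi {n : ℕ} {κ : Type*} [Fintype κ] [DecidableEq κ] (φ : Fin n → κ → ℂ) :
    av (fun x : Fin n → κ => ∏ i, φ i (x i)) = ∏ i, av (φ i) := by
  unfold av
  rw [Finset.prod_mul_distrib, Finset.prod_univ_sum, Fintype.piFinset_univ]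
  simp

abbrev MM (F : Type) (n : ℕ) := Matrix (Fin n) (Fin n) F

def um {n : ℕ} (X : MM F n) : MM F n := fun i j => if i = j then 1 else if i < j then X i j else 0

def mo {n : ℕ} (A : MM F n) : Mo F := std n (Matrix.toLin' A)

def sd {n : ℕ} (X : MM F n) (i : Fin n) : F := if h : i.1 + 1 < n then X i ⟨i.1 + 1, h⟩ else X i i

noncomputable def wt {n : ℕ} (w : ℕ → F → ℂ) (X : MM F n) : ℂ := ∏ i : Fin n, if i.1 + 1 < n then w i (sd X i) else 1

noncomputable def AA (n : ℕ) (w : ℕ → F → ℂ) (f : CF F) : ℂ := av fun X : MM F n => wt w X * f (mo (um X))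

lemma sd_surj (n : ℕ) : Surjective (sd : MM F n → Fin n → F) := by
  intro v
  refine ⟨fun i j => v i, ?_⟩
  funext i
  unfold sd; split_ifs <;> rfl

lemma av_wt {n : ℕ} (w : ℕ → F → ℂ) : av (fun X : MM F n => wt w X) = ∏ i : Fin n, if i.1 + 1 < n then av (w i) else 1 := by
  let p : MM F n →+ (Fin n → F) := 
    { toFun := sd
      map_zero' := by funext i; simp [sd]
      map_add' := fun X Y => by
        funext i
        simp only [sd, Pi.add_apply]
        split_ifs <;> rfl }
  have := av_surj p (sd_surj n) (fun v => ∏ i : Fin n, if i.1 + 1 < n then w i (v i) else 1)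
  refine this.trans ?_
  rw [av_pi (fun (i : Fin n) x => if i.1 + 1 < n then w i x else 1)]
  refine prod_congr rfl fun i _ => ?_
  split_ifs
  · rfl
  · exact av_const _

lemma mo_xx {n : ℕ} (X : MM F n) (v : Fin n → F) (i : Fin n) :
    (show Fin n → F from xx (mo (um X)) v) i = ∑ j, if i < j then X i j * v j else 0 := by
  show (Matrix.toLin' (um X) v - v) i = _
  rw [Pi.sub_apply, Matrix.toLin'_apply, Matrix.mulVec, dotProduct, sub_eq_iff_eq_add]
  have : v i = ∑ j, if i = j then v j else 0 := by simp
  rw [this, ← sum_add_distrib]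
  refine sum_congr rfl fun j _ => ?_
  unfold um
  by_cases h1 : i = j
  · subst h1; simp
  · simp [h1]

def xv {n : ℕ} (X : MM F n) (k : ℕ) (v : Fin n → F) : Fin n → F := (xx (mo (um X)) ^ k) v
lemma xv_succ {n : ℕ} (X : MM F n) (k : ℕ) (v : Fin n → F) (i : Fin n) :
    xv X (k+1) v i = ∑ j, if i < j then X i j * xv X k v j else 0 := by
  have h : xv X (k+1) v = (show Fin n → F from xx (mo (um X)) (xv X k v)) := xx_pow_succ (mo (um X)) k v
  rw [h]
  exact mo_xx X _ i

lemma mo_pow {n : ℕ} (X : MM F n) (k r : ℕ) (v : Fin n → F) (hv : ∀ i : Fin n, r ≤ i.1 → v i = 0) :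
    ∀ i : Fin n, r ≤ i.1 + k → xv X k v i = 0 := by
  induction k with
  | zero => intro i hi; exact hv i hi
  | succ k ih =>
    intro i hi
    rw [xv_succ]
    refine sum_eq_zero fun j _ => ?_
    split_ifs with h
    · have := ih j (by have : i.1 < j.1 := h; omega)
      exact mul_eq_zero_of_right _ this
    · rfl

lemma mo_unip {n : ℕ} (X : MM F n) : Unip (mo (um X)) := by
  refine ⟨n, fun v => ?_⟩
  have := mo_pow X n n v (fun i hi => absurd i.2 (by omega))
  funext i
  exact this i (by omega)

lemma mo_cyc {n : ℕ} (X : MM F (n+1)) (hX : ∀ i : Fin (n+1), i.1 + 1 < n + 1 → sd X i ≠ 0) :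
    ∃ v, (cyc (mo (um X)) v).1 = ⊤ := by
  let v : Fin (n+1) → F := fun i => if i.1 = n then 1 else 0
  let y : ℕ → (Fin (n+1) → F) := fun k => xv X k v
  have hy0 : ∀ k, ∀ i : Fin (n+1), n + 1 ≤ i.1 + k → y k i = 0 := fun k => mo_pow X k (n+1) v (fun i hi => absurd i.2 (by omega))
  have hy1 : ∀ k, ∀ i : Fin (n+1), i.1 + k = n → y k i ≠ 0 := by
    intro k
    induction k with
    | zero => 
      intro i hi
      show v i ≠ 0
      simp only [v, if_pos (show i.1 = n by omega)]; exact one_ne_zero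
    | succ k ih =>
      intro i hi
      have e1 : y (k+1) i = ∑ j, if i < j then X i j * y k j else 0 := xv_succ X k v i
      have hlt : i.1 + 1 < n + 1 := by omega
      rw [e1, sum_eq_single ⟨i.1 + 1, hlt⟩]
      · rw [if_pos (by show i.1 < i.1 + 1; omega)]
        refine mul_ne_zero ?_ (ih _ (by show i.1 + 1 + k = n; omega))
        have := hX i hlt
        rwa [sd, dif_pos hlt] at this
      · intro j _ hj
        split_ifs with h
        · have h1 : i.1 < j.1 := h
          have h2 : j.1 ≠ i.1 + 1 := fun h' => hj (Fin.ext h')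
          rw [hy0 k j (by omega), mul_zero]
        · rfl
      · intro h; exact absurd (mem_univ _) h
  refine ⟨v, ?_⟩
  let C : Submodule F (Fin (n+1) → F) := (cyc (mo (um X)) v).1
  have hyC : ∀ k, y k ∈ C := fun k => xx_pow_mem (cyc (mo (um X)) v) k (mem_cyc (mo (um X)) v)
  have key : ∀ r, r ≤ n + 1 → ∀ z : Fin (n+1) → F, (∀ i : Fin (n+1), r ≤ i.1 → z i = 0) → z ∈ C := by
    intro r
    induction r with
    | zero => intro _ z hz; rw [show z = 0 from funext fun i => hz i (by omega)]; exact C.zero_mem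
    | succ r ih =>
      intro hr z hz
      have hne := hy1 (n - r) ⟨r, by omega⟩ (by show r + (n - r) = n; omega)
      have : z = (z - (z ⟨r, by omega⟩ / y (n-r) ⟨r, by omega⟩) • y (n - r)) + (z ⟨r, by omega⟩ / y (n-r) ⟨r, by omega⟩) • y (n - r) := by simp
      rw [this]
      refine C.add_mem (ih (by omega) _ fun i hi => ?_) (C.smul_mem _ (hyC _))
      by_cases h : i.1 = r
      · have : i = ⟨r, by omega⟩ := Fin.ext h
        rw [this, Pi.sub_apply, Pi.smul_apply, smul_eq_mul, div_mul_cancel₀ _ hne, sub_self]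
      · rw [Pi.sub_apply, Pi.smul_apply, hz i (by omega), hy0 (n-r) i (by omega)]; simp
  show C = ⊤
  rw [eq_top_iff]
  intro z _
  exact key (n+1) le_rfl z fun i hi => absurd i.2 (by omega)

lemma mo_un {n : ℕ} (X : MM F n) (hX : ∀ i : Fin n, i.1 + 1 < n → sd X i ≠ 0) : Iso (mo (um X)) (un n) := by
  have hfr : finrank F (mo (um X)).V = n := by
    show finrank F (Fin n → F) = n
    simp
  have : ∃ v, (cyc (mo (um X)) v).1 = ⊤ := by
    cases n with
    | zero => 
      refine ⟨(0 : Fin 0 → F), ?_⟩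
      refine eq_top_iff.2 fun z _ => ?_
      have h0 : ∀ x y : Fin 0 → F, x = y := fun x y => Subsingleton.elim _ _
      rw [show z = 0 from h0 z 0]; exact Submodule.zero_mem _
    | succ n => exact mo_cyc X hX
  obtain ⟨v, hv⟩ := this
  have := iso_un (mo_unip X) hv
  rwa [hfr] at this

def b11 {k m : ℕ} (X : MM F (k + m)) : MM F k := fun i j => X (Fin.castAdd m i) (Fin.castAdd m j)
def b22 {k m : ℕ} (X : MM F (k + m)) : MM F m := fun i j => X (Fin.natAdd k i) (Fin.natAdd k j)
def b12 {k m : ℕ} (X : MM F (k + m)) : Matrix (Fin k) (Fin m) F := fun i j => X (Fin.castAdd m i) (Fin.natAdd k j)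

def spl (k m : ℕ) : (Fin (k + m) → F) ≃ₗ[F] (Fin m → F) × (Fin k → F) where
  toFun v := (fun i => v (Fin.natAdd k i), fun i => v (Fin.castAdd m i))
  invFun w := Fin.append w.2 w.1
  map_add' v w := rfl
  map_smul' c v := rfl
  left_inv v := by
    funext i
    refine Fin.addCases (fun i => ?_) (fun i => ?_) i
    · simp
    · simp
  right_inv w := by
    refine Prod.ext ?_ ?_
    · funext i; simp
    · funext i; simp

def ExS {k m : ℕ} (A : MM F m) (B : MM F k) (c : (Fin m → F) →ₗ[F] (Fin k → F)) : Mo F := Ex (mo A) (mo B) c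
lemma um_block {k m : ℕ} (X : MM F (k + m)) :
    Iso (mo (um X)) (ExS (um (b22 X)) (um (b11 X)) (Matrix.toLin' (b12 X))) := by
  refine ⟨spl k m, fun v => ?_⟩
  have key : ∀ v : Fin (k+m) → F, spl k m (Matrix.toLin' (um X) v) =
      (Matrix.toLin' (um (b22 X)) (spl k m v).1, Matrix.toLin' (um (b11 X)) (spl k m v).2 + Matrix.toLin' (b12 X) (spl k m v).1) := by
    intro v
    refine Prod.ext ?_ ?_
    · funext i
      show Matrix.toLin' (um X) v (Fin.natAdd k i) = Matrix.toLin' (um (b22 X)) (fun i => v (Fin.natAdd k i)) i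
      simp only [Matrix.toLin'_apply, Matrix.mulVec, dotProduct]
      rw [Fin.sum_univ_add, sum_eq_zero, zero_add]
      · refine sum_congr rfl fun j _ => ?_
        congr 1
        simp only [um, b22, Fin.natAdd_inj, Fin.natAdd_lt_natAdd_iff]
      · intro j _
        have h1 : ¬ (Fin.natAdd k i = Fin.castAdd m j) := by
          intro h; have := congrArg Fin.val h; simp at this; omega
        have h2 : ¬ (Fin.natAdd k i < Fin.castAdd m j) := by
          intro h; have : k + i.1 < j.1 := h; omega
        simp only [um, if_neg h1, if_neg h2, zero_mul]
    · funext i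
      show Matrix.toLin' (um X) v (Fin.castAdd m i) = Matrix.toLin' (um (b11 X)) (fun i => v (Fin.castAdd m i)) i + Matrix.toLin' (b12 X) (fun i => v (Fin.natAdd k i)) i
      simp only [Matrix.toLin'_apply, Matrix.mulVec, dotProduct]
      rw [Fin.sum_univ_add]
      congr 1
      · refine sum_congr rfl fun j _ => ?_
        congr 1
        simp only [um, b11, Fin.castAdd_inj]
        rfl
      · refine sum_congr rfl fun j _ => ?_
        congr 1
        have h1 : ¬ (Fin.castAdd m i = Fin.natAdd k j) := by
          intro h; have := congrArg Fin.val h; simp at this; omega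
        have h2 : (Fin.castAdd m i < Fin.natAdd k j) := by
          show i.1 < k + j.1; omega
        simp only [um, if_neg h1, if_pos h2, b12]
  exact key v

lemma wt_block {k m : ℕ} (w : ℕ → F → ℂ) (hw : ∀ c, w (k - 1) c = 1) (hk : 0 < k) (X : MM F (k + m)) :
    wt w X = wt w (b11 X) * wt (fun i => w (k + i)) (b22 X) := by
  unfold wt
  rw [Fin.prod_univ_add]
  congr 1
  · refine prod_congr rfl fun i _ => ?_
    simp only [Fin.val_castAdd]
    by_cases h : i.1 + 1 < k
    · rw [if_pos h, if_pos (by omega)]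
      congr 1
      unfold sd
      rw [dif_pos (show (Fin.castAdd m i).1 + 1 < k + m by simp; omega), dif_pos h]
      rfl
    · rw [if_neg h]
      split_ifs
      · rw [show i.1 = k - 1 by omega]; exact hw _
      · rfl
  · refine prod_congr rfl fun i _ => ?_
    simp only [Fin.val_natAdd]
    by_cases h : i.1 + 1 < m
    · rw [if_pos h, if_pos (by omega)]
      congr 1
      unfold sd
      rw [dif_pos (show (Fin.natAdd k i).1 + 1 < k + m by simp; omega), dif_pos h]
      rfl
    · rw [if_neg h, if_neg (by omega)]

lemma AA_block {k m : ℕ} (w : ℕ → F → ℂ) (hw : ∀ c, w (k - 1) c = 1) (hk : 0 < k) {f : CF F} (hf : Inv f) :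
    AA (k + m) w f = AA m (fun i => w (k + i)) fun A => AA k w fun B => De f A B := by
  classical
  let p : MM F (k + m) →+ MM F m × MM F k × ((Fin m → F) →ₗ[F] (Fin k → F)) :=
    { toFun := fun X => (b22 X, b11 X, Matrix.toLin' (b12 X))
      map_zero' := by
        refine Prod.ext rfl (Prod.ext rfl ?_)
        show Matrix.toLin' (0 : Matrix (Fin k) (Fin m) F) = 0
        simp
      map_add' := fun X Y => by
        refine Prod.ext rfl (Prod.ext rfl ?_)
        show Matrix.toLin' (b12 X + b12 Y) = Matrix.toLin' (b12 X) + Matrix.toLin' (b12 Y)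
        simp }
  have hp : Surjective p := by
    rintro ⟨A, B, c⟩
    refine ⟨Matrix.reindex finSumFinEquiv finSumFinEquiv (Matrix.fromBlocks B (toMatrix' c) 0 A), ?_⟩
    refine Prod.ext ?_ (Prod.ext ?_ ?_)
    · ext i j
      show Matrix.fromBlocks B (toMatrix' c) 0 A (finSumFinEquiv.symm _) (finSumFinEquiv.symm _) = A i j
      simp
    · ext i j
      show Matrix.fromBlocks B (toMatrix' c) 0 A (finSumFinEquiv.symm _) (finSumFinEquiv.symm _) = B i j
      simp
    · apply LinearMap.toMatrix'.injective
      show toMatrix' (Matrix.toLin' _) = _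
      rw [LinearMap.toMatrix'_toLin']
      ext i j
      show Matrix.fromBlocks B (toMatrix' c) 0 A (finSumFinEquiv.symm _) (finSumFinEquiv.symm _) = _
      simp
  have h1 : ∀ X : MM F (k+m), wt w X * f (mo (um X)) = (fun x : MM F m × MM F k × ((Fin m → F) →ₗ[F] (Fin k → F)) =>
      (wt w x.2.1 * wt (fun i => w (k + i)) x.1) * f (ExS (um x.1) (um x.2.1) x.2.2)) (p X) := by
    intro X
    rw [wt_block w hw hk X, hf _ _ (um_block X)]
    rfl
  unfold AA
  rw [av_congr h1, av_surj p hp (fun x : MM F m × MM F k × ((Fin m → F) →ₗ[F] (Fin k → F)) => (wt w x.2.1 * wt (fun i => w (k + i)) x.1) * f (ExS (um x.1) (um x.2.1) x.2.2))]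
  rw [av_pair (fun (a : MM F m) (x : MM F k × ((Fin m → F) →ₗ[F] (Fin k → F))) => (wt w x.1 * wt (fun i => w (k + i)) a) * f (ExS (um a) (um x.1) x.2))]
  refine av_congr fun A => ?_
  rw [av_pair (fun (a : MM F k) (x : ((Fin m → F) →ₗ[F] (Fin k → F))) => (wt w a * wt (fun i => w (k + i)) A) * f (ExS (um A) (um a) x))]
  rw [← av_mul_left]
  refine av_congr fun B => ?_
  rw [av_mul_left, mul_comm (wt w B), mul_assoc]
  rfl

noncomputable def RR (F : Type) [Field F] [Fintype F] [DecidableEq F] (c : F) : ℂ := if c = 0 then 0 else qq F / (qq F - 1)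

lemma qq_ne : qq F - 1 ≠ 0 := by
  unfold qq
  have : 1 < Nat.card F := by rw [Nat.card_eq_fintype_card]; exact Fintype.one_lt_card
  rw [sub_ne_zero]; exact_mod_cast (by omega)
lemma qq_ne0 : qq F ≠ 0 := by
  unfold qq
  have : 1 < Nat.card F := by rw [Nat.card_eq_fintype_card]; exact Fintype.one_lt_card
  exact_mod_cast (by omega)

lemma av_RR : av (RR F) = 1 := by
  unfold av RR
  have h : ∀ c : F, (if c = 0 then 0 else qq F / (qq F - 1)) = qq F / (qq F - 1) - if c = 0 then qq F / (qq F - 1) else 0 := by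
    intro c; split_ifs <;> simp
  rw [sum_congr rfl fun c _ => h c, sum_sub_distrib, Finset.sum_ite_eq' , sum_const, nsmul_eq_mul]
  have h1 : ((univ : Finset F).card : ℂ) = qq F := by unfold qq; rw [Nat.card_eq_fintype_card]; rfl
  have h2 : (Fintype.card F : ℂ) = qq F := h1
  rw [h1, h2]
  have := qq_ne (F := F); have := qq_ne0 (F := F)
  simp; field_simp

lemma AA_reg {k : ℕ} (w : ℕ → F → ℂ) (hw : ∀ i, i + 1 < k → w i = RR F) {f : CF F} (hf : Inv f) :
    AA k w f = f (un k) := by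
  unfold AA
  have h1 : ∀ X : MM F k, wt w X * f (mo (um X)) = wt w X * f (un k) := by
    intro X
    by_cases h : ∀ i : Fin k, i.1 + 1 < k → sd X i ≠ 0
    · rw [hf _ _ (mo_un X h)]
    · push Not at h
      obtain ⟨i, hi, h0⟩ := h
      have : wt w X = 0 := by
        unfold wt
        refine Finset.prod_eq_zero (mem_univ i) ?_
        rw [if_pos hi, hw _ hi, h0]; simp [RR]
      rw [this, zero_mul, zero_mul]
  rw [av_congr h1, av_mul_right, av_wt, Finset.prod_eq_one, one_mul]
  intro i _
  split_ifs with h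
  · rw [hw _ h, av_RR]
  · rfl

noncomputable def KK (F : Type) [Field F] [Fintype F] [DecidableEq F] (c : F) : ℂ := 1 - RR F c
noncomputable def W (n : ℕ) (f : CF F) : ℂ := AA n (fun _ => KK F) f

lemma AA_congr {n : ℕ} {w w' : ℕ → F → ℂ} (h : ∀ i, i + 1 < n → w i = w' i) (f : CF F) : AA n w f = AA n w' f := by
  refine av_congr fun X => ?_
  congr 1
  refine prod_congr rfl fun i _ => ?_
  split_ifs with hi
  · rw [h _ hi]
  · rfl

lemma AA_add {n : ℕ} {w w' w'' : ℕ → F → ℂ} (k : ℕ) (hk : k + 1 < n) (h : ∀ i, i ≠ k → w i = w'' i ∧ w' i = w'' i)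
    (h0 : ∀ c, w k c + w' k c = w'' k c) (f : CF F) : AA n w f + AA n w' f = AA n w'' f := by
  unfold AA
  rw [← av_add]
  refine av_congr fun X => ?_
  rw [← add_mul]
  congr 1
  unfold wt
  have hm : (⟨k, by omega⟩ : Fin n) ∈ univ := mem_univ _
  rw [← Finset.mul_prod_erase _ _ hm, ← Finset.mul_prod_erase _ _ hm, ← Finset.mul_prod_erase _ _ hm]
  simp only [if_pos hk]
  rw [← h0, add_mul]
  congr 2
  · refine prod_congr rfl fun i hi => ?_
    have : i.1 ≠ k := fun h => (Finset.ne_of_mem_erase hi) (Fin.ext h)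
    rw [(h _ this).1]
  · refine prod_congr rfl fun i hi => ?_
    have : i.1 ≠ k := fun h => (Finset.ne_of_mem_erase hi) (Fin.ext h)
    rw [(h _ this).2]

noncomputable def wz (F : Type) [Field F] [Fintype F] [DecidableEq F] (k i : ℕ) : F → ℂ := if i + 1 < k then RR F else KK F
noncomputable def wx (F : Type) [Field F] [Fintype F] [DecidableEq F] (k i : ℕ) : F → ℂ := if i + 1 < k then RR F else if i + 1 = k then fun _ => 1 else KK F

lemma AA_x {N k : ℕ} (hk : 0 < k) (hkN : k ≤ N) {f : CF F} (hf : Inv f) :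
    AA N (wx F k) f = W (N - k) fun A => De f A (un k) := by
  obtain ⟨m, rfl⟩ := Nat.exists_eq_add_of_le hkN
  rw [AA_block _ (fun c => by unfold wx; rw [if_neg (by omega), if_pos (by omega)]) hk hf, Nat.add_sub_cancel_left]
  unfold W
  rw [AA_congr (w' := fun _ => KK F)]
  · congr 1
    funext A
    refine AA_reg _ (fun i hi => ?_) ((De_inv hf).right A)
    unfold wx; rw [if_pos hi]
  · intro i _
    unfold wx; rw [if_neg (by omega), if_neg (by omega)]

lemma W_tel {N : ℕ} {f : CF F} (hf : Inv f) (d : ℕ) (hd : d < N) :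
    ∑ i ∈ Finset.range (d+1), (-1 : ℂ)^i * AA N (wx F (N - i)) f = (-1)^d * AA N (wz F (N - d)) f := by
  induction d with
  | zero =>
    rw [Finset.sum_range_one]
    congr 1
    refine AA_congr (fun i hi => ?_) f
    unfold wx wz; rw [if_pos (by omega), if_pos (by omega)]
  | succ d ih =>
    rw [sum_range_succ, ih (by omega)]
    have := AA_add (F := F) (n := N) (w := wz F (N - (d+1))) (w' := wz F (N - d)) (w'' := wx F (N - (d+1))) (N - (d+1) - 1) (by omega)
      (fun i hi => ⟨?_, ?_⟩) (fun c => ?_) f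
    · rw [← this]; ring
    · unfold wz wx
      by_cases h : i + 1 < N - (d + 1)
      · rw [if_pos h, if_pos h]
      · rw [if_neg h, if_neg h, if_neg (by omega)]
    · unfold wz wx
      by_cases h : i + 1 < N - d
      · rw [if_pos h, if_pos (by omega)]
      · rw [if_neg h, if_neg (by omega), if_neg (by omega)]
    · unfold wz wx
      rw [if_neg (by omega), if_pos (by omega), if_neg (by omega), if_pos (by omega)]
      simp [KK]

theorem W_al (N : ℕ) : ∀ {f : CF F}, Inv f → W N f = (-1)^N * al N f := by
  induction N using Nat.strong_induction_on with
  | _ N ih =>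
  intro f hf
  rcases Nat.eq_zero_or_pos N with rfl | hN
  · have h1 : W 0 f = f (un 0) := AA_reg _ (fun i hi => absurd hi (by omega)) hf
    have h2 : al 0 f = f (std 0 0) := by
      unfold al
      rw [Q_eq_zero_deg, ga_sub (sub_std0 _), one_mul]
    rw [h1, h2, pow_zero, one_mul]
    exact hf _ _ (Iso.symm ⟨LinearEquiv.refl F (Fin 0 → F), fun v => by
      have : ∀ x y : Fin 0 → F, x = y := fun x y => Subsingleton.elim _ _
      exact this _ _⟩)
  · have h1 := W_tel (N := N) hf (N - 1) (by omega)
    have h2 : AA N (wz F (N - (N-1))) f = W N f := AA_congr (fun i hi => by unfold wz; rw [if_neg (by omega)]) f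
    have hN1 : N - 1 + 1 = N := by omega
    rw [h2, hN1] at h1
    have h3 : ∑ i ∈ Finset.range N, (-1 : ℂ)^i * AA N (wx F (N - i)) f = ∑ i ∈ Finset.range N, al i (fun A => De f A (un (N - i))) := by
      refine sum_congr rfl fun i hi => ?_
      have hi' := Finset.mem_range.1 hi
      rw [AA_x (by omega) (by omega) hf, show N - (N - i) = i by omega, ih i hi' ((De_inv hf).left _), ← mul_assoc, ← pow_add]
      rw [Even.neg_one_pow ⟨i, rfl⟩, one_mul]
    have h4 := adj_hm (F := F) Inv.ga Inv.be hf N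
    rw [Finset.Nat.sum_antidiagonal_eq_sum_range_succ (fun a b => Q a (fun A => Q b (fun B => ga A * be B * De f A B)))] at h4
    have h5 : ∀ i, Q i (fun A : Mo F => Q (N - i) (fun B => ga A * be B * De f A B)) = al i (fun A => De f A (un (N - i))) := by
      intro i
      refine Q_congr i fun T => ?_
      have : (fun B : Mo F => ga (std i T : Mo F) * be B * De f (std i T) B) = fun B => ga (std i T : Mo F) * (be B * De f (std i T) B) := by
        funext B; ring
      show Q (N - i) _ = _
      rw [this, Q_mul_left, Q_be_mul ((De_inv hf).right _)]
    rw [sum_congr rfl fun i _ => h5 i, sum_range_succ, ← h3, h1, Nat.sub_self] at h4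
    have h6 : al N (fun A => De f A (un 0)) = al N f := by
      unfold al
      refine Q_congr N fun T => ?_
      congr 1
      exact De_zero_right hf _ _ (sub_std0 _)
    have h7 : Q N (fun M => hm ga be M * f M) = 0 := by
      refine Q_zero N fun T => ?_
      show hm ga be (std N T) * f _ = 0
      rw [ga_be, one_std, if_neg (by omega), zero_mul]
    rw [h6] at h4
    have h8 : (-1 : ℂ)^(N-1) * W N f + al N f = 0 := by rw [← h4]; exact h7
    obtain ⟨M, rfl⟩ : ∃ M, N = M + 1 := ⟨N - 1, by omega⟩
    rw [Nat.add_sub_cancel] at h8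
    have h9 : ((-1 : ℂ)^M) * (-1)^M = 1 := by rw [← pow_add, Even.neg_one_pow ⟨M, rfl⟩]
    calc W (M+1) f = ((-1 : ℂ)^M * (-1)^M) * W (M+1) f := by rw [h9, one_mul]
      _ = (-1)^M * ((-1 : ℂ)^M * W (M+1) f) := by ring
      _ = (-1)^M * (- al (M+1) f) := by rw [eq_neg_of_add_eq_zero_left h8]
      _ = _ := by ring

end WH

section WG
variable {F : Type} [Field F] [Fintype F] [DecidableEq F]

lemma um_iso {n : ℕ} (X Y : MM F n) (t : Fin n → Fˣ) (h : ∀ i j, Y i j = t i * X i j * (t j)⁻¹) : Iso (mo (um X)) (mo (um Y)) := by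
  let e : (Fin n → F) ≃ₗ[F] (Fin n → F) := LinearEquiv.piCongrRight fun i => LinearEquiv.smulOfUnit (t i)
  have he : ∀ v i, e v i = t i * v i := fun v i => rfl
  refine ⟨e, fun v => ?_⟩
  have key : ∀ v : Fin n → F, e (Matrix.toLin' (um X) v) = Matrix.toLin' (um Y) (e v) := by
    intro v
    funext i
    rw [he]
    simp only [Matrix.toLin'_apply, Matrix.mulVec, dotProduct]
    rw [mul_sum]
    refine sum_congr rfl fun j _ => ?_
    rw [he]
    unfold um
    split_ifs with h1 h2
    · subst h1; simp
    · rw [h]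
      have : (t j : F) ≠ 0 := (t j).ne_zero
      simp only [Units.val_inv_eq_inv_val]
      field_simp
    · simp
  exact key v

lemma exists_t {n : ℕ} (s : Fin n → Fˣ) : ∃ t : Fin n → Fˣ, ∀ i : Fin n, ∀ h : i.1 + 1 < n, t i = s i * t ⟨i.1 + 1, h⟩ := by
  refine ⟨fun i => ∏ j ∈ Finset.univ.filter (fun j => i ≤ j), s j, fun i h => ?_⟩
  simp only
  rw [← Finset.prod_insert]
  · refine prod_congr ?_ fun _ _ => rfl
    ext j
    simp only [mem_filter, mem_univ, true_and, Finset.mem_insert, Fin.le_def, Fin.ext_iff]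
    omega
  · simp [Fin.le_def]

variable (ψ : AddChar F ℂ)

lemma AA_twist {n : ℕ} (s : Fin n → Fˣ) {f : CF F} (hf : Inv f) :
    AA n (fun _ c => ψ c) f = AA n (fun i c => if h : i < n then ψ (s ⟨i, h⟩ * c) else 1) f := by
  obtain ⟨t, ht⟩ := exists_t s
  symm
  unfold AA
  let e : MM F n ≃ MM F n := Equiv.piCongrRight fun i => Equiv.piCongrRight fun j =>
    (Units.mulLeft (t i)).trans (Units.mulRight ((t j)⁻¹))
  have he : ∀ X i j, e X i j = t i * X i j * ((t j)⁻¹ : Fˣ) := fun X i j => rfl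
  refine av_equiv e _ _ fun X => ?_
  rw [hf _ _ (um_iso X (e X) t (fun i j => by rw [he]))]
  congr 1
  refine prod_congr rfl fun i _ => ?_
  by_cases hi : i.1 + 1 < n
  · rw [if_pos hi, if_pos hi]
    show (if h : i.1 < n then ψ (s ⟨i.1,h⟩ * sd X i) else 1) = ψ (sd (e X) i)
    rw [dif_pos i.2]
    congr 1
    unfold sd
    rw [dif_pos hi, dif_pos hi, he, ht i hi]
    have : (t ⟨i.1+1, hi⟩ : F) ≠ 0 := (t _).ne_zero
    simp only [Units.val_mul, Units.val_inv_eq_inv_val]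
    field_simp
  · rw [if_neg hi, if_neg hi]

lemma av_unit (hψ : ψ ≠ 1) (c : F) : av (fun s : Fˣ => ψ (s * c)) = KK F c := by
  have hq : (Fintype.card F : ℂ) = qq F := by unfold qq; rw [Nat.card_eq_fintype_card]
  have hu : (Fintype.card Fˣ : ℂ) = qq F - 1 := by
    rw [Fintype.card_units, Nat.cast_sub Fintype.card_pos, hq, Nat.cast_one]
  unfold KK RR
  have := qq_ne (F := F)
  by_cases hc : c = 0
  · subst hc
    simp only [mul_zero, AddChar.map_zero_eq_one, if_true, sub_zero]
    exact av_const _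
  · rw [if_neg hc]
    have h1 : ∑ x : F, ψ (x * c) = 0 := by
      rw [← AddChar.sum_eq_zero_of_ne_one hψ]
      exact sum_equiv (Equiv.mulRight₀ c hc) _ _ fun x => rfl
    have h2 : ∑ x : F, ψ (x * c) = 1 + ∑ s : Fˣ, ψ (s * c) := by
      rw [← Finset.add_sum_erase _ _ (mem_univ (0:F))]
      congr 1
      · simp
      · symm
        refine Finset.sum_bij (fun s _ => (s : F)) (fun s _ => by simp) (fun a _ b _ h => Units.ext h) (fun b hb => ?_) fun _ _ => rfl
        exact ⟨Units.mk0 b (Finset.ne_of_mem_erase hb), by simp, rfl⟩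
    unfold av
    rw [hu, show ∑ s : Fˣ, ψ (s * c) = -1 by linear_combination h1 - h2]
    field_simp
    ring

theorem AA_psi (hψ : ψ ≠ 1) (n : ℕ) {f : CF F} (hf : Inv f) : AA n (fun _ c => ψ c) f = W n f := by
  have h1 : AA n (fun _ c => ψ c) f = av fun s : Fin n → Fˣ => AA n (fun i c => if h : i < n then ψ (s ⟨i, h⟩ * c) else 1) f := by
    rw [av_congr (fun s => (AA_twist ψ s hf).symm), av_const]
  rw [h1]
  unfold W AA
  rw [av_swap]
  refine av_congr fun X => ?_
  rw [av_mul_right]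
  congr 1
  unfold wt
  have h2 : ∀ s : Fin n → Fˣ, (∏ i : Fin n, if i.1 + 1 < n then (if h : i.1 < n then ψ (s ⟨i.1, h⟩ * sd X i) else 1) else 1) =
      ∏ i : Fin n, (fun (i : Fin n) (s : Fˣ) => if i.1 + 1 < n then ψ (s * sd X i) else 1) i (s i) := by
    intro s
    refine prod_congr rfl fun i _ => ?_
    simp only [dif_pos i.2]
  refine (av_congr h2).trans ((av_pi (fun (i : Fin n) (s : Fˣ) => if i.1 + 1 < n then ψ (s * sd X i) else 1)).trans ?_)
  refine prod_congr rfl fun i _ => ?_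
  split_ifs
  · exact av_unit ψ hψ _
  · exact av_const _

def UU (F : Type) [Field F] [Fintype F] [DecidableEq F] (n : ℕ) : Subgroup (Matrix.GeneralLinearGroup (Fin n) F) where
  carrier := {g | (∀ i j, j < i → g.1 i j = 0) ∧ ∀ i, g.1 i i = 1}
  mul_mem' := by
    rintro a b ⟨ha, ha'⟩ ⟨hb, hb'⟩
    refine ⟨fun i j h => ?_, fun i => ?_⟩
    · rw [Units.val_mul, Matrix.mul_apply]
      refine sum_eq_zero fun k _ => ?_
      by_cases hk : k < i
      · rw [ha _ _ hk, zero_mul]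
      · rw [hb k j (lt_of_lt_of_le h (not_lt.1 hk)), mul_zero]
    · rw [Units.val_mul, Matrix.mul_apply, sum_eq_single i, ha', hb', one_mul]
      · intro k _ hk
        rcases lt_or_gt_of_ne hk with hk | hk
        · rw [ha _ _ hk, zero_mul]
        · rw [hb _ _ hk, mul_zero]
      · intro h; exact absurd (mem_univ _) h
  one_mem' := ⟨fun i j h => by rw [Units.val_one]; exact Matrix.one_apply_ne (ne_of_gt h), fun i => by simp⟩
  inv_mem' := by
    rintro g ⟨hg, hg'⟩
    have hB : Matrix.BlockTriangular g.1 id := fun i j h => hg i j h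
    haveI : Invertible g.1 := g.invertible
    have hB' : Matrix.BlockTriangular (g⁻¹).1 id := by
      rw [Matrix.coe_units_inv]; exact Matrix.blockTriangular_inv_of_blockTriangular hB
    refine ⟨fun i j h => hB' h, fun i => ?_⟩
    have h1 : (g.1 * (g⁻¹).1) i i = 1 := by rw [← Units.val_mul]; simp
    rw [Matrix.mul_apply, sum_eq_single i, hg', one_mul] at h1
    · exact h1
    · intro k _ hk
      rcases lt_or_gt_of_ne hk with hk | hk
      · rw [hg _ _ hk, zero_mul]
      · rw [hB' hk, mul_zero]
    · intro h; exact absurd (mem_univ _) h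

lemma um_det {n : ℕ} (X : MM F n) : (um X).det = 1 := by
  rw [Matrix.det_of_upperTriangular]
  · exact Finset.prod_eq_one fun i _ => by simp [um]
  · intro i j h
    have h' : j < i := h
    simp [um, ne_of_gt h', not_lt_of_gt h']

noncomputable def umU {n : ℕ} (X : MM F n) : UU F n :=
  ⟨Matrix.GeneralLinearGroup.mkOfDetNeZero (um X) (by rw [um_det]; exact one_ne_zero), by
    refine ⟨fun i j h => ?_, fun i => ?_⟩
    · show um X i j = 0
      simp [um, ne_of_gt h, not_lt_of_gt h]
    · show um X i i = 1
      simp [um]⟩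
lemma um_self {n : ℕ} (u : UU F n) : um u.1.1 = u.1.1 := by
  ext i j
  unfold um
  split_ifs with h1 h2
  · subst h1; exact (u.2.2 i).symm
  · rfl
  · exact (u.2.1 i j (lt_of_le_of_ne (not_lt.1 h2) (Ne.symm h1))).symm

noncomputable instance {n : ℕ} : Fintype (UU F n) := ofFinite _

lemma av_UU {n : ℕ} (h : MM F n → ℂ) : av (fun u : UU F n => h u.1.1) = av fun X : MM F n => h (um X) := by
  let A := {x : Fin n × Fin n // x.1 < x.2} → F
  let p : MM F n →+ A := { toFun := fun X x => X x.1.1 x.1.2, map_zero' := rfl, map_add' := fun _ _ => rfl }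
  let g : A → MM F n := fun a i j => if h : i < j then a ⟨(i, j), h⟩ else 0
  have hg : ∀ a, p (g a) = a := by
    intro a; funext x
    show g a x.1.1 x.1.2 = a x
    simp only [g, dif_pos x.2]
  have hum : ∀ X, um (g (p X)) = um X := by
    intro X; ext i j
    unfold um
    split_ifs with h1 h2
    · rfl
    · show g (p X) i j = _
      simp only [g, dif_pos h2]; rfl
    · rfl
  have h1 := av_surj p (fun a => ⟨g a, hg a⟩) (fun a => h (um (g a)))
  have h2 : av (fun X : MM F n => h (um X)) = av fun X : MM F n => h (um (g (p X))) := av_congr fun X => by rw [hum]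
  rw [h2, h1]
  symm
  refine av_equiv (⟨fun a => umU (g a), fun u => p u.1.1, fun a => ?_, fun u => ?_⟩ : A ≃ UU F n) _ _ fun a => rfl
  · show p (um (g a)) = a
    funext x
    show um (g a) x.1.1 x.1.2 = a x
    unfold um
    rw [if_neg (ne_of_lt x.2), if_pos x.2]
    simp only [g, dif_pos x.2]
  · refine Subtype.ext (Units.ext ?_)
    show um (g (p u.1.1)) = u.1.1
    rw [hum, um_self]

noncomputable def psg (n : ℕ) (g : MM F n) : ℂ := ∏ i : Fin n, if h : i.1 + 1 < n then ψ (g i ⟨i.1 + 1, h⟩) else 1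

theorem av_U_al (hψ : ψ ≠ 1) (n : ℕ) {f : CF F} (hf : Inv f) :
    av (fun u : UU F n => psg ψ n u.1.1 * f (mo u.1.1)) = (-1)^n * al n f := by
  rw [av_UU (fun A => psg ψ n A * f (mo A)), ← W_al n hf, ← AA_psi ψ hψ n hf]
  refine av_congr fun X => ?_
  congr 1
  refine prod_congr rfl fun i _ => ?_
  by_cases h : i.1 + 1 < n
  · rw [dif_pos h, if_pos h, sd, dif_pos h]
    congr 1
    unfold um
    rw [if_neg, if_pos]
    · show i.1 < i.1 + 1; omega
    · intro h'; have := congrArg Fin.val h'; simp at this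
  · rw [dif_neg h, if_neg h]

lemma psg_mul {n : ℕ} (u v : UU F n) : psg ψ n (u * v).1.1 = psg ψ n u.1.1 * psg ψ n v.1.1 := by
  unfold psg
  rw [← Finset.prod_mul_distrib]
  refine prod_congr rfl fun i _ => ?_
  by_cases h : i.1 + 1 < n
  · rw [dif_pos h, dif_pos h, dif_pos h, ← AddChar.map_add_eq_mul]
    congr 1
    show (u.1.1 * v.1.1) i _ = _
    have hne : i ≠ ⟨i.1+1, h⟩ := by intro h'; have := congrArg Fin.val h'; simp at this
    rw [Matrix.mul_apply, ← Finset.sum_subset (Finset.subset_univ {i, ⟨i.1+1, h⟩}), Finset.sum_pair hne, u.2.2, v.2.2, one_mul, mul_one, add_comm]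
    intro k _ hk
    simp only [Finset.mem_insert, Finset.mem_singleton, not_or] at hk
    by_cases hki : k < i
    · rw [u.2.1 _ _ hki, zero_mul]
    · have : (⟨i.1+1, h⟩ : Fin n) < k := by
        have h1 : k.1 ≠ i.1 := fun h' => hk.1 (Fin.ext h')
        have h2 : k.1 ≠ i.1 + 1 := fun h' => hk.2 (Fin.ext h')
        have h3 : ¬ k.1 < i.1 := hki
        show i.1 + 1 < k.1
        omega
      rw [v.2.1 _ _ this, mul_zero]
  · rw [dif_neg h, dif_neg h, dif_neg h, one_mul]

lemma psg_one {n : ℕ} : psg ψ n (1 : MM F n) = 1 := by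
  unfold psg
  refine Finset.prod_eq_one fun i _ => ?_
  split_ifs with h
  · rw [Matrix.one_apply_ne, AddChar.map_zero_eq_one]
    intro h'; have := congrArg Fin.val h'; simp at this
  · rfl

end WG

section Gel
variable {G : Type} [Group G] [Fintype G]

lemma schur_sc {V : Type} [AddCommGroup V] [Module ℂ V] [FiniteDimensional ℂ V]
    (ρ : Representation ℂ G V) (hρ : ρ.IsIrreducible) (T : V →ₗ[ℂ] V)
    (hT : ∀ g, T * ρ g = ρ g * T) : (finrank ℂ V : ℂ) • T = LinearMap.trace ℂ V T • (1 : V →ₗ[ℂ] V) := by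
  rw [← sub_eq_zero]
  refine schur_zero ρ hρ _ (fun g v => ?_) ?_
  · have := LinearMap.congr_fun (hT g) v
    simp only [Module.End.mul_apply] at this
    simp [this]
  · simp [mul_comm]

variable (U : Subgroup G) [Fintype U] (ψ : G → ℂ)

noncomputable def EE : (G → ℂ) →ₗ[ℂ] (G → ℂ) where
  toFun f x := ((Fintype.card U : ℂ)⁻¹)^2 * ∑ u : U, ∑ v : U, ψ u * ψ v * f (u * x * v)
  map_add' f g := by
    funext x
    simp only [Pi.add_apply, mul_add, sum_add_distrib]
  map_smul' c f := by
    funext x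
    simp only [Pi.smul_apply, smul_eq_mul, RingHom.id_apply, mul_sum]
    exact sum_congr rfl fun _ _ => sum_congr rfl fun _ _ => by ring

def HH : Submodule ℂ (G → ℂ) where
  carrier := {f | ∀ (u v : U) x, ψ u * ψ v * f (u * x * v) = f x}
  add_mem' := fun ha hb u v x => by simp only [Pi.add_apply, mul_add, ha u v x, hb u v x]
  zero_mem' := fun u v x => by simp
  smul_mem' := fun c f hf u v x => by
    simp only [Pi.smul_apply, smul_eq_mul]
    rw [← hf u v x]; ring

lemma cardU_ne : (Fintype.card U : ℂ) ≠ 0 := by exact_mod_cast card_ne_zero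

variable {ψ} (h1 : ψ 1 = 1) (hm : ∀ u v : U, ψ (u * v : U) = ψ u * ψ v)
include hm
lemma EE_mem (f : G → ℂ) : EE U ψ f ∈ HH U ψ := by
  intro u v x
  simp only [EE, coe_mk, AddHom.coe_mk]
  rw [mul_left_comm]
  congr 1
  simp only [mul_sum]
  refine sum_equiv (mulRight u) _ _ fun a => sum_equiv (Equiv.mulLeft v) _ _ fun b => ?_
  simp only [coe_mulRight, Equiv.coe_mulLeft, hm]
  rw [show ((a * u : U) : G) * x * (v * b : U) = a * (u * x * v) * b by push_cast; group]
  ring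
omit hm
lemma EE_id {f : G → ℂ} (hf : f ∈ HH U ψ) : EE U ψ f = f := by
  funext x
  simp only [EE, coe_mk, AddHom.coe_mk]
  simp only [hf _ _ x, sum_const, card_univ, nsmul_eq_mul]
  have := cardU_ne U
  field_simp

open Classical in
lemma EE_trace : LinearMap.trace ℂ _ (EE U ψ) = ((Fintype.card U : ℂ)⁻¹)^2 * ∑ u : U, ∑ v : U, ψ u * ψ v *
    (Nat.card {x : G // u * x * v = x} : ℂ) := by
  rw [LinearMap.trace_eq_matrix_trace ℂ (Pi.basisFun ℂ G), Matrix.trace]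
  simp only [Matrix.diag, LinearMap.toMatrix_apply, EE, Pi.basisFun_repr, Pi.basisFun_apply, coe_mk, AddHom.coe_mk]
  rw [← mul_sum, sum_comm]
  congr 1
  refine sum_congr rfl fun u _ => ?_
  rw [sum_comm]
  refine sum_congr rfl fun v _ => ?_
  rw [← mul_sum, Nat.card_eq_fintype_card, card_subtype]
  simp [Pi.single_apply]

variable (θ : G → G) (hθ : ∀ x y, θ (x * y) = θ y * θ x) (hθθ : ∀ x, θ (θ x) = x)
  (hU : ∀ u ∈ U, θ u ∈ U) (hψ : ∀ u ∈ U, ψ (θ u) = ψ u) {ι : Type} [Fintype ι] (S : ι → G) (hS : ∀ i, θ (S i) = S i)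
  (ha : ∀ i (u v : U), (u : G) * S i = S i * v → ψ u = ψ v) (hd : ∀ i j (u v : U), (u : G) * S i = S j * v → i = j)
  (ht : LinearMap.trace ℂ _ (EE U ψ) = Fintype.card ι)

include h1 hm ha hd in
lemma ev_surj (c : ι → ℂ) : ∃ f ∈ HH U ψ, ∀ i, f (S i) = c i := by
  classical
  have hinv : ∀ u : U, ψ u * ψ (u⁻¹ : U) = 1 := fun u => by rw [← hm, mul_inv_cancel]; exact h1
  have key : ∀ j, ∃ f ∈ HH U ψ, ∀ i, f (S i) = if i = j then 1 else 0 := by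
    intro j
    set a := EE U ψ (Pi.single (S j) 1)
    have h0 : ∀ i, i ≠ j → a (S i) = 0 := by
      intro i hij
      simp only [a, EE, coe_mk, AddHom.coe_mk]
      rw [sum_eq_zero, mul_zero]
      refine fun u _ => sum_eq_zero fun v _ => ?_
      rw [Pi.single_eq_of_ne, mul_zero]
      intro h
      refine hij (hd i j u v⁻¹ ?_)
      rw [← h]; push_cast; group
    have h2 : a (S j) = ((Fintype.card U : ℂ)⁻¹)^2 * ((∑ u : U, ∑ v : U, if (u : G) * S j * v = S j then 1 else 0 : ℕ) : ℂ) := by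
      simp only [a, EE, coe_mk, AddHom.coe_mk]
      congr 1
      push_cast
      refine sum_congr rfl fun u _ => sum_congr rfl fun v _ => ?_
      rw [Pi.single_apply]
      split_ifs with h
      · have := ha j u v⁻¹ (by nth_rw 2 [← h]; push_cast; group)
        rw [this, mul_one, mul_comm, hinv]
      · rw [mul_zero]
    have h3 : a (S j) ≠ 0 := by
      rw [h2]
      refine mul_ne_zero (pow_ne_zero _ (inv_ne_zero (cardU_ne U))) ?_
      rw [Nat.cast_ne_zero]
      refine ne_of_gt (Finset.sum_pos' (fun _ _ => Nat.zero_le _) ⟨1, mem_univ _, Finset.sum_pos' (fun _ _ => Nat.zero_le _) ⟨1, mem_univ _, ?_⟩⟩)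
      simp
    refine ⟨(a (S j))⁻¹ • a, smul_mem _ _ (EE_mem U hm _), fun i => ?_⟩
    split_ifs with h
    · rw [h]; simp [h3]
    · simp [h0 i h]
  choose f hf hf' using key
  refine ⟨∑ j, c j • f j, Submodule.sum_mem _ fun j _ => smul_mem _ _ (hf j), fun i => ?_⟩
  simp [Finset.sum_apply, hf']

include h1 hm ha hd ht in
lemma ev_inj {f : G → ℂ} (hf : f ∈ HH U ψ) (h0 : ∀ i, f (S i) = 0) : f = 0 := by
  have hP : LinearMap.IsProj (HH U ψ) (EE U ψ) := ⟨EE_mem U hm, fun f hf => EE_id U hf⟩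
  have hr : finrank ℂ (HH U ψ) = finrank ℂ (ι → ℂ) := by
    have := hP.trace
    rw [ht] at this
    rw [Module.finrank_fintype_fun_eq_card]; exact_mod_cast this.symm
  let ev : HH U ψ →ₗ[ℂ] (ι → ℂ) :=
    { toFun := fun f i => f.1 (S i), map_add' := fun _ _ => rfl, map_smul' := fun _ _ => rfl }
  have hs : Surjective ev := fun c => by
    obtain ⟨f, hf, h⟩ := ev_surj U h1 hm S ha hd c
    exact ⟨⟨f, hf⟩, funext h⟩
  have hi := (LinearMap.injective_iff_surjective_of_finrank_eq_finrank hr).2 hs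
  have := @hi ⟨f, hf⟩ 0 (funext h0)
  exact congrArg Subtype.val this

include hθ hU hψ hS h1 hm ha hd ht in
lemma theta_fix {f : G → ℂ} (hf : f ∈ HH U ψ) (x : G) : f (θ x) = f x := by
  have h2 : (fun x => f (θ x)) ∈ HH U ψ := by
    intro u v x
    show ψ u * ψ v * f (θ (u * x * v)) = f (θ x)
    rw [hθ, hθ, ← hψ u u.2, ← hψ v v.2, ← hf ⟨θ v, hU _ v.2⟩ ⟨θ u, hU _ u.2⟩ (θ x)]
    simp only [mul_assoc]
    ring
  have := ev_inj U h1 hm S ha hd ht (Submodule.sub_mem _ h2 hf) fun i => by simp [hS]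
  have := congrFun this x
  simpa [sub_eq_zero] using this

include hθ hθθ hU hψ hS h1 hm ha hd ht in
theorem gelfand {χ : G → ℂ} (hχ : IrrR G χ) :
    av (fun u : U => ψ u * χ u) = 0 ∨ av (fun u : U => ψ u * χ u) = 1 := by
  classical
  have hip := ip_irr hχ hχ
  rw [if_pos rfl] at hip
  obtain ⟨V, _, _, _, ρ, hρ, rfl⟩ := hχ
  set n : ℂ := (Fintype.card U : ℂ) with hn
  have hn0 : n ≠ 0 := cardU_ne U
  set P : V →ₗ[ℂ] V := n⁻¹ • ∑ u : U, ψ u • ρ u with hP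
  have hPl : ∀ u : U, ψ u • (P * ρ u) = P := by
    intro u
    rw [hP, smul_mul_assoc, smul_comm, sum_mul, smul_sum]
    congr 1
    refine sum_equiv (mulRight u) _ _ fun a => ?_
    rw [coe_mulRight, hm, Subgroup.coe_mul, map_mul, smul_mul_assoc, smul_smul, mul_comm (ψ u)]
  have hPr : ∀ u : U, ψ u • (ρ u * P) = P := by
    intro u
    rw [hP, mul_smul_comm, smul_comm, mul_sum, smul_sum]
    congr 1
    refine sum_equiv (Equiv.mulLeft u) _ _ fun a => ?_
    rw [Equiv.coe_mulLeft, hm, Subgroup.coe_mul, map_mul, mul_smul_comm, smul_smul]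
  have hPP : P * P = P := by
    nth_rw 1 [hP]
    rw [smul_mul_assoc, sum_mul]
    simp only [smul_mul_assoc, hPr, sum_const, card_univ]
    rw [← Nat.cast_smul_eq_nsmul ℂ, smul_smul, inv_mul_cancel₀ hn0, one_smul]
  set tr := LinearMap.trace ℂ V
  have htr : av (fun u : U => ψ u * ρ.character u) = tr P := by
    rw [hP, map_smul, map_sum, smul_eq_mul]
    unfold av
    congr 1
    · exact sum_congr rfl fun u _ => by rw [map_smul, smul_eq_mul]; rfl
  rw [htr]
  have hH : ∀ Y : V →ₗ[ℂ] V, (fun x => tr (P * ρ x * P * Y)) ∈ HH U ψ := by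
    intro Y u v x
    show ψ u * ψ v * tr (P * ρ (u * x * v) * P * Y) = tr (P * ρ x * P * Y)
    nth_rw 3 [← hPl u]
    nth_rw 4 [← hPr v]
    simp only [smul_mul_assoc, mul_smul_comm, map_smul, smul_eq_mul, map_mul, mul_assoc]
    ring
  have hfix := fun Y x => theta_fix U h1 hm θ hθ hU hψ S hS ha hd ht (hH Y) x
  have hmid : ∀ g k Y, tr (P * ρ g * P * ρ k * P * Y) = n⁻¹ * ∑ u : U, ψ u * tr (P * ρ (g * u * k) * P * Y) := by
    intro g k Y
    rw [show P * ρ g * P * ρ k * P * Y = n⁻¹ • ∑ u : U, ψ u • (P * ρ (g * u * k) * P * Y) by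
      rw [show P * ρ g * P * ρ k * P * Y = (P * ρ g) * P * (ρ k * P * Y) by simp only [mul_assoc]]
      nth_rw 2 [hP]
      simp only [mul_smul_comm, smul_mul_assoc, mul_sum, sum_mul, map_mul, mul_assoc]]
    rw [map_smul, map_sum, smul_eq_mul]
    simp only [map_smul, smul_eq_mul]
  have hcom : ∀ g k Y, tr (P * ρ g * P * ρ k * P * Y) = tr (P * ρ k * P * ρ g * P * Y) := by
    intro g k Y
    have e1 : tr (P * ρ g * P * ρ k * P * Y) = tr (P * ρ (θ k) * P * ρ (θ g) * P * Y) := by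
      rw [hmid, hmid]
      congr 1
      refine Fintype.sum_bijective (fun u : U => (⟨θ u, hU u u.2⟩ : U)) ⟨fun a b h => ?_, fun b => ⟨⟨θ b, hU b b.2⟩, Subtype.ext (hθθ b)⟩⟩ _ _ fun u => ?_
      · have := congrArg (fun u : U => θ u) h
        simp only [hθθ] at this
        exact Subtype.ext this
      · simp only [hψ u u.2]
        rw [← hfix Y (g * u * k), hθ, hθ, ← mul_assoc]
    rw [e1]
    have e2 := hfix (ρ (θ g) * P * Y) k
    have e3 := hfix (Y * P * ρ k) g
    simp only [mul_assoc] at e2 e3 ⊢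
    have cyc : ∀ x, tr (P * (ρ k * (P * (ρ x * (P * Y))))) = tr (P * (ρ x * (P * (Y * (P * ρ k))))) := by
      intro x
      rw [show P * (ρ k * (P * (ρ x * (P * Y)))) = (P * ρ k) * (P * (ρ x * (P * Y))) by simp only [mul_assoc], LinearMap.trace_mul_comm]
      simp only [mul_assoc, tr]
    rw [e2, cyc, e3, ← cyc]
  set d : ℂ := (finrank ℂ V : ℂ)
  have hsch : ∀ X : V →ₗ[ℂ] V, d • ∑ g, ρ g * X * ρ g⁻¹ = (Fintype.card G * tr X : ℂ) • (1 : V →ₗ[ℂ] V) := by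
    intro X
    rw [schur_sc ρ hρ]
    · congr 1
      rw [map_sum, sum_congr rfl (g := fun _ => tr X), sum_const, card_univ, nsmul_eq_mul]
      intro g _
      show tr _ = _
      rw [mul_assoc, LinearMap.trace_mul_comm, mul_assoc, ← map_mul, inv_mul_cancel, map_one, mul_one]
    · intro h
      rw [sum_mul, mul_sum]
      refine sum_equiv (Equiv.mulLeft h⁻¹) _ _ fun g => ?_
      simp only [Equiv.coe_mulLeft, _root_.mul_inv_rev, inv_inv, map_mul, ← mul_assoc]
      rw [← map_mul, mul_inv_cancel, map_one, one_mul]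
  have hZ : d • ∑ k, ρ.character k • ρ k⁻¹ = (Fintype.card G : ℂ) • (1 : V →ₗ[ℂ] V) := by
    rw [schur_sc ρ hρ]
    · congr 1
      rw [map_sum]
      simp only [map_smul, smul_eq_mul]
      have : ∀ k, ρ.character k * LinearMap.trace ℂ V (ρ k⁻¹) = conj (ρ.character k) * ρ.character k := fun k => by
        rw [← char_inv_conj, mul_comm]; rfl
      simp only [this]
      unfold ip at hip
      rw [inv_mul_eq_one₀ card_ne] at hip
      exact hip.symm
    · intro h
      rw [sum_mul, mul_sum]
      refine sum_equiv (MulAut.conj h⁻¹).toEquiv _ _ fun g => ?_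
      simp only [MulEquiv.toEquiv_eq_coe, EquivLike.coe_coe, MulAut.conj_apply, inv_inv, smul_mul_assoc, mul_smul_comm, ← map_mul]
      have := ρ.char_conj g h⁻¹
      rw [inv_inv] at this
      rw [this]
      congr 2
      group
  have hZP : d • ∑ k, tr (ρ k * P) • ρ k⁻¹ = (Fintype.card G : ℂ) • P := by
    have e1 : ∑ k, tr (ρ k * P) • ρ k⁻¹ = P * ∑ k, ρ.character k • ρ k⁻¹ := by
      rw [hP]
      simp only [mul_smul_comm, smul_mul_assoc, map_smul, mul_sum, map_sum, sum_mul, smul_assoc, ← smul_sum, Finset.sum_smul]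
      rw [sum_comm]
      simp only [smul_comm _ n⁻¹, ← smul_sum]
      simp only [smul_sum (r := ρ.character _)]
      rw [sum_comm (γ := G)]
      congr 1
      refine sum_congr rfl fun u _ => ?_
      simp only [smul_comm _ (ψ u), ← smul_sum]
      congr 1
      refine sum_equiv (mulRight (u : G)) _ _ fun k => ?_
      simp only [coe_mulRight, _root_.mul_inv_rev, ← map_mul, mul_inv_cancel_left]
      rfl
    rw [e1, ← mul_smul_comm, hZ, mul_smul_comm, mul_one]
  have T1 : d * d * ∑ k : G, ∑ g : G, tr (P * ρ g * P * ρ k * P * (ρ g⁻¹ * P * ρ k⁻¹)) = (Fintype.card G : ℂ)^2 * tr P := by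
    have : ∀ k, d * ∑ g : G, tr (P * ρ g * P * ρ k * P * (ρ g⁻¹ * P * ρ k⁻¹)) = Fintype.card G * (tr (ρ k * P) * tr (P * ρ k⁻¹)) := by
      intro k
      rw [← map_sum tr, ← smul_eq_mul, ← map_smul tr]
      have : ∑ g : G, P * ρ g * P * ρ k * P * (ρ g⁻¹ * P * ρ k⁻¹) = P * (∑ g : G, ρ g * (P * ρ k * P) * ρ g⁻¹) * (P * ρ k⁻¹) := by
        simp only [mul_sum, sum_mul, mul_assoc]
      rw [this, ← smul_mul_assoc, ← mul_smul_comm, hsch, mul_smul_comm, smul_mul_assoc, map_smul, mul_one, ← mul_assoc, hPP, smul_eq_mul,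
        mul_assoc P, LinearMap.trace_mul_comm, mul_assoc (ρ k), hPP]
      ring
    rw [mul_assoc, mul_sum, sum_congr rfl (fun k _ => this k), ← mul_sum]
    have h2 := congrArg (fun X => tr (P * X)) hZP
    simp only [mul_smul_comm, mul_sum, map_smul, map_sum, smul_eq_mul, hPP] at h2
    rw [mul_left_comm, mul_sum, h2]; ring
  have T2 : d * d * ∑ k : G, ∑ g : G, tr (P * ρ k * P * ρ g * P * (ρ g⁻¹ * P * ρ k⁻¹)) = (Fintype.card G : ℂ)^2 * tr P ^ 3 := by
    have : ∀ k, d * ∑ g : G, tr (P * ρ k * P * ρ g * P * (ρ g⁻¹ * P * ρ k⁻¹)) = Fintype.card G * tr P * tr (P * (ρ k * P * ρ k⁻¹)) := by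
      intro k
      rw [← map_sum tr, ← smul_eq_mul, ← map_smul tr]
      have : ∑ g : G, P * ρ k * P * ρ g * P * (ρ g⁻¹ * P * ρ k⁻¹) = P * ρ k * P * (∑ g : G, ρ g * P * ρ g⁻¹) * (P * ρ k⁻¹) := by
        simp only [mul_sum, sum_mul, mul_assoc]
      rw [this, ← smul_mul_assoc, ← mul_smul_comm, hsch, mul_smul_comm, smul_mul_assoc, map_smul, mul_one, ← mul_assoc, mul_assoc _ P P, hPP, smul_eq_mul]
      simp only [mul_assoc]
    rw [mul_assoc, mul_sum, sum_congr rfl (fun k _ => this k), ← mul_sum]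
    have h2 := congrArg (fun X => tr (P * X)) (hsch P)
    simp only [mul_smul_comm, mul_sum, map_smul, map_sum, smul_eq_mul, mul_one] at h2
    rw [mul_left_comm, mul_sum, h2]; ring
  have T3 : tr P = tr P ^ 3 := by
    rw [sum_congr rfl (fun k _ => sum_congr rfl fun g _ => hcom g k _), T2] at T1
    exact (mul_left_cancel₀ (pow_ne_zero 2 card_ne) T1).symm
  have hPn : ∃ m : ℕ, tr P = m := by
    have : LinearMap.IsProj (range P) P := ⟨fun x => ⟨x, rfl⟩, by
      rintro _ ⟨x, rfl⟩
      exact LinearMap.congr_fun hPP x⟩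
    exact ⟨_, this.trace⟩
  obtain ⟨m, hm'⟩ := hPn
  rw [hm'] at T3 ⊢
  have T4 : m = m ^ 3 := by exact_mod_cast T3
  rcases m with _ | _ | m
  · left; simp
  · right; simp
  · nlinarith [sq_nonneg m]
end Gel

section Bl
variable {F : Type} [Field F] [Fintype F] [DecidableEq F]

def stt (c : ℕ → F) : ℕ → ℕ
  | 0 => 0
  | j+1 => if c (j+1) = 0 then stt c j else j+1
lemma stt_le (c : ℕ → F) (j : ℕ) : stt c j ≤ j := by
  induction j with
  | zero => simp [stt]
  | succ j ih => rw [stt]; split_ifs <;> omega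
lemma stt_mono (c : ℕ → F) : Monotone (stt c) := monotone_nat_of_le_succ fun j => by
  have := stt_le c j
  rw [stt]; split_ifs <;> omega
lemma stt_stt (c : ℕ → F) (j : ℕ) : stt c (stt c j) = stt c j := by
  induction j with
  | zero => rfl
  | succ j ih =>
    rw [stt]
    split_ifs with h
    · exact ih
    · rw [stt, if_neg h]
lemma stt_ne (c : ℕ → F) (h0 : c 0 ≠ 0) (j : ℕ) : c (stt c j) ≠ 0 := by
  induction j with
  | zero => exact h0
  | succ j ih => rw [stt]; split_ifs with h; exacts [ih, h]
def enn (n : ℕ) (c : ℕ → F) (j : ℕ) : ℕ := ((Finset.range n).filter fun i => stt c i = stt c j).sup id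
lemma enn_spec {n : ℕ} (c : ℕ → F) {j : ℕ} (hj : j < n) : j ≤ enn n c j ∧ enn n c j < n ∧ stt c (enn n c j) = stt c j := by
  have h1 : j ∈ (Finset.range n).filter fun i => stt c i = stt c j := by simp [hj]
  have h2 : enn n c j ∈ (Finset.range n).filter fun i => stt c i = stt c j := by
    obtain ⟨b, hb, hb'⟩ := Finset.exists_mem_eq_sup _ ⟨j, h1⟩ id
    unfold enn; rw [hb']; exact hb
  simp only [mem_filter, Finset.mem_range] at h2
  exact ⟨Finset.le_sup (f := id) h1, h2.1, h2.2⟩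
def sgg (n : ℕ) (c : ℕ → F) (j : ℕ) : ℕ := stt c j + enn n c j - j
lemma sgg_st {n : ℕ} (c : ℕ → F) {j : ℕ} (hj : j < n) : stt c (sgg n c j) = stt c j := by
  obtain ⟨h1, h2, h3⟩ := enn_spec c hj
  have h4 := stt_le c j
  have h5 := stt_mono c (show stt c j ≤ sgg n c j by unfold sgg; omega)
  have h6 := stt_mono c (show sgg n c j ≤ enn n c j by unfold sgg; omega)
  rw [stt_stt] at h5; omega
lemma sgg_lt {n : ℕ} (c : ℕ → F) {j : ℕ} (hj : j < n) : sgg n c j < n := by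
  obtain ⟨h1, h2, h3⟩ := enn_spec c hj
  have h4 := stt_le c j
  unfold sgg; omega
lemma sgg_sgg {n : ℕ} (c : ℕ → F) {j : ℕ} (hj : j < n) : sgg n c (sgg n c j) = j := by
  obtain ⟨h1, h2, h3⟩ := enn_spec c hj
  have h4 := stt_le c j
  have h5 := sgg_st c hj
  have h6 : enn n c (sgg n c j) = enn n c j := by unfold enn; rw [h5]
  have h7 : sgg n c j = stt c j + enn n c j - j := rfl
  unfold sgg at h6 h5 ⊢
  rw [h5, h6]; omega
lemma sgg_step {n : ℕ} (c : ℕ → F) {j : ℕ} (hj : j + 1 < n) :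
    (c (j+1) ≠ 0 ∧ stt c (j+1) = j+1 ∧ sgg n c j < sgg n c (j+1)) ∨ (c (j+1) = 0 ∧ stt c (j+1) = stt c j ∧ sgg n c j = sgg n c (j+1) + 1) := by
  obtain ⟨h1, h2, h3⟩ := enn_spec c hj
  obtain ⟨h1', h2', h3'⟩ := enn_spec c (show j < n by omega)
  have h4 := stt_le c j
  have h5 : stt c (j+1) = if c (j+1) = 0 then stt c j else j+1 := rfl
  split_ifs at h5 with h
  · right
    have h6 : enn n c (j+1) = enn n c j := by unfold enn; rw [h5]
    refine ⟨h, h5, ?_⟩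
    unfold sgg; rw [h5, h6]; omega
  · left
    refine ⟨h, h5, ?_⟩
    have : enn n c j < j + 1 := by
      by_contra h7
      have := stt_mono c (not_lt.1 h7)
      omega
    unfold sgg; omega

def II (F : Type) [Field F] (n : ℕ) : Type := {c : Fin n → F // ∀ h : 0 < n, c ⟨0, h⟩ ≠ 0}
noncomputable instance (n : ℕ) : Fintype (II F n) := by unfold II; exact ofFinite _
lemma card_II (n : ℕ) : (Fintype.card (II F n) : ℂ) = NN F n := by
  unfold NN
  rw [← Nat.card_eq_fintype_card]
  rcases n with _ | n
  · rw [if_pos rfl]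
    have : Unique (II F 0) := ⟨⟨⟨Fin.elim0, fun h => absurd h (lt_irrefl _)⟩⟩, fun a => Subtype.ext (funext fun i => i.elim0)⟩
    simp
  · rw [if_neg (by omega)]
    let e : II F (n+1) ≃ Fˣ × (Fin n → F) :=
      { toFun := fun c => (Units.mk0 (c.1 0) (c.2 (by omega)), fun i => c.1 i.succ)
        invFun := fun x => ⟨Fin.cons (x.1 : F) x.2, fun h => by
          show Fin.cons (α := fun _ => F) (x.1 : F) x.2 0 ≠ 0
          rw [Fin.cons_zero]; exact x.1.ne_zero⟩
        left_inv := fun c => Subtype.ext (Fin.cons_self_tail c.1)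
        right_inv := fun x => by ext <;> simp }
    rw [Nat.card_congr e, Nat.card_prod, Nat.card_eq_fintype_card, Fintype.card_units, Nat.card_fun, Nat.card_fin]
    unfold qq
    rw [Nat.card_eq_fintype_card, Nat.cast_mul, Nat.cast_sub Fintype.card_pos]; push_cast; simp

def cx {n : ℕ} (c : II F n) (i : ℕ) : F := if h : i < n then c.1 ⟨i, h⟩ else 0
def sg {n : ℕ} (c : II F n) (i : Fin n) : Fin n := ⟨sgg n (cx c) i, sgg_lt _ i.2⟩
def dd {n : ℕ} (c : II F n) (i : Fin n) : F := cx c (stt (cx c) i)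
lemma dd_ne {n : ℕ} (c : II F n) (i : Fin n) : dd c i ≠ 0 := stt_ne _ (by
  have := i.pos
  unfold cx; rw [dif_pos this]; exact c.2 this) _
lemma sg_sg {n : ℕ} (c : II F n) (i : Fin n) : sg c (sg c i) = i := Fin.ext (sgg_sgg _ i.2)
lemma dd_sg {n : ℕ} (c : II F n) (i : Fin n) : dd c (sg c i) = dd c i := by
  unfold dd; rw [show stt (cx c) (sg c i) = stt (cx c) i from sgg_st _ i.2]
lemma sd_inj {n : ℕ} {c c' : II F n} (h1 : ∀ i, sg c i = sg c' i) (h2 : ∀ i, dd c i = dd c' i) : c = c' := by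
  refine Subtype.ext (funext fun i => ?_)
  have hc : ∀ (c : II F n) (i : Fin n), c.1 i = cx c i := fun c i => by unfold cx; rw [dif_pos i.2]
  rw [hc, hc]
  obtain ⟨i, hi⟩ := i
  rcases i with _ | i
  · exact h2 ⟨0, hi⟩
  · have a1 : sgg n (cx c) i = sgg n (cx c') i := congrArg Fin.val (h1 ⟨i, by omega⟩)
    have a2 : sgg n (cx c) (i+1) = sgg n (cx c') (i+1) := congrArg Fin.val (h1 ⟨i+1, hi⟩)
    have a3 : cx c (stt (cx c) (i+1)) = cx c' (stt (cx c') (i+1)) := h2 ⟨i+1, hi⟩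
    rcases sgg_step (cx c) hi with b | b <;> rcases sgg_step (cx c') hi with b' | b'
    · rw [b.2.1, b'.2.1] at a3; exact a3
    · omega
    · omega
    · show cx c (i+1) = cx c' (i+1)
      rw [b.1, b'.1]

def smat {n : ℕ} (c : II F n) : MM F n := fun i j => if j = sg c i.rev then dd c j else 0
lemma smat_mul {n : ℕ} (c : II F n) (v : MM F n) (i j : Fin n) : (smat c * v) i j = dd c i.rev * v (sg c i.rev) j := by
  rw [Matrix.mul_apply, sum_eq_single (sg c i.rev)]
  · simp [smat, dd_sg]
  · intro k _ hk; simp [smat, hk]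
  · intro h; exact absurd (mem_univ _) h
lemma mul_smat {n : ℕ} (c : II F n) (u : MM F n) (i j : Fin n) : (u * smat c) i j = u i (sg c j).rev * dd c j := by
  rw [Matrix.mul_apply, sum_eq_single (sg c j).rev]
  · simp [smat, sg_sg]
  · intro k _ hk
    rw [smat, if_neg, mul_zero]
    intro h; apply hk; rw [h, sg_sg, Fin.rev_rev]
  · intro h; exact absurd (mem_univ _) h
noncomputable def sG {n : ℕ} (c : II F n) : Matrix.GeneralLinearGroup (Fin n) F :=
  Matrix.GeneralLinearGroup.mkOfDetNeZero (smat c) (by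
    refine (Matrix.isUnit_iff_isUnit_det _).1 ?_ |>.ne_zero
    refine IsUnit.of_mul_eq_one (Matrix.of fun i j => if j = (sg c i).rev then (dd c i)⁻¹ else 0) ?_
    ext i j
    rw [smat_mul, Matrix.of_apply, sg_sg, dd_sg, Fin.rev_rev]
    by_cases h : j = i
    · subst h; simp [dd_ne]
    · simp [h, Matrix.one_apply_ne (Ne.symm h)])
def thm {n : ℕ} (g : MM F n) : MM F n := fun i j => g j.rev i.rev
lemma thm_mul {n : ℕ} (g h : MM F n) : thm (g * h) = thm h * thm g := by
  ext i j
  rw [Matrix.mul_apply]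
  show (g * h) j.rev i.rev = _
  rw [Matrix.mul_apply]
  exact sum_equiv Fin.revPerm _ _ fun k => by simp [thm, mul_comm]
lemma thm_one {n : ℕ} : thm (1 : MM F n) = 1 := by
  ext i j; simp [thm, Matrix.one_apply, eq_comm]
def th {n : ℕ} (g : Matrix.GeneralLinearGroup (Fin n) F) : Matrix.GeneralLinearGroup (Fin n) F :=
  ⟨thm g.1, thm (g⁻¹).1, by rw [← thm_mul, ← Units.val_mul]; simp [thm_one], by rw [← thm_mul, ← Units.val_mul]; simp [thm_one]⟩

lemma bij_le {n : ℕ} (f : Fin n → Fin n) (hf : Injective f) (h : ∀ i, f i ≤ i) (i : Fin n) : f i = i := by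
  induction i using WellFoundedLT.induction with
  | _ i ih =>
    rcases (h i).lt_or_eq with h1 | h1
    · exact hf (ih _ h1)
    · exact h1

lemma star {n : ℕ} {c c' : II F n} {u v : MM F n} (h : u * smat c = smat c' * v) (x y : Fin n) :
    u x.rev y.rev * dd c y = dd c' x * v (sg c' x) (sg c y) := by
  have := congrFun (congrFun h x.rev) (sg c y)
  rwa [mul_smat, smat_mul, sg_sg, dd_sg, Fin.rev_rev] at this

lemma disj {n : ℕ} {c c' : II F n} (u v : UU F n) (h : u.1.1 * smat c = smat c' * v.1.1) : c = c' := by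
  have h1 : ∀ j, dd c j = dd c' j * v.1.1 (sg c' j) (sg c j) := fun j => by
    have := star h j j
    rwa [u.2.2, one_mul] at this
  have h2 : ∀ i, sg c' (sg c i) = i := bij_le _ (fun i j h => by
    have := congrArg (fun x => sg c (sg c' x)) h
    simpa only [sg_sg] using this) fun i => by
    by_contra h3
    have := h1 (sg c i)
    rw [sg_sg, v.2.1 _ _ (not_le.1 h3), mul_zero] at this
    exact dd_ne _ _ this
  have h3 : ∀ i, sg c i = sg c' i := fun i => by rw [← sg_sg c' (sg c i), h2]
  refine sd_inj h3 fun i => ?_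
  rw [h1 i, h3, v.2.2, mul_one]

lemma adm (ψ : AddChar F ℂ) {n : ℕ} {c : II F n} (u v : UU F n) (h : u.1.1 * smat c = smat c * v.1.1) : psg ψ n u.1.1 = psg ψ n v.1.1 := by
  unfold psg
  refine Fintype.prod_bijective (fun i : Fin n => sg c i.rev) ((Function.Involutive.bijective (sg_sg c)).comp Fin.rev_bijective) _ _ fun i => ?_
  have hs := star h
  have key : ∀ a : Fin n, (if h : a.rev.1 + 1 < n then ψ (u.1.1 a.rev ⟨a.rev.1 + 1, h⟩) else 1) =
      if h : (sg c a).1 + 1 < n then ψ (v.1.1 (sg c a) ⟨(sg c a).1 + 1, h⟩) else 1 := by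
    intro a
    have hab : ∀ a : Fin n, (sg c a).1 = sgg n (cx c) a.1 := fun _ => rfl
    have hr : a.rev.1 + 1 < n ↔ 0 < a.1 := by rw [Fin.val_rev]; omega
    by_cases hA : ∃ ha : 0 < a.1, cx c a.1 = 0
    · obtain ⟨ha, hA⟩ := hA
      have hst := sgg_step (cx c) (j := a.1 - 1) (n := n) (by omega)
      rw [show a.1 - 1 + 1 = a.1 by omega] at hst
      rcases hst with hst | hst
      · exact absurd hA hst.1
      have e1 : sg c ⟨a.1 - 1, by omega⟩ = ⟨(sg c a).1 + 1, by rw [hab, ← hst.2.2]; exact sgg_lt _ (by omega)⟩ := Fin.ext hst.2.2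
      have e2 : (⟨a.1 - 1, by omega⟩ : Fin n).rev = ⟨a.rev.1 + 1, hr.2 ha⟩ := Fin.ext (by simp [Fin.val_rev]; omega)
      have e3 : dd c ⟨a.1 - 1, by omega⟩ = dd c a := by
        unfold dd; rw [hst.2.1]
      have := hs a ⟨a.1 - 1, by omega⟩
      rw [e1, e2, e3, mul_comm] at this
      rw [dif_pos (hr.2 ha), dif_pos, mul_left_cancel₀ (dd_ne c a) this]
    · have hA' : (if h : a.rev.1 + 1 < n then ψ (u.1.1 a.rev ⟨a.rev.1 + 1, h⟩) else 1) = 1 := by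
        split_ifs with ha
        · have ha' := hr.1 ha
          have hst := sgg_step (cx c) (j := a.1 - 1) (n := n) (by omega)
          rw [show a.1 - 1 + 1 = a.1 by omega] at hst
          rcases hst with hst | hst
          · have e2 : (⟨a.1 - 1, by omega⟩ : Fin n).rev = ⟨a.rev.1 + 1, ha⟩ := Fin.ext (by simp [Fin.val_rev]; omega)
            have := hs a ⟨a.1 - 1, by omega⟩
            rw [e2, v.2.1 _ _ (show sg c ⟨a.1 - 1, by omega⟩ < sg c a from hst.2.2), mul_zero] at this
            rw [(mul_eq_zero.1 this).resolve_right (dd_ne _ _), AddChar.map_zero_eq_one]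
          · exact absurd ⟨ha', hst.1⟩ hA
        · rfl
      rw [hA']
      symm
      split_ifs with hb
      · have hst := sgg_step (cx c) hb
        have hsa : sgg n (cx c) (sg c a).1 = a.1 := congrArg Fin.val (sg_sg c a)
        rcases hst with hst | hst
        · have := hs a (sg c ⟨(sg c a).1 + 1, hb⟩)
          rw [sg_sg, u.2.1 _ _ (Fin.rev_lt_rev.2 (show a < sg c ⟨(sg c a).1 + 1, hb⟩ by
            show a.1 < sgg n (cx c) ((sg c a).1 + 1)
            rw [← hsa]; exact hst.2.2)), zero_mul] at this
          rw [(mul_eq_zero.1 this.symm).resolve_left (dd_ne _ _), AddChar.map_zero_eq_one]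
        · exfalso
          rw [hsa] at hst
          have hst2 := sgg_step (cx c) (j := a.1 - 1) (n := n) (by omega)
          rw [show a.1 - 1 + 1 = a.1 by omega] at hst2
          have e4 : sgg n (cx c) (a.1 - 1) = (sg c a).1 + 1 := by
            rw [show a.1 - 1 = sgg n (cx c) ((sg c a).1 + 1) by omega, sgg_sgg _ hb]
          rcases hst2 with h2 | h2
          · have := h2.2.2; rw [e4] at this; exact absurd this (by show ¬ (sgg n (cx c) a.1 + 1 < sgg n (cx c) a.1); omega)
          · exact hA ⟨by omega, h2.1⟩
      · rfl
  have := key i.rev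
  rwa [Fin.rev_rev] at this

noncomputable def EQ (n : ℕ) : Matrix.GeneralLinearGroup (Fin n) F ≃* LG F n :=
  Matrix.GeneralLinearGroup.toLin.trans (LinearMap.GeneralLinearGroup.generalLinearEquiv F (Fin n → F))
lemma mo_EQ {n : ℕ} (g : Matrix.GeneralLinearGroup (Fin n) F) : mo g.1 = gm (EQ n g) := rfl

noncomputable instance {n : ℕ} : Fintype (Matrix.GeneralLinearGroup (Fin n) F) := ofFinite _

lemma av_kap (ψ : AddChar F ℂ) (hψ : ψ ≠ 1) {n : ℕ} (B : LG F n) :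
    av (fun v : UU F n => psg ψ n v.1.1 * (Nat.card {g : LG F n // g * EQ n v.1 * g⁻¹ = B} : ℂ)) = (-1)^n * ga (gm B) := by
  classical
  set κ : LG F n → ℂ := fun x => (Nat.card {g : LG F n // g * x * g⁻¹ = B} : ℂ) with hκ
  have hc : IsClass κ := by
    intro x h
    simp only [hκ]
    congr 1
    refine Nat.card_congr (subtypeEquiv (mulRight h) fun g => ?_)
    simp only [coe_mulRight, _root_.mul_inv_rev]
    simp only [mul_assoc]
  have h1 := av_U_al ψ hψ n (cl_ext hc).inv
  have h2 : ∀ g, ext κ (gm g) = κ g := fun g => congrFun (res_ext hc) g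
  simp only [mo_EQ, h2] at h1
  rw [h1]
  congr 1
  unfold al
  rw [Q_group (fun M hM => ((cl_ext hc).supp M (right_ne_zero_of_mul hM)).2)]
  simp only [h2]
  rw [inv_mul_eq_iff_eq_mul₀ card_ne]
  have h3 : ∀ x, κ x = ∑ g : LG F n, if g * x * g⁻¹ = B then 1 else 0 := fun x => by
    simp only [hκ]
    rw [Nat.card_eq_fintype_card, card_subtype, sum_boole]
  simp only [h3, mul_sum]
  rw [sum_comm, sum_congr rfl (g := fun _ => ga (gm B)), sum_const, card_univ, nsmul_eq_mul]
  intro g _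
  rw [sum_eq_single (g⁻¹ * B * g)]
  · rw [if_pos (by group), mul_one]
    have := gm_conj B g⁻¹
    rw [inv_inv] at this
    exact Inv.ga _ _ this
  · intro x _ hx
    rw [if_neg, mul_zero]
    rintro rfl
    apply hx; group
  · intro h; exact absurd (mem_univ _) h

lemma tr_EE (ψ : AddChar F ℂ) (hψ : ψ ≠ 1) (n : ℕ) :
    LinearMap.trace ℂ _ (EE (UU F n) (fun g => psg ψ n g.1)) = NN F n := by
  classical
  rw [EE_trace]
  have h1 : ∀ u v : UU F n, (Nat.card {x : Matrix.GeneralLinearGroup (Fin n) F // u.1 * x * v.1 = x} : ℂ) =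
      (Nat.card {g : LG F n // g * EQ n v.1 * g⁻¹ = EQ n u.1⁻¹} : ℂ) := by
    intro u v
    congr 1
    refine Nat.card_congr (subtypeEquiv (EQ n).toEquiv fun x => ?_)
    show _ ↔ EQ n x * EQ n v.1 * (EQ n x)⁻¹ = EQ n u.1⁻¹
    rw [← map_mul, ← map_inv, ← map_mul, (EQ n).injective.eq_iff, mul_inv_eq_iff_eq_mul, eq_inv_mul_iff_mul_eq, mul_assoc]
  have hinv : ∀ u : UU F n, psg ψ n (u⁻¹).1.1 = psg ψ⁻¹ n u.1.1 := by
    intro u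
    have e1 := psg_mul ψ u u⁻¹
    rw [mul_inv_cancel] at e1
    have e2 : psg ψ⁻¹ n u.1.1 = (psg ψ n u.1.1)⁻¹ := by
      unfold psg
      rw [← Finset.prod_inv_distrib]
      refine prod_congr rfl fun i _ => ?_
      split_ifs
      · rw [AddChar.inv_apply, AddChar.map_neg_eq_inv]
      · simp
    rw [e2]
    exact eq_inv_of_mul_eq_one_right (e1.symm.trans (psg_one ψ))
  have h2 : ((Fintype.card (UU F n) : ℂ)⁻¹)^2 * ∑ u : UU F n, ∑ v : UU F n, psg ψ n u.1.1 * psg ψ n v.1.1 *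
    (Nat.card {x : Matrix.GeneralLinearGroup (Fin n) F // u.1 * x * v.1 = x} : ℂ) =
      av fun u : UU F n => psg ψ n u.1.1 * av (fun v : UU F n => psg ψ n v.1.1 * (Nat.card {g : LG F n // g * EQ n v.1 * g⁻¹ = EQ n u.1⁻¹} : ℂ)) := by
    unfold av
    simp only [h1, mul_sum]
    refine sum_congr rfl fun u _ => sum_congr rfl fun v _ => ?_
    ring
  refine h2.trans ?_
  have h3 : av (fun u : UU F n => psg ψ n u.1.1 * av (fun v : UU F n => psg ψ n v.1.1 * (Nat.card {g : LG F n // g * EQ n v.1 * g⁻¹ = EQ n u.1⁻¹} : ℂ)))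
      = av (fun u : UU F n => psg ψ⁻¹ n u.1.1 * (fun M : Mo F => (-1)^n * ga M) (mo u.1.1)) := by
    refine av_equiv (Equiv.inv _) _ _ fun u => ?_
    rw [av_kap ψ hψ, mo_EQ]
    simp only [Equiv.inv_apply]
    rw [← hinv, inv_inv]
    rfl
  have hi : Inv (fun M : Mo F => (-1)^n * ga M) := fun M N h => by simp only [Inv.ga M N h]
  have h5 := av_U_al ψ⁻¹ (by simpa using hψ) n hi
  rw [h3]
  refine Eq.trans (by congr!) (h5.trans ?_)
  have h4 : al n (fun M : Mo F => (-1)^n * ga M) = (-1)^n * al (F := F) n ga := by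
    unfold al
    rw [← Q_mul_left]
    exact Q_congr n fun T => by ring
  rw [h4, al_ga, ← mul_assoc, ← mul_pow]
  simp

lemma IrrR.comp {G H : Type} [Group G] [Group H] [Fintype G] [Fintype H] (e : G ≃* H) {χ : H → ℂ} (hχ : IrrR H χ) : IrrR G (χ ∘ e) := by
  classical
  have h1 := ip_irr hχ hχ
  rw [if_pos rfl] at h1
  obtain ⟨V, _, _, _, ρ, hρ, rfl⟩ := hχ
  refine IsIrrChar.irrR ⟨FDRep.of (ρ.comp e.toMonoidHom), ?_, rfl⟩
  rw [FDRep.simple_iff_char_is_norm_one, Nat.card_eq_fintype_card]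
  unfold ip at h1
  rw [inv_mul_eq_one₀ card_ne] at h1
  rw [card_congr e.toEquiv, h1]
  refine sum_equiv e.toEquiv _ _ fun g => ?_
  show ρ.character (e g) * ρ.character (e g⁻¹) = conj (ρ.character (e g)) * ρ.character (e g)
  rw [map_inv, char_inv_conj, mul_comm]

theorem generic01 {n : ℕ} {χ : LG F n → ℂ} (hχ : IrrR (LG F n) χ) :
    (-1)^n * al n (ext χ) = 0 ∨ (-1)^n * al n (ext χ) = 1 := by
  obtain ⟨ψ, hψ'⟩ := AddChar.exists_apply_ne_zero.2 (one_ne_zero (α := F))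
  have hψ : ψ ≠ 1 := by rintro rfl; exact hψ' rfl
  have hval : ∀ (c : II F n) , (sG c).1 = smat c := fun c => rfl
  have := gelfand (UU F n) (ψ := fun g => psg ψ n g.1) (psg_one ψ) (psg_mul ψ) th
    (fun x y => Units.ext (thm_mul _ _)) (fun x => Units.ext (by ext i j; simp [th, thm]))
    (fun u hu => ⟨fun i j h => hu.1 _ _ (Fin.rev_lt_rev.2 h), fun i => hu.2 _⟩)
    (fun u hu => by
      show psg ψ n (thm u.1) = psg ψ n u.1
      unfold psg
      have hr : Function.Involutive (fun i : Fin n => if h : i.1 + 1 < n then (⟨n - 2 - i.1, by omega⟩ : Fin n) else i) := by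
        intro i
        by_cases h : i.1 + 1 < n
        · simp only [dif_pos h]
          rw [dif_pos (by omega)]
          exact Fin.ext (by simp; omega)
        · simp only [dif_neg h]
      refine Fintype.prod_bijective _ hr.bijective _ _ fun i => ?_
      by_cases h : i.1 + 1 < n
      · simp only [dif_pos h]
        rw [dif_pos (show n - 2 - i.1 + 1 < n by omega)]
        congr 1
        show u.1 _ _ = _
        exact congrArg₂ u.1 (Fin.ext (by simp only [Fin.val_rev]; omega)) (Fin.ext (by simp only [Fin.val_rev]; omega))
      · simp only [dif_neg h])
    (sG (F := F) (n := n)) (fun c => Units.ext (by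
      ext i j
      show smat c j.rev i.rev = smat c i j
      unfold smat
      rw [Fin.rev_rev]
      by_cases h : j = sg c i.rev
      · rw [if_pos h, if_pos (by rw [h, sg_sg]), h, dd_sg]
      · rw [if_neg h, if_neg]
        intro h'; apply h; rw [h', sg_sg]))
    (fun c u v h => adm ψ u v (congrArg Units.val h))
    (fun c c' u v h => disj u v (congrArg Units.val h))
    ((tr_EE ψ hψ n).trans (card_II n).symm) (hχ.comp (EQ n))
  rw [← av_U_al ψ hψ n (cl_ext hχ.isClass).inv]
  have h2 : ∀ g, ext χ (gm g) = χ g := fun g => congrFun (res_ext hχ.isClass) g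
  simp only [mo_EQ, h2]
  exact this

end Bl
section Cus
variable {F : Type} [Field F] [Finite F]

lemma gen01 {n : ℕ} {χ : LG F n → ℂ} (hχ : IrrR (LG F n) χ) :
    (-1)^n * al n (ext χ) = 0 ∨ (-1)^n * al n (ext χ) = 1 := by
  classical
  letI := ofFinite F
  exact generic01 hχ

structure CuF (d : ℕ) (h : CF F) : Prop where
  pos : 0 < d
  inv : Inv h
  van : ∀ A B : Mo F, Nontrivial A.V → Nontrivial B.V → De h A B = 0

lemma De_cj (h : CF F) (A B : Mo F) : De (fun M => conj (h M)) A B = conj (De h A B) := by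
  unfold De av; simp [map_sum]

lemma CuF.cj {d : ℕ} {h : CF F} (H : CuF d h) : CuF d (fun M => conj (h M)) :=
  ⟨H.pos, fun M N e => by simp only [H.inv M N e], fun A B hA hB => by rw [De_cj, H.van A B hA hB, map_zero]⟩

lemma CuF.adj {d : ℕ} {h : CF F} (H : CuF d h) {Φ : Mo F → CF F} (hΦ : Inv2 Φ) :
    (Q d fun M => hm2 Φ M * h M) = (Q d fun A => Φ A (std 0 0) * h A) + Q d fun B => Φ (std 0 0) B * h B := by
  rw [GLp.adj hΦ H.inv]
  have hne : ((d, 0) : ℕ × ℕ) ≠ (0, d) := by have := H.pos; simp; omega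
  rw [← Finset.sum_subset (s₁ := {(d,0),(0,d)}), Finset.sum_pair hne]
  · congr 1
    · refine Q_congr _ fun T => ?_
      rw [Q_eq_zero_deg, De_zero_right H.inv]
      infer_instance
    · rw [Q_eq_zero_deg]
      refine Q_congr _ fun T => ?_
      rw [De_zero_left H.inv]
      infer_instance
  · intro x hx; simp at hx; rcases hx with rfl | rfl <;> simp
  · rintro ⟨a, b⟩ hx hx'
    simp at hx hx'
    refine Q_zero _ fun T => Q_zero _ fun T' => ?_
    haveI : NeZero a := ⟨by rintro rfl; omega⟩
    haveI : NeZero b := ⟨by rintro rfl; omega⟩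
    rw [H.van _ _ (inferInstanceAs (Nontrivial (Fin a → F))) (inferInstanceAs (Nontrivial (Fin b → F))), mul_zero]

variable (F) in
structure Cp where
  d : ℕ
  ρ : LG F d → ℂ
  irr : IrrR (LG F d) ρ
  cu : CuF d (ext ρ)

noncomputable def Cp.f (r : Cp F) : CF F := ext r.ρ
lemma Cp.cl (r : Cp F) : Cl r.d r.f := cl_ext r.irr.isClass
lemma Cp.cf (r : Cp F) : CuF r.d r.f := r.cu
lemma Cp.posC (r : Cp F) : PosC r.d r.f := PosC_irr r.irr

noncomputable def D (r : Cp F) (f : CF F) (B : Mo F) : ℂ := Q r.d fun A => conj (r.f A) * De f A B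

lemma D_adj (r : Cp F) {f g : CF F} (hf : Inv f) (hg : Inv g) (n : ℕ) :
    (Q (r.d + n) fun M => conj (hm r.f f M) * g M) = Q n fun B => conj (f B) * D r g B := by
  simp only [hm_conj]
  rw [adj_hm r.cf.cj.inv (fun M N e => by simp only [hf M N e]) hg, sum_eq_single (r.d, n)]
  · rw [Q_swap]
    refine Q_congr _ fun T => ?_
    unfold D
    rw [← Q_mul_left]
    exact Q_congr _ fun T' => by ring
  · rintro ⟨a, b⟩ hx hx'
    simp at hx
    refine Q_zero _ fun T => Q_zero _ fun T' => ?_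
    rw [r.cl.std_zero (by rintro rfl; apply hx'; simp; omega)]
    simp
  · simp

lemma D_der (r : Cp F) {f g : CF F} (hf : Inv f) (hg : Inv g) :
    D r (hm f g) = hm (D r f) g + hm f (D r g) := by
  funext B
  unfold D
  simp only [green hf hg, Pi.add_apply]
  have h1 : ∀ A : Mo F, conj (r.f A) * ∑ A1 : St A, ∑ B1 : St B, De f (quo A A1) (quo B B1) * De g (sub A A1) (sub B B1)
    = ∑ B1 : St B, hm2 (fun A' A'' => De f A' (quo B B1) * De g A'' (sub B B1)) A * conj (r.f A) := by
    intro A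
    rw [sum_comm, mul_comm, sum_mul]
    rfl
  simp only [h1]
  rw [Q_sum]
  unfold hm
  rw [← sum_add_distrib]
  refine sum_congr rfl fun B1 _ => ?_
  rw [r.cf.cj.adj (Φ := fun A' A'' => De f A' (quo B B1) * De g A'' (sub B B1))
    (fun A A' C C' e e' => by simp only [De_inv hf _ _ _ _ e (Iso.refl _), De_inv hg _ _ _ _ e' (Iso.refl _)])]
  have s0 : Subsingleton (std (F := F) 0 0).V := inferInstanceAs (Subsingleton (Fin 0 → F))
  congr 1
  · rw [← Q_mul_right]
    refine Q_congr _ fun T => ?_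
    rw [De_zero_left hg _ _ s0]
    show _ = conj (r.f _) * _ * _
    ring
  · rw [← Q_mul_left]
    refine Q_congr _ fun T => ?_
    rw [De_zero_left hf _ _ s0]
    show _ = _ * (conj (r.f _) * _)
    ring

lemma D_one (r : Cp F) : D r one = 0 := by
  funext B
  refine Q_zero _ fun T => ?_
  rw [De_one, one_std, if_neg r.cu.pos.ne']; simp

open Classical in
lemma D_cp (r s : Cp F) : D r s.f = if r = s then one else 0 := by
  funext B
  unfold D
  by_cases hB : Subsingleton B.V
  · have h1 : (Q r.d fun A => conj (r.f A) * De s.f A B) = Q r.d fun A => conj (r.f A) * s.f A :=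
      Q_congr _ fun T => by rw [De_zero_right s.cl.inv _ _ hB]
    rw [h1]
    by_cases hd : r.d = s.d
    · obtain ⟨d, ρ, ir, cu⟩ := r
      obtain ⟨d', ρ', ir', cu'⟩ := s
      obtain rfl : d = d' := hd
      show (Q d fun A => conj (ext ρ A) * ext ρ' A) = _
      rw [Q_ip (cl_ext ir.isClass), res_ext ir.isClass, res_ext ir'.isClass, ip_irr ir ir']
      by_cases h : ρ = ρ'
      · subst h; simp [one, hB]
      · rw [if_neg h, if_neg (by simpa using h)]; rfl
    · rw [if_neg (by rintro rfl; exact hd rfl), Q_zero]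
      · rfl
      · intro T; rw [s.cl.std_zero hd, mul_zero]
  · rw [Q_zero]
    · by_cases h : r = s
      · rw [if_pos h]; simp [one, hB]
      · rw [if_neg h]; rfl
    · intro T
      haveI : NeZero r.d := ⟨r.cu.pos.ne'⟩
      unfold Cp.f
      rw [s.cu.van _ _ (inferInstanceAs (Nontrivial (Fin r.d → F))) (not_subsingleton_iff_nontrivial.1 hB), mul_zero]

noncomputable def pl : List (Cp F) → CF F
  | [] => one
  | r :: L => hm r.f (pl L)

def dg : List (Cp F) → ℕ
  | [] => 0
  | r :: L => r.d + dg L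

lemma ip_eq {n : ℕ} {χ : LG F n → ℂ} (hχ : IrrR (LG F n) χ) (h : CF F) :
    ip χ (res n h) = Q n fun M => conj (ext χ M) * h M := by
  rw [Q_ip (cl_ext hχ.isClass), res_ext hχ.isClass]

lemma ip_one0 {χ : LG F 0 → ℂ} (hχ : IrrR (LG F 0) χ) : ip χ (res 0 one) = conj (al 0 (ext χ)) := by
  rw [ip_eq hχ, Q_eq_zero_deg, al, Q_eq_zero_deg, one_std, ga_sub (sub_std0 _)]
  simp

lemma PosC_one : PosC 0 (one : CF F) := by
  refine ⟨cl_one, fun χ hχ => ?_⟩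
  have h := gen01 hχ
  rw [ip_one0 hχ]
  rw [pow_zero, one_mul] at h
  rcases h with h | h
  · exact ⟨0, by rw [h]; simp⟩
  · exact ⟨1, by rw [h]; simp⟩

lemma pl_pos : ∀ L : List (Cp F), PosC (dg L) (pl L)
  | [] => PosC_one
  | r :: L => r.posC.hm (pl_pos L)

lemma pl_inv (L : List (Cp F)) : Inv (pl L) := (pl_pos L).inv

lemma pl_append : ∀ L M : List (Cp F), pl (L ++ M) = hm (pl L) (pl M)
  | [], M => (one_hm (pl_inv M)).symm
  | r :: L, M => by
    show hm r.f (pl (L ++ M)) = hm (hm r.f (pl L)) (pl M)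
    rw [pl_append L M, hm_assoc r.cl.inv (pl_inv L) (pl_inv M)]

lemma Cl.eq_zero {n : ℕ} {f : CF F} (hf : Cl n f) (h : (Q n fun M => conj (f M) * f M) = 0) : f = 0 := by
  rw [Q_ip hf] at h
  refine hf.ext Cl.zero ?_
  exact ip_self_eq_zero h

open Classical in
lemma cp_comm (r s : Cp F) : hm r.f s.f = hm s.f r.f := by
  by_cases hrs : r = s
  · rw [hrs]
  have h1 : ∀ g : CF F, Inv g → (Q (r.d + s.d) fun M => conj (hm r.f s.f M) * g M) = Q s.d fun M => conj (s.f M) * D r g M :=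
    fun g hg => D_adj r s.cl.inv hg _
  have h2 : ∀ g : CF F, Inv g → (Q (r.d + s.d) fun M => conj (hm s.f r.f M) * g M) = Q r.d fun M => conj (r.f M) * D s g M :=
    fun g hg => by rw [add_comm]; exact D_adj s r.cl.inv hg _
  have i1 := r.cl.inv.hm s.cl.inv
  have i2 := s.cl.inv.hm r.cl.inv
  have e1 : D r (hm r.f s.f) = s.f := by
    rw [D_der r r.cl.inv s.cl.inv, D_cp, D_cp, if_pos rfl, if_neg hrs, one_hm s.cl.inv, hm_zero_right, add_zero]
  have e2 : D r (hm s.f r.f) = s.f := by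
    rw [D_der r s.cl.inv r.cl.inv, D_cp, D_cp, if_pos rfl, if_neg hrs, hm_one s.cl.inv, hm_zero_left, zero_add]
  have e3 : D s (hm r.f s.f) = r.f := by
    rw [D_der s r.cl.inv s.cl.inv, D_cp, D_cp, if_pos rfl, if_neg (Ne.symm hrs), hm_one r.cl.inv, hm_zero_left, zero_add]
  have e4 : D s (hm s.f r.f) = r.f := by
    rw [D_der s s.cl.inv r.cl.inv, D_cp, D_cp, if_pos rfl, if_neg (Ne.symm hrs), one_hm r.cl.inv, hm_zero_right, add_zero]
  have c1 := r.cl.hm s.cl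
  have c2 : Cl (r.d + s.d) (hm s.f r.f) := by rw [add_comm]; exact s.cl.hm r.cl
  have hc : Cl (r.d + s.d) (hm r.f s.f + (-1 : ℂ) • hm s.f r.f) := c1.add (c2.smul _)
  have h0 := hc.eq_zero (by
    have : ∀ M, conj ((hm r.f s.f + (-1 : ℂ) • hm s.f r.f) M) * (hm r.f s.f + (-1 : ℂ) • hm s.f r.f) M
      = (conj (hm r.f s.f M) * hm r.f s.f M - conj (hm r.f s.f M) * hm s.f r.f M) -
        (conj (hm s.f r.f M) * hm r.f s.f M - conj (hm s.f r.f M) * hm s.f r.f M) := by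
      intro M
      simp only [Pi.add_apply, Pi.smul_apply, smul_eq_mul, map_add, map_mul, map_neg, map_one]; ring
    simp only [this]
    rw [Q_sub, Q_sub, Q_sub, h1 _ i1, h1 _ i2, h2 _ i1, h2 _ i2, e1, e2, e3, e4]
    ring)
  funext M
  have := congrFun h0 M
  simp only [Pi.add_apply, Pi.smul_apply, smul_eq_mul, Pi.zero_apply] at this
  linear_combination this

lemma pl_perm {L M : List (Cp F)} (h : L.Perm M) : pl L = pl M := by
  induction h with
  | nil => rfl
  | cons x _ ih => show hm _ _ = hm _ _; rw [ih]
  | swap x y L =>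
    show hm y.f (hm x.f (pl L)) = hm x.f (hm y.f (pl L))
    rw [← hm_assoc y.cl.inv x.cl.inv (pl_inv L), cp_comm, hm_assoc x.cl.inv y.cl.inv (pl_inv L)]
  | trans _ _ h1 h2 => exact h1.trans h2

open Classical in
lemma D_pl (r : Cp F) : ∀ L : List (Cp F), D r (pl L) = (L.count r : ℂ) • pl (L.erase r)
  | [] => by simp [pl, D_one]
  | s :: L => by
    show D r (hm s.f (pl L)) = _
    rw [D_der r s.cl.inv (pl_inv L), D_cp, D_pl r L, hm_smul_right]
    by_cases h : r = s
    · subst h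
      rw [if_pos rfl, one_hm (pl_inv L), List.count_cons_self, List.erase_cons_head]
      by_cases hm' : r ∈ L
      · have : hm r.f (pl (L.erase r)) = pl L := (pl_perm (List.perm_cons_erase hm')).symm
        rw [this]; push_cast; rw [add_smul, one_smul, add_comm]
      · rw [List.count_eq_zero_of_not_mem hm']; simp
    · rw [if_neg h, hm_zero_left, zero_add, List.count_cons_of_ne (Ne.symm h), List.erase_cons_tail (by simpa using Ne.symm h)]
      rfl

lemma pl_orth : ∀ (L M : List (Cp F)), (Q (dg L) fun X => conj (pl L X) * pl M X) ≠ 0 → L.Perm M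
  | [], M => by
    intro h
    cases M with
    | nil => exact List.Perm.nil
    | cons s M =>
      exfalso; apply h
      refine Q_zero _ fun T => ?_
      rw [(pl_pos (s :: M)).std_zero (show dg ([] : List (Cp F)) ≠ dg (s :: M) by show 0 ≠ s.d + dg M; have := s.cu.pos; omega), mul_zero]
  | r :: L, M => by
    classical
    intro h
    have e : (Q (dg (r :: L)) fun X => conj (pl (r :: L) X) * pl M X) = Q (dg L) fun B => conj (pl L B) * D r (pl M) B :=
      D_adj r (pl_inv L) (pl_inv M) _
    rw [e, D_pl] at h
    by_cases hm' : r ∈ M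
    · have h2 : (Q (dg L) fun X => conj (pl L X) * pl (M.erase r) X) ≠ 0 := by
        intro h0; apply h
        have : ∀ B, conj (pl L B) * ((M.count r : ℂ) • pl (M.erase r)) B = (M.count r : ℂ) * (conj (pl L B) * pl (M.erase r) B) := by
          intro B; simp only [Pi.smul_apply, smul_eq_mul]; ring
        simp only [this]
        rw [Q_mul_left, h0, mul_zero]
      exact ((pl_orth L _ h2).cons r).trans (List.perm_cons_erase hm').symm
    · exfalso; apply h
      rw [List.count_eq_zero_of_not_mem hm']
      exact Q_zero _ fun T => by simp

end Cus
section Cus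
variable {F : Type} [Field F] [Finite F]

lemma sum_nat_ne {ι : Type*} [Fintype ι] (f : ι → ℂ) (hf : ∀ i, ∃ k : ℕ, f i = k) (i : ι) (hi : f i ≠ 0) : ∑ i, f i ≠ 0 := by
  choose k hk using hf
  simp only [hk] at hi ⊢
  have h1 : k i ≤ ∑ j, k j := Finset.single_le_sum (fun _ _ => Nat.zero_le _) (mem_univ i)
  have h2 : k i ≠ 0 := by simpa using hi
  exact_mod_cast (by omega : ∑ j, k j ≠ 0)

lemma adj2 {a : ℕ} {f g h : CF F} (hf : Cl a f) (hg : Inv g) (hh : Inv h) (n : ℕ) :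
    (Q (a + n) fun M => conj (hm f g M) * h M) = Q a fun A => conj (f A) * Q n fun B => conj (g B) * De h A B := by
  simp only [hm_conj]
  rw [adj_hm (fun M N e => by simp only [hf.inv M N e]) (fun M N e => by simp only [hg M N e]) hh, sum_eq_single (a, n)]
  · refine Q_congr _ fun T => ?_
    rw [← Q_mul_left]
    exact Q_congr _ fun T' => by ring
  · rintro ⟨a', b⟩ hx hx'
    simp at hx
    refine Q_zero _ fun T => Q_zero _ fun T' => ?_
    rw [hf.std_zero (by rintro rfl; apply hx'; simp; omega)]
    simp
  · simp

lemma Q_exp {n : ℕ} {f : CF F} (hf : Cl n f) (w : CF F) :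
    (Q n fun M => w M * f M) = ∑ χ : {χ : LG F n → ℂ // IrrR (LG F n) χ}, ip χ.1 (res n f) * Q n fun M => w M * ext χ.1 M := by
  have h1 : ∀ M, w M * f M = ∑ χ : {χ : LG F n → ℂ // IrrR (LG F n) χ}, ip χ.1 (res n f) * (w M * ext χ.1 M) := by
    intro M
    conv_lhs => rw [hf.expand]
    rw [Finset.sum_apply, mul_sum]
    refine sum_congr rfl fun χ _ => ?_
    simp only [Pi.smul_apply, smul_eq_mul]; ring
  simp only [h1]
  rw [Q_sum]
  exact sum_congr rfl fun χ _ => Q_mul_left _ _ _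

lemma con_hm {a b : ℕ} {f g : CF F} (hf : PosC a f) (hg : PosC b g) {χ1 : LG F a → ℂ} {χ2 : LG F b → ℂ} {χ : LG F (a + b) → ℂ}
    (c1 : IrrR _ χ1) (c2 : IrrR _ χ2) (c : IrrR _ χ) (h1 : ip χ1 (res a f) ≠ 0) (h2 : ip χ2 (res b g) ≠ 0)
    (h : ip χ (res (a + b) (hm (ext χ1) (ext χ2))) ≠ 0) : ip χ (res (a + b) (hm f g)) ≠ 0 := by
  have e : ip χ (res (a + b) (hm f g)) = ∑ x : {χ : LG F a → ℂ // IrrR _ χ} × {χ : LG F b → ℂ // IrrR _ χ},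
      ip x.1.1 (res a f) * ip x.2.1 (res b g) * ip χ (res (a + b) (hm (ext x.1.1) (ext x.2.1))) := by
    rw [sum_prod_type, ip_eq c, hm_expand hf.toCl hg.toCl]
    simp only [ip_eq c, Finset.sum_apply, mul_sum, Q_sum, Pi.smul_apply, smul_eq_mul]
    refine sum_congr rfl fun x _ => sum_congr rfl fun y _ => ?_
    rw [← Q_mul_left]
    exact Q_congr _ fun T => by ring
  rw [e]
  refine sum_nat_ne _ (fun x => ?_) (⟨χ1, c1⟩, ⟨χ2, c2⟩) (mul_ne_zero (mul_ne_zero h1 h2) h)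
  obtain ⟨k1, e1⟩ := hf.coef _ x.1.2
  obtain ⟨k2, e2⟩ := hg.coef _ x.2.2
  obtain ⟨k3, e3⟩ := (PosC_hm_irr x.1.2 x.2.2).coef _ c
  exact ⟨k1 * k2 * k3, by rw [e1, e2, e3]; push_cast; ring⟩

lemma Ex_inj {A B : Mo F} {c : Hm A B} (h : Injective (Ex A B c).T) :
    Injective A.T ∧ Injective B.T := by
  constructor
  · rw [LinearMap.injective_iff_surjective]
    haveI := (Ex A B c).fin
    have hs := LinearMap.injective_iff_surjective.1 h
    intro a
    obtain ⟨x, hx⟩ := hs ((a, 0) : A.V × B.V)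
    exact ⟨x.1, congrArg Prod.fst hx⟩
  · intro b b' hb
    have : (Ex A B c).T ((0, b) : A.V × B.V) = (Ex A B c).T ((0, b') : A.V × B.V) := by
      show ((A.T 0, B.T b + c 0) : A.V × B.V) = (A.T 0, B.T b' + c 0)
      rw [hb]
    exact congrArg Prod.snd (h this)

lemma split {n : ℕ} {χ : LG F n → ℂ} (hχ : IrrR _ χ) {A B : Mo F} (h : De (ext χ) A B ≠ 0) :
    finrank F A.V + finrank F B.V = n ∧ ∃ χ1 χ2, ∃ (c1 : IrrR (LG F (finrank F A.V)) χ1)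
      (c2 : IrrR (LG F (finrank F B.V)) χ2),
      (Q n fun M => conj (hm (ext χ1) (ext χ2) M) * ext χ M) ≠ 0 := by
  have hI := (cl_ext hχ.isClass).inv
  obtain ⟨c, hc⟩ : ∃ c : Hm A B, ext χ (Ex A B c) ≠ 0 := by
    by_contra! h0
    apply h; unfold De av; simp [h0]
  obtain ⟨hd, hi⟩ := (cl_ext hχ.isClass).supp _ hc
  have hn : finrank F A.V + finrank F B.V = n := by
    rw [← hd]; exact (Module.finrank_prod (R := F) (M := A.V) (M' := B.V)).symm
  obtain ⟨iA, iB⟩ := Ex_inj hi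
  obtain ⟨g, hg⟩ := exists_gm rfl iA
  obtain ⟨g', hg'⟩ := exists_gm rfl iB
  refine ⟨hn, ?_⟩
  subst hn
  by_contra! H
  apply h
  rw [De_inv hI _ _ _ _ hg hg']
  have k1 : ∀ χ2, IrrR (LG F (finrank F B.V)) χ2 → ∀ g : LG F (finrank F A.V),
      (Q (finrank F B.V) fun B => conj (ext χ2 B) * De (ext χ) (gm g) B) = 0 := by
    intro χ2 c2 g
    refine congrFun (complete_zero (f := res (finrank F A.V) fun A => Q (finrank F B.V) fun B => conj (ext χ2 B) * De (ext χ) A B)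
      (res_class fun M N e => Q_congr _ fun T => by rw [De_inv hI _ _ _ _ e (Iso.refl _)]) fun χ1 c1 => ?_) g
    rw [ip_eq c1, ← adj2 (cl_ext c1.isClass) (cl_ext c2.isClass).inv hI]
    exact H _ _ c1 c2
  refine congrFun (complete_zero (f := res (finrank F B.V) fun B => De (ext χ) (gm g) B)
      (res_class fun M N e => De_inv hI _ _ _ _ (Iso.refl _) e) fun χ2 c2 => ?_) g'
  rw [ip_eq c2]
  exact k1 χ2 c2 g

lemma irr_con : ∀ (n : ℕ) (χ : LG F n → ℂ), IrrR _ χ → ∃ L : List (Cp F), dg L = n ∧ ip χ (res n (pl L)) ≠ 0 := by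
  intro n
  induction n using Nat.strong_induction_on with
  | _ n ih =>
  intro χ hχ
  classical
  rcases Nat.eq_zero_or_pos n with rfl | hn
  · refine ⟨[], rfl, ?_⟩
    show ip χ (res 0 one) ≠ 0
    have h1 := ip_irr hχ hχ
    rw [if_pos rfl, ← congrArg (ip χ) (res_ext hχ.isClass), ip_eq hχ, Q_eq_zero_deg] at h1
    rw [ip_eq hχ, Q_eq_zero_deg, one_std, if_pos rfl, mul_one]
    intro h; rw [h] at h1; simp at h1
  by_cases hc : CuF n (ext χ)
  · refine ⟨[⟨n, χ, hχ, hc⟩], rfl, ?_⟩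
    show ip χ (res n (hm (ext χ) one)) ≠ 0
    rw [hm_one hc.inv, res_ext hχ.isClass, ip_irr hχ hχ, if_pos rfl]
    exact one_ne_zero
  · have : ∃ A B : Mo F, Nontrivial A.V ∧ Nontrivial B.V ∧ De (ext χ) A B ≠ 0 := by
      by_contra! h
      exact hc ⟨hn, (cl_ext hχ.isClass).inv, h⟩
    obtain ⟨A, B, nA, nB, h⟩ := this
    obtain ⟨hs, χ1, χ2, c1, c2, h2⟩ := split hχ h
    have pA : 0 < finrank F A.V := Module.finrank_pos
    have pB : 0 < finrank F B.V := Module.finrank_pos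
    obtain ⟨L1, d1, h3⟩ := ih _ (by omega) χ1 c1
    obtain ⟨L2, d2, h4⟩ := ih _ (by omega) χ2 c2
    generalize finrank F A.V = a at *
    generalize finrank F B.V = b at *
    subst hs
    refine ⟨L1 ++ L2, ?_, ?_⟩
    · subst d1 d2
      clear * -
      induction L1 with
      | nil => simp [dg]
      | cons r L ihL => show r.d + dg (L ++ L2) = r.d + dg L + dg L2; rw [ihL]; omega
    · rw [pl_append]
      refine con_hm (d1 ▸ pl_pos L1) (d2 ▸ pl_pos L2) c1 c2 hχ h3 h4 ?_
      rw [Q_ip (Cl.hm (cl_ext c1.isClass) (cl_ext c2.isClass)), res_ext hχ.isClass, ← ip_conj] at h2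
      intro h0; apply h2; rw [h0, map_zero]

lemma con_perm {n : ℕ} {χ : LG F n → ℂ} (hχ : IrrR _ χ) {L M : List (Cp F)} (hL : dg L = n) (hM : dg M = n)
    (h : ip χ (res n (pl L)) ≠ 0) (h' : ip χ (res n (pl M)) ≠ 0) : pl L = pl M := by
  apply pl_perm
  apply pl_orth
  subst hL
  have pM : PosC (dg L) (pl M) := hM ▸ pl_pos M
  rw [Q_ip (pl_pos L).toCl, parseval _ (res_class (pl_inv M))]
  refine sum_nat_ne _ (fun x => ?_) ⟨χ, hχ⟩ (mul_ne_zero (by simpa using h) h')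
  obtain ⟨k1, e1⟩ := (pl_pos L).coef _ x.2
  obtain ⟨k2, e2⟩ := pM.coef _ x.2
  exact ⟨k1 * k2, by rw [e1, e2]; simp⟩

lemma cu_al (r : Cp F) : al r.d r.f = - ep r.d r.f := by
  have h := r.cf.adj (Φ := fun A B => ga A * be B) (fun A A' B B' e e' => by simp only [Inv.ga _ _ e, Inv.be _ _ e'])
  have h1 : ∀ M : Mo F, hm2 (fun A B => ga A * be B) M = one M := fun M => congrFun ga_be M
  simp only [h1, ga_sub (sub_std0 _), one_of_sub (sub_std0 _), one_mul, mul_one] at h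
  rw [Q_zero _ (fun T => by rw [one_std, if_neg r.cu.pos.ne', zero_mul])] at h
  unfold al ep
  linear_combination -h

lemma al_cl {a b : ℕ} {f g : CF F} (hf : Cl a f) (hg : Cl b g) : al (a + b) (hm f g) = al a f * al b g := by
  rw [al_hm hf.inv hg.inv, sum_eq_single (a, b)]
  · rintro ⟨x, y⟩ hx hx'
    simp at hx
    have : al x f = 0 := Q_zero _ fun T => by rw [hf.std_zero (by rintro rfl; apply hx'; simp; omega), mul_zero]
    rw [this, zero_mul]
  · simp

lemma ep_cl {a b : ℕ} {f g : CF F} (hf : Cl a f) (hg : Cl b g) : ep (a + b) (hm f g) = ep a f * ep b g := by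
  rw [ep_hm hf.inv hg.inv, sum_eq_single (a, b)]
  · rintro ⟨x, y⟩ hx hx'
    simp at hx
    have : ep x f = 0 := Q_zero _ fun T => by rw [hf.std_zero (by rintro rfl; apply hx'; simp; omega), mul_zero]
    rw [this, zero_mul]
  · simp

lemma pl_al : ∀ L : List (Cp F), al (dg L) (pl L) ^ 2 = ep (dg L) (pl L) ^ 2 ∧
    ((-1)^(dg L) * al (dg L) (pl L) = 0 ∨ (-1)^(dg L) * al (dg L) (pl L) = 1)
  | [] => by
    show al 0 one ^ 2 = ep 0 one ^ 2 ∧ ((-1)^0 * al 0 one = 0 ∨ (-1)^0 * al 0 one = 1)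
    rw [al_one, ep_one]; simp
  | r :: L => by
    obtain ⟨h1, h2⟩ := pl_al L
    have e1 : al (dg (r :: L)) (pl (r :: L)) = al r.d r.f * al (dg L) (pl L) := al_cl r.cl (pl_pos L).toCl
    have e2 : ep (dg (r :: L)) (pl (r :: L)) = ep r.d r.f * ep (dg L) (pl L) := ep_cl r.cl (pl_pos L).toCl
    have e3 : (-1 : ℂ)^(dg (r :: L)) = (-1)^r.d * (-1)^(dg L) := pow_add _ _ _
    have h3 : (-1)^r.d * al r.d r.f = 0 ∨ (-1)^r.d * al r.d r.f = 1 := gen01 r.irr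
    rw [e1, e2, e3]
    constructor
    · rw [mul_pow, mul_pow, h1, cu_al]; ring
    · rw [mul_mul_mul_comm]
      rcases h3 with h | h <;> rcases h2 with h' | h' <;> rw [h, h'] <;> simp

lemma gen_unique {n : ℕ} {L : List (Cp F)} (hL : dg L = n) {χ χ' : LG F n → ℂ} (hχ : IrrR _ χ) (hχ' : IrrR _ χ')
    (h : ip χ (res n (pl L)) ≠ 0) (h' : ip χ' (res n (pl L)) ≠ 0) (g : al n (ext χ) ≠ 0) (g' : al n (ext χ') ≠ 0) : χ = χ' := by
  classical
  subst hL
  have e : (-1)^(dg L) * al (dg L) (pl L) = ∑ χ : {χ : LG F (dg L) → ℂ // IrrR _ χ}, ip χ.1 (res (dg L) (pl L)) * ((-1)^(dg L) * al (dg L) (ext χ.1)) := by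
    rw [al, Q_exp (pl_pos L).toCl, mul_sum]
    exact sum_congr rfl fun χ _ => by unfold al; ring
  have hk : ∀ χ : {χ : LG F (dg L) → ℂ // IrrR _ χ}, ∃ k : ℕ, ip χ.1 (res (dg L) (pl L)) * ((-1)^(dg L) * al (dg L) (ext χ.1)) = k := by
    intro χ
    obtain ⟨k, hk⟩ := (pl_pos L).coef _ χ.2
    rcases gen01 χ.2 with h | h
    · exact ⟨0, by rw [h]; simp⟩
    · exact ⟨k, by rw [h, hk, mul_one]⟩
  choose k hk using hk
  have k1 : ∀ χ (hχ : IrrR (LG F (dg L)) χ), ip χ (res (dg L) (pl L)) ≠ 0 → al (dg L) (ext χ) ≠ 0 → 1 ≤ k ⟨χ, hχ⟩ := by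
    intro χ hχ h g
    rw [Nat.one_le_iff_ne_zero]
    intro h0
    have := hk ⟨χ, hχ⟩
    rw [h0, Nat.cast_zero] at this
    exact mul_ne_zero h (mul_ne_zero (pow_ne_zero _ (by norm_num)) g) this
  by_contra hne
  have h2 : ∑ x ∈ {⟨χ, hχ⟩, ⟨χ', hχ'⟩}, k x ≤ ∑ x, k x := Finset.sum_le_sum_of_subset (Finset.subset_univ _)
  rw [Finset.sum_pair (by simpa using hne)] at h2
  have h3 := k1 χ hχ h g
  have h4 := k1 χ' hχ' h' g'
  simp only [hk] at e
  have h5 := (pl_al L).2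
  rw [e] at h5
  have h6 : ∑ x, k x = 0 ∨ ∑ x, k x = 1 := by exact_mod_cast h5
  omega

lemma gen_to_ep {n : ℕ} {χ : LG F n → ℂ} (hχ : IrrR _ χ) (g : al n (ext χ) ≠ 0) :
    ∃ ξ : {χ : LG F n → ℂ // IrrR _ χ}, ep n (ext ξ.1) ≠ 0 ∧ ∃ L : List (Cp F), dg L = n ∧ ip χ (res n (pl L)) ≠ 0 ∧ ip ξ.1 (res n (pl L)) ≠ 0 := by
  obtain ⟨L, hL, h⟩ := irr_con n χ hχ
  subst hL
  have h1 : (-1)^(dg L) * al (dg L) (pl L) ≠ 0 := by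
    rw [al, Q_exp (pl_pos L).toCl, mul_sum]
    refine sum_nat_ne _ (fun x => ?_) ⟨χ, hχ⟩ (mul_ne_zero (pow_ne_zero _ (by norm_num)) (mul_ne_zero h g))
    obtain ⟨k, hk⟩ := (pl_pos L).coef _ x.2
    rw [mul_left_comm]
    rcases gen01 x.2 with h | h <;> unfold al at h <;> rw [h]
    · exact ⟨0, by simp⟩
    · exact ⟨k, by rw [hk, mul_one]⟩
  have h2 : ep (dg L) (pl L) ≠ 0 := by
    intro h0
    have := (pl_al L).1
    rw [h0] at this
    apply h1
    rw [pow_eq_zero_iff (by norm_num) |>.1 (this.trans (by simp)), mul_zero]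
  rw [ep, Q_exp (pl_pos L).toCl] at h2
  obtain ⟨ξ, -, hξ⟩ := Finset.exists_ne_zero_of_sum_ne_zero h2
  exact ⟨ξ, right_ne_zero_of_mul hξ, L, rfl, h, left_ne_zero_of_mul hξ⟩

lemma card_gen_le (n : ℕ) : Nat.card {χ : {χ : LG F n → ℂ // IrrR _ χ} // al n (ext χ.1) ≠ 0} ≤
    Nat.card {χ : {χ : LG F n → ℂ // IrrR _ χ} // ep n (ext χ.1) ≠ 0} := by
  choose Φ hΦ L hL h1 h2 using fun χ : {χ : {χ : LG F n → ℂ // IrrR _ χ} // al n (ext χ.1) ≠ 0} => gen_to_ep χ.1.2 χ.2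
  refine Nat.card_le_card_of_injective (fun χ => ⟨Φ χ, hΦ χ⟩) fun χ χ' h => ?_
  have h3 : Φ χ = Φ χ' := congrArg Subtype.val h
  have h4 := h2 χ'
  rw [← h3] at h4
  have h5 := con_perm (Φ χ).2 (hL χ) (hL χ') (h2 χ) h4
  have h6 := h1 χ'
  rw [← h5] at h6
  exact Subtype.ext (Subtype.ext (gen_unique (hL χ) χ.1.2 χ'.1.2 (h1 χ) h6 χ.2 χ'.2))

end Cus
section Cus
variable {F : Type} [Field F] [Finite F]

open Classical in
noncomputable def tr (n : ℕ) (f : CF F) (M : Mo F) : ℂ := if finrank F M.V = n then f M else 0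

lemma tr_of {n : ℕ} {M : Mo F} (h : finrank F M.V = n) (f : CF F) : tr n f M = f M := if_pos h
lemma tr_std (n : ℕ) (f : CF F) (T) : tr n f (std n T) = f (std n T) :=
  tr_of (by show finrank F (Fin n → F) = n; simp) f
lemma Unip.inj {M : Mo F} (h : Unip M) : Injective M.T := by
  obtain ⟨k, hk⟩ := h
  rw [injective_iff_map_eq_zero]
  intro v hv
  have h1 : xx M v = -v := by rw [xx_apply, hv, zero_sub]
  have h2 : ∀ j, (xx M ^ j) v = v ∨ (xx M ^ j) v = -v := by
    intro j
    induction j with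
    | zero => left; rfl
    | succ j ih =>
      rw [xx_pow_succ]
      rcases ih with h | h <;> rw [h]
      · right; exact h1
      · left; rw [map_neg, h1, neg_neg]
  rcases h2 k with h | h <;> rw [hk] at h
  · exact h.symm
  · exact neg_eq_zero.1 h.symm

structure Wt (w : CF F) : Prop where
  inv : Inv w
  re : ∀ M, conj (w M) = w M
  supp : ∀ M, w M ≠ 0 → Unip M

lemma wt_ga : Wt (ga : CF F) := by
  refine ⟨Inv.ga, fun M => ?_, fun M h => by by_contra h0; exact h (if_neg h0)⟩
  unfold ga
  split_ifs
  · unfold PP qq; simp [map_prod]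
  · simp
lemma wt_be : Wt (be : CF F) := by
  refine ⟨Inv.be, fun M => ?_, fun M h => by by_contra h0; exact h (if_neg h0)⟩
  unfold be
  split_ifs <;> simp

lemma Wt.cl {w : CF F} (h : Wt w) (n : ℕ) : Cl n (tr n w) := by
  refine ⟨fun M N e => ?_, fun M hM => ?_⟩
  · have := e.choose.finrank_eq
    unfold tr; rw [this, h.inv M N e]
  · unfold tr at hM
    by_cases h0 : finrank F M.V = n
    · rw [if_pos h0] at hM; exact ⟨h0, (h.supp M hM).inj⟩
    · rw [if_neg h0] at hM; exact absurd rfl hM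

lemma Wt.ip {w : CF F} (h : Wt w) {n : ℕ} {χ : LG F n → ℂ} (hχ : IrrR _ χ) :
    ip χ (res n (tr n w)) = conj (Q n fun M => w M * ext χ M) := by
  rw [ip_eq hχ, Q_conj]
  refine Q_congr _ fun T => ?_
  rw [tr_std, map_mul, h.re, mul_comm]

lemma Wt.pars {w : CF F} (h : Wt w) (n : ℕ) :
    ∑ χ : {χ : LG F n → ℂ // IrrR _ χ}, (Q n fun M => w M * ext χ.1 M) * conj (Q n fun M => w M * ext χ.1 M) = Q n fun M => w M * w M := by
  have := parseval (res n (tr n w)) (res_class (n := n) (h.cl n).inv)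
  rw [← Q_ip (h.cl n)] at this
  rw [show (Q n fun M => w M * w M) = Q n fun M => conj (tr n w M) * tr n w M from
    Q_congr _ fun T => by rw [tr_std, h.re], this]
  refine sum_congr rfl fun χ _ => ?_
  rw [h.ip χ.2, Complex.conj_conj]

lemma IntC_ga (n : ℕ) : IntC n (tr n ga : CF F) := by
  refine ⟨wt_ga.cl n, fun χ hχ => ?_⟩
  rw [wt_ga.ip hχ]
  rcases gen01 hχ with h | h
  · exact ⟨0, by rw [show (Q n fun M => ga M * ext χ M) = 0 from (mul_eq_zero.1 h).resolve_left (pow_ne_zero _ (by norm_num))]; simp⟩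
  · refine ⟨(-1)^n, ?_⟩
    have : (Q n fun M => ga M * ext χ M) = (-1)^n := by
      have h2 : ((-1 : ℂ)^n) * (-1)^n = 1 := by rw [← mul_pow]; simp
      calc _ = ((-1)^n * (-1)^n) * al n (ext χ) := by rw [h2, one_mul]; rfl
        _ = _ := by rw [mul_assoc, h, mul_one]
    rw [this]; simp

lemma tr_hm (n : ℕ) (f g : CF F) : tr n (hm f g) = ∑ x ∈ antidiagonal n, hm (tr x.1 f) (tr x.2 g) := by
  funext M
  rw [Finset.sum_apply]
  unfold hm
  rw [sum_comm]
  have key : ∀ N : St M, finrank F (quo M N).V + finrank F (sub M N).V = finrank F M.V :=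
    fun N => finrank_quotient_add_finrank N.1
  have h1 : ∀ N : St M, ∑ x ∈ antidiagonal n, tr x.1 f (quo M N) * tr x.2 g (sub M N) =
      if finrank F M.V = n then f (quo M N) * g (sub M N) else 0 := by
    intro N
    have := key N
    split_ifs with h
    · rw [sum_eq_single (finrank F (quo M N).V, finrank F (sub M N).V), tr_of rfl, tr_of rfl]
      · rintro ⟨a, b⟩ hx hne
        unfold tr
        split_ifs with h1 h2 <;> simp at *
        omega
      · intro h0; simp at h0; omega
    · refine sum_eq_zero fun x hx => ?_
      unfold tr
      split_ifs with h1 h2 <;> simp at *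
      omega
  simp only [h1]
  unfold tr
  split_ifs <;> simp

lemma tr_zero_one {w : CF F} (h : ∀ M : Mo F, Subsingleton M.V → w M = 1) : tr 0 w = one := by
  funext M
  unfold tr one
  have : finrank F M.V = 0 ↔ Subsingleton M.V := Module.finrank_zero_iff
  by_cases h0 : Subsingleton M.V
  · rw [if_pos (this.2 h0), if_pos h0, h M h0]
  · rw [if_neg (fun h' => h0 (this.1 h')), if_neg h0]

lemma IntC_be (n : ℕ) : IntC n (tr n be : CF F) := by
  induction n using Nat.strong_induction_on with
  | _ n ih =>
  cases n with
  | zero => rw [tr_zero_one fun M h => one_of_sub h]; exact PosC_one.int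
  | succ n =>
    have h := tr_hm (F := F) (n+1) ga be
    rw [ga_be, Finset.Nat.sum_antidiagonal_succ] at h
    have h0 : tr (n+1) (one : CF F) = 0 := by
      funext M
      unfold tr one
      split_ifs with h1 h2
      · exfalso; rw [Module.finrank_zero_iff.2 h2] at h1; omega
      · rfl
      · rfl
    simp only [tr_zero_one (w := (ga : CF F)) fun M h => ga_sub h] at h
    rw [h0, one_hm (wt_be.cl _).inv] at h
    have e : tr (n+1) be = ((-1 : ℤ) : ℂ) • ∑ p ∈ antidiagonal n, hm (tr (p.1+1) ga) (tr p.2 (be : CF F)) := by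
      funext M
      have := congrFun h M
      simp only [Pi.add_apply, Pi.zero_apply] at this
      rw [Pi.smul_apply, smul_eq_mul]
      push_cast
      linear_combination -this
    rw [e]
    refine IntC.zsmul _ (IntC.sum _ fun x hx => ?_)
    have hx' : x.1 + x.2 = n := by simpa using hx
    rw [show n + 1 = (x.1 + 1) + x.2 by omega]
    exact (IntC_ga _).hm (ih _ (by omega))

lemma ep_int {n : ℕ} {χ : LG F n → ℂ} (hχ : IrrR _ χ) : ∃ k : ℤ, ep n (ext χ) = k := by
  obtain ⟨k, hk⟩ := (IntC_be n).coef χ hχ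
  rw [wt_be.ip hχ] at hk
  refine ⟨k, ?_⟩
  rw [ep, ← Complex.conj_conj (Q n _), hk]; simp

lemma count_aux {ι : Type*} [Fintype ι] (a k : ι → ℤ) (ha : ∀ i, a i = 0 ∨ a i ^ 2 = 1) (N : ℤ) (h1 : ∑ i, a i ^ 2 = N)
    (h2 : ∑ i, k i ^ 2 = N) (hc : Nat.card {i // a i ≠ 0} ≤ Nat.card {i // k i ≠ 0}) :
    (Nat.card {i // k i ≠ 0} : ℤ) = N ∧ ∀ i, k i = 0 ∨ k i ^ 2 = 1 := by
  classical
  have c : ∀ b : ι → ℤ, (Nat.card {i // b i ≠ 0} : ℤ) = ∑ i, if b i ≠ 0 then 1 else 0 := by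
    intro b; rw [Nat.card_eq_fintype_card, card_subtype, Finset.card_filter]; push_cast; rfl
  have e1 : (Nat.card {i // a i ≠ 0} : ℤ) = N := by
    rw [c, ← h1]
    refine sum_congr rfl fun i _ => ?_
    rcases ha i with h | h
    · simp [h]
    · rw [if_pos (by intro h0; rw [h0] at h; norm_num at h), h]
  have le : ∀ i ∈ univ, (if k i ≠ 0 then 1 else 0 : ℤ) ≤ k i ^ 2 := by
    intro i _
    split_ifs with h
    · have := sq_nonneg (k i); have h3 : k i ^ 2 ≠ 0 := pow_ne_zero _ h; omega
    · positivity
  have le2 := Finset.sum_le_sum le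
  rw [← c, h2] at le2
  have e2 : (Nat.card {i // k i ≠ 0} : ℤ) = N := by
    have : (Nat.card {i // a i ≠ 0} : ℤ) ≤ Nat.card {i // k i ≠ 0} := by exact_mod_cast hc
    omega
  refine ⟨e2, fun i => ?_⟩
  have := (Finset.sum_eq_sum_iff_of_le le).1 (by rw [← c, h2, e2]) i (mem_univ i)
  by_cases h : k i = 0
  · exact Or.inl h
  · right; rw [if_pos h] at this; exact this.symm

theorem ep_main (n : ℕ) : (Nat.card {χ : {χ : LG F n → ℂ // IrrR _ χ} // ep n (ext χ.1) ≠ 0} : ℂ) = NN F n ∧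
    ∀ χ : LG F n → ℂ, IrrR _ χ → ep n (ext χ) = 0 ∨ ep n (ext χ) = 1 ∨ ep n (ext χ) = -1 := by
  choose k hk using fun χ : {χ : LG F n → ℂ // IrrR _ χ} => ep_int χ.2
  have ha : ∀ χ : {χ : LG F n → ℂ // IrrR _ χ}, ∃ a : ℤ, al n (ext χ.1) = a ∧ (a = 0 ∨ a ^ 2 = 1) := by
    intro χ
    rcases gen01 χ.2 with h | h
    · exact ⟨0, by rw [(mul_eq_zero.1 h).resolve_left (pow_ne_zero _ (by norm_num))]; simp, Or.inl rfl⟩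
    · refine ⟨(-1)^n, ?_, Or.inr (by rw [← pow_mul, mul_comm, pow_mul]; simp)⟩
      have h2 : ((-1 : ℂ)^n) * (-1)^n = 1 := by rw [← mul_pow]; simp
      calc _ = ((-1)^n * (-1)^n) * al n (ext χ.1) := by rw [h2, one_mul]
        _ = _ := by rw [mul_assoc, h, mul_one]; push_cast; rfl
  choose a ha ha' using ha
  have s1 : ∑ χ, (a χ : ℂ) ^ 2 = NN F n := by
    rw [← al_ga, al, ← wt_ga.pars n]
    refine sum_congr rfl fun χ _ => ?_
    rw [show (Q n fun M => ga M * ext χ.1 M) = a χ from ha χ]; simp [sq]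
  have s2 : ∑ χ, (k χ : ℂ) ^ 2 = NN F n := by
    rw [← ep_be, ep, ← wt_be.pars n]
    refine sum_congr rfl fun χ _ => ?_
    rw [show (Q n fun M => be M * ext χ.1 M) = k χ from hk χ]; simp [sq]
  have hc := card_gen_le (F := F) n
  simp only [ha, hk, Ne, Int.cast_eq_zero] at hc
  have s3 : ∑ χ, (k χ) ^ 2 = ∑ χ, (a χ) ^ 2 := by
    have := s2.trans s1.symm; exact_mod_cast this
  obtain ⟨r1, r2⟩ := count_aux a k ha' _ rfl s3 hc
  constructor
  · simp only [hk, Ne, Int.cast_eq_zero]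
    rw [← s1]
    exact_mod_cast r1
  · intro χ hχ
    have := hk ⟨χ, hχ⟩
    simp only at this
    rw [this]
    rcases r2 ⟨χ, hχ⟩ with h | h
    · left; rw [h]; simp
    · right
      rcases (sq_eq_sq_iff_eq_or_eq_neg.1 (h.trans (one_pow 2).symm)) with h | h <;> rw [h] <;> simp
end Cus
section Cus

lemma trace_pow {V : Type*} [AddCommGroup V] [Module ℂ V] [FiniteDimensional ℂ V] (f : Module.End ℂ V) (N : ℕ) (hf : f ^ N = 1) :
    ∃ s : Multiset ℂ, (∀ x ∈ s, x ^ N = 1) ∧ LinearMap.trace ℂ V f = s.sum ∧ (finrank ℂ V : ℂ) = s.card := by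
  have hs : f.charpoly.Splits := IsAlgClosed.splits _
  refine ⟨f.charpoly.roots, fun x hx => ?_, Module.End.trace_eq_sum_roots_charpoly_of_splits hs, ?_⟩
  · have h1 : f.HasEigenvalue x := (Module.End.hasEigenvalue_iff_isRoot_charpoly f x).2 (Polynomial.isRoot_of_mem_roots hx)
    obtain ⟨v, hv⟩ := h1.exists_hasEigenvector
    have h2 := hv.pow_apply N
    rw [hf] at h2
    have h3 : (x ^ N - 1) • v = 0 := by rw [sub_smul, ← h2, one_smul]; simp
    exact sub_eq_zero.1 ((smul_eq_zero.1 h3).resolve_right hv.2)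
  · rw [Polynomial.splits_iff_card_roots.1 hs, LinearMap.charpoly_natDegree]

lemma cong_pow {p : ℕ} (hp : p.Prime) (m : ℕ) (s : Multiset ℂ) (hs : ∀ x ∈ s, x ^ (p ^ m) = 1) :
    IsIntegral ℤ s.sum ∧ ∃ r : ℂ, IsIntegral ℤ r ∧ s.sum ^ (p ^ m) = s.card + p * r := by
  induction s using Multiset.induction_on with
  | empty => exact ⟨by simpa using isIntegral_zero, 0, isIntegral_zero, by simp [hp.ne_zero]⟩
  | cons a s ih =>
    obtain ⟨i1, r, hr, e⟩ := ih fun x hx => hs x (Multiset.mem_cons_of_mem hx)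
    have ha := hs a (Multiset.mem_cons_self a s)
    have ia : IsIntegral ℤ a := IsIntegral.of_pow (pow_pos hp.pos m) (by rw [ha]; exact isIntegral_one)
    rw [Multiset.sum_cons]
    refine ⟨ia.add i1, ?_⟩
    obtain ⟨t, ht⟩ := exists_add_pow_prime_pow_eq hp (⟨a, ia⟩ : integralClosure ℤ ℂ) ⟨s.sum, i1⟩ m
    have h2 := congrArg (Subtype.val) ht
    push_cast at h2
    refine ⟨r + a * s.sum * t.1, hr.add ((ia.mul i1).mul t.2), ?_⟩
    rw [Multiset.card_cons, h2, ha, e]; push_cast; ring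

lemma not_int_inv {p : ℕ} (hp : p.Prime) : ¬ IsIntegral ℤ ((p : ℂ)⁻¹) := by
  intro h
  have h1 : IsIntegral ℤ ((p : ℚ)⁻¹) := by
    rw [← isIntegral_algebraMap_iff (algebraMap ℚ ℂ).injective (R := ℤ)]
    simpa using h
  obtain ⟨k, hk⟩ := IsIntegrallyClosed.isIntegral_iff.1 h1
  have h2 : (k : ℚ) * p = 1 := by
    rw [show (k : ℚ) = (p : ℚ)⁻¹ from hk, inv_mul_cancel₀ (by exact_mod_cast hp.ne_zero)]
  have h3 : k * p = 1 := by exact_mod_cast h2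
  have h4 : (p : ℤ) ∣ 1 := ⟨k, by rw [mul_comm]; exact h3.symm⟩
  have h5 := Int.natCast_dvd_natCast.1 (by simpa using h4 : ((p : ℕ) : ℤ) ∣ ((1 : ℕ) : ℤ))
  exact hp.one_lt.ne' (Nat.dvd_one.1 h5)

lemma dvd_iff {G : Type} [Group G] [Fintype G] {χ : G → ℂ} (hχ : IrrR G χ) {p : ℕ} (hp : p.Prime) {m : ℕ} {g : G}
    (hg : g ^ (p ^ m) = 1) (h01 : χ g = 0 ∨ χ g = 1 ∨ χ g = -1) : NatDvdAlg p (χ 1) ↔ χ g = 0 := by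
  obtain ⟨V, _, _, _, ρ, hρ, rfl⟩ := hχ
  obtain ⟨s, h1, h2, h3⟩ := trace_pow (ρ g) (p ^ m) (by rw [← map_pow, hg, map_one])
  obtain ⟨-, r, hr, e⟩ := cong_pow hp m s h1
  have hp0 : (p : ℂ) ≠ 0 := by exact_mod_cast hp.ne_zero
  rw [← h2, ← h3] at e
  have e1 : ρ.character 1 = finrank ℂ V := by simp [Representation.character]
  have e2 : ρ.character g ^ (p ^ m) = ρ.character 1 + p * r := by rw [e1]; exact e
  unfold NatDvdAlg
  constructor
  · intro h
    by_contra h0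
    have h4 : IsIntegral ℤ (ρ.character g ^ (p ^ m) / p) := by
      rw [e2, add_div, mul_div_cancel_left₀ _ hp0]; exact h.add hr
    apply not_int_inv hp
    have h5 : ρ.character g ^ (p ^ m) = 1 ∨ ρ.character g ^ (p ^ m) = -1 := by
      rcases h01 with h | h | h
      · exact absurd h h0
      · left; rw [h, one_pow]
      · rw [h]; exact neg_one_pow_eq_or _ _
    rcases h5 with h | h <;> rw [h] at h4
    · simpa using h4
    · simpa [neg_div] using h4.neg
  · intro h
    rw [h, zero_pow (pow_pos hp.pos m).ne'] at e2
    have : ρ.character 1 / p = -r := by rw [div_eq_iff hp0]; linear_combination -e2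
    rw [this]; exact hr.neg

variable {F : Type} [Field F] [Finite F]

lemma un_gm {p : ℕ} (hp : p.Prime) [CharP F p] (n : ℕ) : ∃ g : LG F n, Iso (un n) (gm g) ∧ ∃ m, g ^ (p ^ m) = 1 := by
  obtain ⟨g, hg⟩ := exists_gm (un_finrank (F := F) n) (un_unip n).inj
  refine ⟨g, hg, ?_⟩
  obtain ⟨k, hk⟩ := (unip_iso hg).1 (un_unip n)
  refine ⟨k, ?_⟩
  haveI := Fact.mk hp
  have hk0 : xx (gm g) ^ k = 0 := LinearMap.ext hk
  have h1 : xx (gm g) ^ (p ^ k) = 0 := by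
    rw [← Nat.sub_add_cancel (Nat.lt_pow_self hp.one_lt (n := k)).le, pow_add, hk0, mul_zero]
  let E : Module.End F (Fin n → F) := (g : (Fin n → F) →ₗ[F] (Fin n → F))
  have h2 : E ^ (p ^ k) = 1 := by
    have hE : E = (E - 1) + 1 := by abel
    have h1' : (E - 1) ^ (p ^ k) = 0 := h1
    haveI : CharP (Module.End F (Fin n → F)) p ∨ n = 0 := by
      rcases Nat.eq_zero_or_pos n with h | h
      · exact Or.inr h
      · haveI : NeZero n := ⟨h.ne'⟩
        left; exact charP_of_injective_algebraMap (FaithfulSMul.algebraMap_injective F _) p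
    rcases this with h | rfl
    · rw [hE, add_pow_char_pow_of_commute p _ (Commute.one_right _), h1', one_pow, zero_add]
    · exact Subsingleton.elim _ _
  have h3 : ∀ (j : ℕ) v, (g ^ j) v = (E ^ j) v := by
    intro j
    induction j with
    | zero => intro v; rfl
    | succ j ih => intro v; rw [pow_succ, pow_succ]; exact ih _
  ext1 v
  rw [h3, h2]; rfl

lemma dvd_ep {p : ℕ} (hp : p.Prime) [CharP F p] {n : ℕ} {χ : LG F n → ℂ} (hχ : IrrR _ χ) :
    NatDvdAlg p (χ 1) ↔ ep n (ext χ) = 0 := by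
  obtain ⟨g, hg, m, hm⟩ := un_gm (F := F) hp n
  have h := (ep_main n).2 χ hχ
  have e : ep n (ext χ) = χ g := by rw [ep_eq (cl_ext hχ.isClass).inv, ext_gm hχ.isClass hg]
  rw [e] at h ⊢
  exact dvd_iff hχ hp hm h

lemma IrrR.comp_iff {G H : Type} [Group G] [Group H] [Fintype G] [Fintype H] (e : G ≃* H) {χ : H → ℂ} : IrrR H χ ↔ IrrR G (χ ∘ e) :=
  ⟨fun h => h.comp e, fun h => by
    have := h.comp e.symm
    rwa [show (χ ∘ e) ∘ e.symm = χ by ext x; simp] at this⟩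

end Cus

section Fin
variable {F : Type} [Field F] [Fintype F] [DecidableEq F]
theorem card_split {p : ℕ} (hp : p.Prime) [CharP F p] (n : ℕ) :
    (Nat.card {χ : Matrix.GeneralLinearGroup (Fin n) F → ℂ // IsIrrChar _ χ ∧ NatDvdAlg p (χ 1)} : ℂ) + NN F n =
      Nat.card (ConjClasses (LG F n)) ∧
    Nat.card {χ : Matrix.GeneralLinearGroup (Fin n) F → ℂ // IsIrrChar _ χ} = Nat.card (ConjClasses (LG F n)) := by
  classical
  let e : (LG F n → ℂ) ≃ (Matrix.GeneralLinearGroup (Fin n) F → ℂ) := (EQ n).toEquiv.symm.arrowCongr (Equiv.refl ℂ)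
  have he : ∀ χ, e χ = χ ∘ EQ n := fun χ => rfl
  have e1 : {χ : LG F n → ℂ // IrrR _ χ} ≃ {χ : Matrix.GeneralLinearGroup (Fin n) F → ℂ // IsIrrChar _ χ} :=
    subtypeEquiv e fun χ => by rw [isIrrChar_iff, he]; exact IrrR.comp_iff _
  have e2 : {χ : LG F n → ℂ // IrrR _ χ ∧ ep n (ext χ) = 0} ≃ {χ : Matrix.GeneralLinearGroup (Fin n) F → ℂ // IsIrrChar _ χ ∧ NatDvdAlg p (χ 1)} :=
    subtypeEquiv e fun χ => by
      rw [isIrrChar_iff, he, ← IrrR.comp_iff]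
      refine and_congr_right fun h => ?_
      rw [← dvd_ep hp h]
      show _ ↔ NatDvdAlg p (χ (EQ n 1))
      rw [map_one]
  have e3 : {χ : {χ : LG F n → ℂ // IrrR _ χ} // ep n (ext χ.1) = 0} ≃ {χ : LG F n → ℂ // IrrR _ χ ∧ ep n (ext χ) = 0} :=
    Equiv.subtypeSubtypeEquivSubtypeInter _ (fun χ : LG F n → ℂ => ep n (ext χ) = 0)
  have k : Nat.card {χ : LG F n → ℂ // IrrR _ χ} = Nat.card (ConjClasses (LG F n)) := by
    have := card_irr (G := LG F n); exact this
  refine ⟨?_, (Nat.card_congr e1).symm.trans k⟩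
  rw [← Nat.card_congr (e3.trans e2), ← (ep_main n).1, ← k]
  rw [← Nat.card_congr (Equiv.sumCompl fun χ : {χ : LG F n → ℂ // IrrR _ χ} => ep n (ext χ.1) = 0), Nat.card_sum]
  push_cast
  rfl
end Fin
open Polynomial
section Cls
variable (F : Type) [Field F]

abbrev Pr : Type := {p : F[X] // p.Monic ∧ Irreducible p ∧ p ≠ X}
variable {F}
noncomputable def py (y : Pr F × ℕ) : F[X] := (y.1 : F[X]) ^ (y.2 + 1)
abbrev Bl (f : F[X]) : Type := F[X] ⧸ (Submodule.span F[X] {f})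

lemma finrank_Bl (f : F[X]) : finrank F (Bl f) = f.natDegree := finrank_quotient_span_eq_natDegree
lemma py_monic (y : Pr F × ℕ) : (py y).Monic := y.1.2.1.pow _
lemma finBl {f : F[X]} (hf : f.Monic) : Module.Finite F (Bl f) := hf.finite_quotient

lemma card_Bl [Finite F] {f : F[X]} (hf : f.Monic) : Nat.card (Bl f) = Nat.card F ^ f.natDegree := by
  haveI := finBl hf
  rw [Module.natCard_eq_pow_finrank (K := F), finrank_Bl]

variable [Finite F]
noncomputable def pm {ι : Type} [Finite ι] (y : ι → Pr F × ℕ) : Mo F :=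
  haveI : ∀ i, Finite (Bl (py (y i))) := fun i => haveI := finBl (py_monic (y i)); Module.finite_of_finite F
  ⟨∀ i, Bl (py (y i)), Algebra.lsmul F F _ (X : F[X])⟩

lemma pm_aeval {ι : Type} [Finite ι] (y : ι → Pr F × ℕ) (h : F[X]) :
    aeval (pm y).T h = (Algebra.lsmul F F (∀ i, Bl (py (y i))) h : Module.End F _) := by
  show aeval (Algebra.lsmul F F (∀ i, Bl (py (y i))) (X : F[X])) h = _
  rw [aeval_algHom_apply, aeval_X_left_apply]

lemma iso_aeval {M N : Mo F} (h : F[X]) (e : M.V ≃ₗ[F] N.V) (he : ∀ v, e (M.T v) = N.T (e v)) (v : M.V) :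
    e (aeval M.T h v) = aeval N.T h (e v) := by
  induction h using Polynomial.induction_on' generalizing v with
  | add p q hp hq => simp [hp, hq]
  | monomial n a =>
    rw [← C_mul_X_pow_eq_monomial]
    simp only [map_mul, aeval_C, map_pow, aeval_X, Module.End.mul_apply, Module.algebraMap_end_apply, map_smul]
    congr 1
    induction n generalizing v with
    | zero => rfl
    | succ n ih => rw [pow_succ, pow_succ]; simp only [Module.End.mul_apply]; rw [ih, he]

noncomputable def rkc (M : Mo F) (h : F[X]) : ℕ := Nat.card (Set.range (aeval M.T h : M.V → M.V))
lemma rkc_iso {M N : Mo F} (h : F[X]) (H : Iso M N) : rkc M h = rkc N h := by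
  obtain ⟨e, he⟩ := H
  refine Nat.card_congr ((e.toEquiv.image _).trans (Equiv.setCongr ?_))
  ext w
  simp only [Set.mem_image, Set.mem_range, exists_exists_eq_and]
  constructor
  · rintro ⟨v, rfl⟩; exact ⟨e v, (iso_aeval h e he v).symm⟩
  · rintro ⟨v, rfl⟩; exact ⟨e.symm v, by
      have := iso_aeval h e he (e.symm v)
      rw [e.apply_symm_apply] at this; exact this⟩

open Classical in
noncomputable def rr (P : Pr F) (k : ℕ) (y : Pr F × ℕ) : ℕ :=
  if y.1 = P then (y.2 + 1 - k) * (P : F[X]).natDegree else (y.2 + 1) * (y.1 : F[X]).natDegree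

lemma mem_sp {f a : F[X]} : (Submodule.Quotient.mk a : Bl f) = 0 ↔ f ∣ a := by
  rw [Submodule.Quotient.mk_eq_zero, Submodule.mem_span_singleton]
  constructor
  · rintro ⟨c, rfl⟩; exact ⟨c, by simp [mul_comm]⟩
  · rintro ⟨c, rfl⟩; exact ⟨c, by simp [mul_comm]⟩

lemma card_range_Bl (f h r : F[X]) (hr : r.Monic) (H : ∀ a, f ∣ h * a ↔ r ∣ a) :
    Nat.card (Set.range fun v : Bl f => h • v) = Nat.card F ^ r.natDegree := by
  rw [← card_Bl hr]
  let φ : F[X] →ₗ[F[X]] Bl f := (LinearMap.lsmul F[X] (Bl f) h) ∘ₗ (Submodule.span F[X] {f}).mkQ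
  have hk : ker φ = Submodule.span F[X] {r} := by
    ext a
    have : φ a = Submodule.Quotient.mk (h * a) := rfl
    rw [LinearMap.mem_ker, this, mem_sp, H, ← mem_sp, Submodule.Quotient.mk_eq_zero]
  refine Nat.card_congr ((Equiv.setCongr ?_).trans ((quotEquivOfEq _ _ hk).symm.trans φ.quotKerEquivRange).symm.toEquiv)
  ext w
  constructor
  · rintro ⟨v, rfl⟩
    obtain ⟨a, rfl⟩ := Submodule.Quotient.mk_surjective _ v
    exact ⟨a, rfl⟩
  · rintro ⟨a, rfl⟩; exact ⟨Submodule.Quotient.mk a, rfl⟩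

lemma cop {P Q : Pr F} (h : Q ≠ P) : IsCoprime (Q : F[X]) (P : F[X]) := by
  rw [Irreducible.coprime_iff_not_dvd Q.2.2.1]
  intro hd
  exact h (Subtype.ext (eq_of_monic_of_associated Q.2.1 P.2.1 (Q.2.2.1.associated_of_dvd P.2.2.1 hd)))

lemma card_range_py (P : Pr F) (k : ℕ) (y : Pr F × ℕ) :
    Nat.card (Set.range fun v : Bl (py y) => (P : F[X]) ^ k • v) = Nat.card F ^ rr P k y := by
  unfold rr
  split_ifs with h
  · subst h
    rw [card_range_Bl (py y) _ ((y.1 : F[X]) ^ (y.2 + 1 - k)) (y.1.2.1.pow _), natDegree_pow]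
    intro a
    unfold py
    have h0 : (y.1 : F[X]) ≠ 0 := y.1.2.1.ne_zero
    rcases le_total k (y.2 + 1) with hk | hk
    · conv_lhs => rw [show y.2 + 1 = k + (y.2 + 1 - k) by omega, pow_add]
      exact mul_dvd_mul_iff_left (pow_ne_zero _ h0)
    · rw [Nat.sub_eq_zero_of_le hk, pow_zero]
      simp only [one_dvd, iff_true]
      exact Dvd.dvd.mul_right (pow_dvd_pow _ hk) _
  · rw [card_range_Bl (py y) _ (py y) (py_monic y)]
    · rw [py, natDegree_pow]
    · intro a
      exact ⟨fun H => (IsCoprime.pow (cop h)).dvd_of_dvd_mul_left H, fun H => H.mul_left _⟩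

lemma rkc_pm {ι : Type} [Fintype ι] (y : ι → Pr F × ℕ) (P : Pr F) (k : ℕ) :
    rkc (pm y) ((P : F[X]) ^ k) = Nat.card F ^ ∑ i, rr P k (y i) := by
  rw [rkc, pm_aeval, ← Finset.prod_pow_eq_pow_sum]
  simp_rw [← card_range_py]
  rw [← Nat.card_pi]
  refine Nat.card_congr ((Equiv.setCongr ?_).trans (Equiv.Set.univPi _))
  exact Set.range_piMap (fun i => fun v : Bl (py (y i)) => (P : F[X]) ^ k • v)

lemma rr_rec (P : Pr F) (k : ℕ) (y : Pr F × ℕ) [Decidable ((P, k) = y)] :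
    rr P k y + rr P (k+2) y = 2 * rr P (k+1) y + (if (P, k) = y then 1 else 0) * (P : F[X]).natDegree := by
  obtain ⟨Q, j⟩ := y
  unfold rr
  by_cases h : Q = P
  · subst h
    simp only [if_true, Prod.mk.injEq, true_and]
    rw [← mul_assoc, ← add_mul, ← add_mul]
    congr 1
    split_ifs <;> omega
  · have : ¬ ((P, k) = (Q, j)) := fun e => h (by simpa using (congrArg Prod.fst e).symm)
    rw [if_neg h, if_neg h, if_neg h, if_neg this]; ring

noncomputable def ms {ι : Type} [Fintype ι] (y : ι → Pr F × ℕ) : Multiset (Pr F × ℕ) := Finset.univ.val.map y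

open Classical in
lemma count_ms {ι : Type} [Fintype ι] (y : ι → Pr F × ℕ) (a : Pr F × ℕ) :
    (ms y).count a = ∑ i, if a = y i then 1 else 0 := by
  rw [ms, Multiset.count_map, sum_boole]; rfl

lemma one_lt_q : 1 < Nat.card F := Finite.one_lt_card

open Classical in
lemma ms_of_iso {ι κ : Type} [Fintype ι] [Fintype κ] (y : ι → Pr F × ℕ) (z : κ → Pr F × ℕ) (h : Iso (pm y) (pm z)) :
    ms y = ms z := by
  ext ⟨P, k⟩
  have h1 : ∀ k, ∑ i, rr P k (y i) = ∑ i, rr P k (z i) := fun k =>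
    Nat.pow_right_injective one_lt_q (by
      show Nat.card F ^ _ = Nat.card F ^ _
      rw [← rkc_pm, ← rkc_pm]; exact rkc_iso _ h)
  have h2 : ∀ {ι : Type} [Fintype ι] (y : ι → Pr F × ℕ), ∑ i, rr P k (y i) + ∑ i, rr P (k+2) (y i) =
      2 * ∑ i, rr P (k+1) (y i) + (ms y).count (P, k) * (P : F[X]).natDegree := by
    intro ι _ y
    rw [count_ms, ← sum_add_distrib, mul_sum, sum_mul, ← sum_add_distrib]
    exact sum_congr rfl fun i _ => rr_rec P k (y i)
  have h3 := h2 y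
  rw [h1, h1, h1, h2 z] at h3
  have : 0 < (P : F[X]).natDegree := P.2.2.1.natDegree_pos
  exact (Nat.eq_of_mul_eq_mul_right this (by omega)).symm

lemma pm_reindex {ι κ : Type} [Finite ι] [Finite κ] (σ : ι ≃ κ) (y : κ → Pr F × ℕ) : Iso (pm y) (pm (y ∘ σ)) :=
  ⟨LinearEquiv.piCongrLeft' F (fun i => Bl (py (y i))) σ.symm, fun v => rfl⟩

open Classical in
lemma iso_of_ms {ι κ : Type} [Fintype ι] [Fintype κ] (y : ι → Pr F × ℕ) (z : κ → Pr F × ℕ) (h : ms y = ms z) :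
    Iso (pm y) (pm z) := by
  have h1 : ∀ a, Nonempty ({i // y i = a} ≃ {i // z i = a}) := fun a => by
    have := congrArg (Multiset.count a) h
    rw [count_ms, count_ms] at this
    refine ⟨Fintype.equivOfCardEq ?_⟩
    rw [card_subtype, card_subtype]
    simpa [sum_boole, eq_comm] using this
  let σ : ι ≃ κ := (Equiv.sigmaFiberEquiv y).symm.trans ((Equiv.sigmaCongrRight fun a => (h1 a).some).trans (Equiv.sigmaFiberEquiv z))
  have hσ : z ∘ σ = y := by
    funext i
    exact ((h1 (y i)).some ⟨i, rfl⟩).2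
  have := pm_reindex σ z
  rw [hσ] at this
  exact this.symm

lemma pm_finrank {ι : Type} [Fintype ι] (y : ι → Pr F × ℕ) :
    finrank F (pm y).V = ((ms y).map fun a => (a.2 + 1) * (a.1 : F[X]).natDegree).sum := by
  haveI : ∀ i, Module.Finite F (Bl (py (y i))) := fun i => finBl (py_monic (y i))
  show finrank F (∀ i, Bl (py (y i))) = _
  rw [Module.finrank_pi_fintype, ms, Multiset.map_map]
  refine sum_congr rfl fun i _ => ?_
  rw [finrank_Bl, py, natDegree_pow]; rfl

lemma pm_inj {ι : Type} [Finite ι] (y : ι → Pr F × ℕ) : Injective (pm y).T := by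
  rw [injective_iff_map_eq_zero]
  intro v hv
  funext i
  have h : (X : F[X]) • v i = 0 := congrFun hv i
  obtain ⟨a, ha⟩ := Submodule.Quotient.mk_surjective _ (v i)
  rw [← ha] at h ⊢
  rw [← Submodule.Quotient.mk_smul, mem_sp] at h
  refine mem_sp.2 ?_
  refine IsCoprime.dvd_of_dvd_mul_left ?_ h
  refine IsCoprime.pow_left ?_
  rw [Irreducible.coprime_iff_not_dvd (y i).1.2.2.1]
  intro hd
  exact (y i).1.2.2.2 (eq_of_monic_of_associated (y i).1.2.1 monic_X ((y i).1.2.2.1.associated_of_dvd irreducible_X hd))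

end Cls
section Cls
variable {F : Type} [Field F] [Finite F]

lemma tors (M : Mo F) : Module.IsTorsion F[X] (Module.AEval' M.T) := by
  intro v
  have hi : IsIntegral F M.T := Algebra.IsIntegral.isIntegral _
  refine ⟨⟨minpoly F M.T, mem_nonZeroDivisors_of_ne_zero (minpoly.ne_zero hi)⟩, ?_⟩
  show minpoly F M.T • v = 0
  apply (Module.AEval.of F M.V M.T).symm.injective
  rw [Module.AEval.of_symm_smul, minpoly.aeval, zero_smul, map_zero]

open scoped DirectSum in
lemma exists_pm (M : Mo F) (hM : Injective M.T) :
    ∃ (ι : Type) (_ : Fintype ι) (y : ι → Pr F × ℕ), Iso M (pm y) := by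
  obtain ⟨ι, _, p, hp, e, ⟨E⟩⟩ := Module.equiv_directSum_of_isTorsion (tors M)
  classical
  let E1 := E.trans (DirectSum.linearEquivFunOnFintype F[X] ι (fun i => F[X] ⧸ (Submodule.span F[X] {p i ^ e i})))
  have hX : ∀ w : ∀ i, F[X] ⧸ (Submodule.span F[X] {p i ^ e i}), (X : F[X]) • w = 0 → w = 0 := by
    intro w hw
    have h1 : (X : F[X]) • (E1.symm w) = 0 := by rw [← map_smul, hw, map_zero]
    have h2 := congrArg (Module.AEval.of F M.V M.T).symm h1
    rw [Module.AEval.of_symm_smul, aeval_X, map_zero] at h2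
    have h3 : (Module.AEval.of F M.V M.T).symm (E1.symm w) = 0 := hM (by rw [map_zero]; exact h2)
    simpa using h3
  let κ := {i : ι // e i ≠ 0}
  have hne : ∀ i : κ, normalize (p i) ≠ X := by
    intro i hi
    have hd : p i ∣ X := by rw [← hi]; exact (associated_normalize _).dvd
    obtain ⟨c, hc⟩ := hd
    have := hX (Pi.single i.1 (Submodule.Quotient.mk (p i ^ (e i - 1)))) (by
      rw [← Pi.single_smul, ← Submodule.Quotient.mk_smul]
      have : (Submodule.Quotient.mk ((X : F[X]) • p i ^ (e i - 1)) : Bl (p i ^ e i)) = 0 := by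
        rw [mem_sp]
        refine ⟨c, ?_⟩
        rw [smul_eq_mul, hc]
        conv_rhs => rw [show e i = (e i - 1) + 1 from (Nat.succ_pred_eq_of_pos (Nat.pos_of_ne_zero i.2)).symm, pow_succ]
        ring
      rw [this, Pi.single_zero])
    rw [Pi.single_eq_zero_iff] at this
    have h4 := mem_sp.1 this
    have h5 := (pow_dvd_pow_iff (hp i).ne_zero (hp i).not_isUnit).1 h4
    have := i.2
    omega
  let y : κ → Pr F × ℕ := fun i => (⟨normalize (p i), monic_normalize (hp i).ne_zero,
    (associated_normalize _).irreducible (hp i), hne i⟩, e i - 1)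
  have hsp : ∀ i : κ, Submodule.span F[X] {p i ^ e i} = Submodule.span F[X] {py (y i)} := by
    intro i
    have : py (y i) = normalize (p i) ^ e i := by
      show normalize (p i) ^ (e i - 1 + 1) = _
      rw [show e i - 1 + 1 = e i from Nat.succ_pred_eq_of_pos (Nat.pos_of_ne_zero i.2)]
    rw [this]
    exact Ideal.span_singleton_eq_span_singleton.2 ((associated_normalize _).pow_pow)
  let E2 : (∀ i, F[X] ⧸ (Submodule.span F[X] {p i ^ e i})) →ₗ[F[X]] (∀ i : κ, F[X] ⧸ (Submodule.span F[X] {p i.1 ^ e i.1})) :=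
    LinearMap.pi fun i => LinearMap.proj i.1
  have hE2 : Function.Bijective E2 := by
    constructor
    · intro v w h
      funext i
      by_cases hi : e i = 0
      · haveI : Subsingleton (F[X] ⧸ (Submodule.span F[X] {p i ^ e i})) := by
          rw [hi, pow_zero, Submodule.Quotient.subsingleton_iff]
          exact Ideal.span_singleton_one
        exact Subsingleton.elim _ _
      · exact congrFun h ⟨i, hi⟩
    · intro w
      refine ⟨fun i => if h : e i ≠ 0 then w ⟨i, h⟩ else 0, ?_⟩
      funext i
      show (if h : e i.1 ≠ 0 then w ⟨i.1, h⟩ else 0) = w i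
      rw [dif_pos i.2]
  let E3 := (E1.trans (LinearEquiv.ofBijective E2 hE2)).trans
    (LinearEquiv.piCongrRight fun i : κ => quotEquivOfEq _ _ (hsp i))
  refine ⟨κ, inferInstance, y, (Module.AEval.of F M.V M.T).trans (E3.restrictScalars F), fun v => ?_⟩
  show E3 (Module.AEval.of F M.V M.T (M.T v)) = (X : F[X]) • E3 (Module.AEval.of F M.V M.T v)
  rw [← map_smul, Module.AEval.X_smul_of]; rfl

abbrev wtp (a : Pr F × ℕ) : ℕ := (a.2 + 1) * (a.1 : F[X]).natDegree

open Classical in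
theorem card_cls (n : ℕ) : Nat.card (ConjClasses (LG F n)) =
    Nat.card {D : Multiset (Pr F × ℕ) // (D.map wtp).sum = n} := by
  have hms : ∀ D : Multiset (Pr F × ℕ), ms (fun i : D => (i : Pr F × ℕ)) = D := fun D => D.map_univ_coe
  have hex : ∀ D : {D : Multiset (Pr F × ℕ) // (D.map wtp).sum = n}, ∃ g : LG F n, Iso (pm (fun i : D.1 => (i : Pr F × ℕ))) (gm g) :=
    fun D => exists_gm (by rw [pm_finrank, hms, D.2]) (pm_inj _)
  choose g hg using hex
  symm
  refine Nat.card_congr (ofBijective (fun D => ConjClasses.mk (g D)) ⟨?_, ?_⟩)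
  · intro D D' h
    rw [ConjClasses.mk_eq_mk_iff_isConj, isConj_iff] at h
    obtain ⟨c, hc⟩ := h
    have h1 : Iso (gm (g D')) (gm (g D)) := by rw [← hc]; exact gm_conj _ _
    have h2 := ms_of_iso _ _ ((hg D).trans (h1.symm.trans (hg D').symm))
    rw [hms, hms] at h2
    exact Subtype.ext h2
  · intro c
    obtain ⟨k, rfl⟩ := ConjClasses.exists_rep c
    obtain ⟨ι, _, y, hy⟩ := exists_pm (gm k) k.injective
    have hn : ((ms y).map wtp).sum = n := by
      rw [← pm_finrank]
      obtain ⟨E, -⟩ := hy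
      rw [← E.finrank_eq]
      show finrank F (Fin n → F) = n
      simp
    refine ⟨⟨ms y, hn⟩, ?_⟩
    show ConjClasses.mk _ = ConjClasses.mk _
    rw [ConjClasses.mk_eq_mk_iff_isConj, isConj_iff]
    refine conj_of_iso ((hg _).symm.trans (Iso.trans ?_ hy.symm))
    exact iso_of_ms _ _ (hms _)

end Cls
section Cls
variable {F : Type} [Field F] [Finite F]

noncomputable def ws (s : Multiset (Pr F)) : ℕ := (s.map fun P : Pr F => (P : F[X]).natDegree).sum
noncomputable def mp (s : Multiset (Pr F)) : F[X] := (s.map fun P : Pr F => (P : F[X])).prod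

lemma mp_monic (s : Multiset (Pr F)) : (mp s).Monic := by
  apply monic_multiset_prod_of_monic; intro P _; exact P.2.1

lemma mp_deg (s : Multiset (Pr F)) : (mp s).natDegree = ws s := by
  rw [mp, natDegree_multiset_prod_of_monic]
  · rw [Multiset.map_map]; rfl
  · intro f hf
    obtain ⟨P, -, rfl⟩ := Multiset.mem_map.1 hf
    exact P.2.1

lemma mp_X (s : Multiset (Pr F)) : ¬ X ∣ mp s := by
  intro h
  obtain ⟨a, ha, hd⟩ := Prime.exists_mem_multiset_dvd prime_X h
  obtain ⟨P, -, rfl⟩ := Multiset.mem_map.1 ha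
  exact P.2.2.2 (eq_of_monic_of_associated monic_X P.2.1 (irreducible_X.associated_of_dvd P.2.2.1 hd)).symm

open Classical in
lemma mp_inj : Injective (mp (F := F)) := by
  intro s t h
  have key : ∀ s : Multiset (Pr F), UniqueFactorizationMonoid.normalizedFactors (mp s) = s.map fun P : Pr F => (P : F[X]) := by
    intro s
    rw [mp, UniqueFactorizationMonoid.normalizedFactors_prod_eq _ (by
      intro a ha
      obtain ⟨P, -, rfl⟩ := Multiset.mem_map.1 ha
      exact P.2.2.1), Multiset.map_map]
    refine Multiset.map_congr rfl fun P _ => P.2.1.normalize_eq_self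
  have := congrArg UniqueFactorizationMonoid.normalizedFactors h
  rw [key, key] at this
  exact Multiset.map_injective Subtype.val_injective this

open Classical in
lemma mp_surj (f : F[X]) (hf : f.Monic) (h : ¬ X ∣ f) : ∃ s, mp s = f := by
  have h1 : ∀ a ∈ UniqueFactorizationMonoid.normalizedFactors f, a.Monic ∧ Irreducible a ∧ a ≠ X := by
    intro a ha
    have hi := UniqueFactorizationMonoid.irreducible_of_normalized_factor a ha
    refine ⟨?_, hi, ?_⟩
    · rw [← UniqueFactorizationMonoid.normalize_normalized_factor a ha]; exact monic_normalize hi.ne_zero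
    · rintro rfl; exact h (UniqueFactorizationMonoid.dvd_of_mem_normalizedFactors ha)
  refine ⟨(UniqueFactorizationMonoid.normalizedFactors f).pmap (fun a ha => ⟨a, ha⟩) h1, ?_⟩
  refine eq_of_monic_of_associated (mp_monic _) hf ?_
  rw [mp, Multiset.map_pmap, Multiset.pmap_eq_map, Multiset.map_id']
  exact UniqueFactorizationMonoid.prod_normalizedFactors hf.ne_zero

lemma card_monic (m : ℕ) : Nat.card {f : F[X] // f.Monic ∧ f.natDegree = m} = Nat.card F ^ m := by
  rw [Nat.card_congr ((monicEquivDegreeLT m).trans (degreeLTEquiv F m).toEquiv), Nat.card_fun, Nat.card_fin]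

open Classical in
lemma card_ws (m : ℕ) : Nat.card {s : Multiset (Pr F) // ws s = m} =
    if m = 0 then 1 else (Nat.card F - 1) * Nat.card F ^ (m - 1) := by
  have e : {s : Multiset (Pr F) // ws s = m} ≃ {f : {f : F[X] // f.Monic ∧ f.natDegree = m} // ¬ X ∣ f.1} :=
    ofBijective (fun s => ⟨⟨mp s.1, mp_monic _, by rw [mp_deg, s.2]⟩, mp_X _⟩) ⟨fun s t h => Subtype.ext (mp_inj (by simpa using h)), by
      rintro ⟨⟨f, hf, hd⟩, hX⟩
      obtain ⟨s, rfl⟩ := mp_surj f hf hX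
      exact ⟨⟨s, by rw [← mp_deg, hd]⟩, rfl⟩⟩
  rw [Nat.card_congr e]
  have hfin : ∀ m, Finite {f : F[X] // f.Monic ∧ f.natDegree = m} := fun m =>
    Nat.finite_of_card_ne_zero (by rw [card_monic]; exact pow_ne_zero _ (Nat.card_pos).ne')
  haveI := hfin m
  have h1 := Nat.card_congr (Equiv.sumCompl fun f : {f : F[X] // f.Monic ∧ f.natDegree = m} => X ∣ f.1)
  rw [Nat.card_sum, card_monic] at h1
  rcases m with _ | m
  · have : IsEmpty {f : {f : F[X] // f.Monic ∧ f.natDegree = 0} // X ∣ f.1} := by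
      refine ⟨fun ⟨⟨f, hf, h0⟩, hd⟩ => ?_⟩
      have hd' : X ∣ f := hd
      rw [hf.natDegree_eq_zero.1 h0] at hd'
      exact not_isUnit_X (isUnit_of_dvd_one hd')
    rw [Nat.card_of_isEmpty] at h1
    simpa using h1
  · have e2 : {f : F[X] // f.Monic ∧ f.natDegree = m} ≃ {f : {f : F[X] // f.Monic ∧ f.natDegree = m + 1} // X ∣ f.1} :=
      ofBijective (fun f => ⟨⟨X * f.1, monic_X.mul f.2.1, by rw [monic_X.natDegree_mul f.2.1, f.2.2, natDegree_X]; ring⟩, dvd_mul_right _ _⟩)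
        ⟨fun f g h => Subtype.ext (by simpa using h), by
          rintro ⟨⟨f, hf, hd⟩, hX⟩
          obtain ⟨g, hfg⟩ : X ∣ f := hX
          subst hfg
          have hg : g.Monic := Monic.of_mul_monic_left monic_X hf
          exact ⟨⟨g, hg, by rw [monic_X.natDegree_mul hg, natDegree_X] at hd; omega⟩, rfl⟩⟩
    rw [← Nat.card_congr e2, card_monic] at h1
    rw [if_neg (Nat.succ_ne_zero m), Nat.add_sub_cancel, Nat.sub_mul, one_mul]
    rw [pow_succ'] at h1
    omega

noncomputable def WW (k : ℕ) (D : Multiset (Pr F × ℕ)) : ℕ := (D.map fun a => (a.2 + k) * (a.1 : F[X]).natDegree).sum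

def Th (x : Multiset (Pr F) × Multiset (Pr F × ℕ)) : Multiset (Pr F × ℕ) :=
  x.1.map (fun P => (P, 0)) + x.2.map (fun a => (a.1, a.2 + 1))

lemma WW_Th (k : ℕ) (x) : WW (F := F) k (Th x) = k * ws x.1 + WW (k+1) x.2 := by
  rw [WW, Th, Multiset.map_add, Multiset.sum_add, Multiset.map_map, Multiset.map_map, WW, ws, ← Multiset.sum_map_mul_left]
  simp [Function.comp_def, add_assoc, add_comm 1]

open Classical in
lemma Th_bij : Function.Bijective (Th (F := F)) := by
  have i1 : Injective (fun P : Pr F => (P, 0)) := fun P Q h => congrArg Prod.fst h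
  have i2 : Injective (fun a : Pr F × ℕ => (a.1, a.2 + 1)) := fun a b h => by
    simp only [Prod.mk.injEq, Nat.add_right_cancel_iff] at h; exact Prod.ext h.1 h.2
  have c1 : ∀ x P, (Th (F := F) x).count (P, 0) = x.1.count P := by
    intro x P
    rw [Th, Multiset.count_add, Multiset.count_map_eq_count' _ _ i1, Multiset.count_eq_zero_of_notMem (s := Multiset.map _ x.2) (by simp), add_zero]
  have c2 : ∀ x P j, (Th (F := F) x).count (P, j+1) = x.2.count (P, j) := by
    intro x P j
    rw [Th, Multiset.count_add, Multiset.count_eq_zero_of_notMem (by simp), zero_add]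
    exact Multiset.count_map_eq_count' _ _ i2 (P, j)
  constructor
  · intro x x' h
    refine Prod.ext ?_ ?_
    · ext P; rw [← c1, ← c1, h]
    · ext ⟨P, j⟩; rw [← c2, ← c2, h]
  · intro D
    induction D using Multiset.induction with
    | empty => exact ⟨(0, 0), rfl⟩
    | cons a D ih =>
      obtain ⟨⟨s, E⟩, rfl⟩ := ih
      obtain ⟨P, _ | j⟩ := a
      · exact ⟨(P ::ₘ s, E), by simp [Th]⟩
      · exact ⟨(s, (P, j) ::ₘ E), by simp [Th]⟩

end Cls
section Cls
variable {F : Type} [Field F] [Finite F]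

variable (F) in
noncomputable def rq : ℝ := (Nat.card F : ℝ)
lemma rq_gt : 1 < rq F := by have := one_lt_q (F := F); unfold rq; exact_mod_cast this
variable (F) in
noncomputable def cc (m : ℕ) : ℝ := if m = 0 then 1 else (rq F - 1) * rq F ^ (m - 1)

lemma card_ws' (m : ℕ) : (Nat.card {s : Multiset (Pr F) // ws s = m} : ℝ) = cc F m := by
  have := one_lt_q (F := F)
  rw [card_ws, cc, rq]
  split_ifs
  · simp
  · push_cast [Nat.cast_sub this.le]; ring
lemma fin_ws (m : ℕ) : Finite {s : Multiset (Pr F) // ws s = m} := by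
  refine Nat.finite_of_card_ne_zero fun h => ?_
  have h1 := card_ws' (F := F) m
  rw [h, cc] at h1
  have := rq_gt (F := F)
  split_ifs at h1
  · simp at h1
  · have : 0 < (rq F - 1) * rq F ^ (m - 1) := by have : 0 < rq F - 1 := by linarith
                                                 positivity
    rw [Nat.cast_zero] at h1; linarith
lemma cc_nonneg (m : ℕ) : 0 ≤ cc F m := by rw [← card_ws']; positivity

lemma ecard_ws (m : ℕ) : ENNReal.ofReal (cc F m) = ∑' s : {s : Multiset (Pr F) // ws s = m}, (1 : ENNReal) := by
  haveI := fin_ws (F := F) m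
  haveI := ofFinite {s : Multiset (Pr F) // ws s = m}
  rw [← card_ws', tsum_fintype]
  simp

lemma tsum_fib {α : Type*} (w : α → ℕ) (f : ℕ → ENNReal) :
    ∑' a, f (w a) = ∑' m, f m * ∑' s : {s : α // w s = m}, (1 : ENNReal) := by
  rw [← (Equiv.sigmaFiberEquiv w).tsum_eq, ENNReal.tsum_sigma']
  refine tsum_congr fun m => ?_
  rw [← ENNReal.tsum_mul_left]
  refine tsum_congr fun s => ?_
  rw [mul_one]
  exact congrArg f s.2

lemma cc_sum {t : ℝ} (h0 : 0 ≤ t) (h1 : rq F * t < 1) : HasSum (fun m => cc F m * t ^ m) ((1 - t) / (1 - rq F * t)) := by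
  have hq := rq_gt (F := F)
  rw [← hasSum_nat_add_iff' 1]
  have := (hasSum_geometric_of_lt_one (by positivity) h1).mul_left ((rq F - 1) * t)
  have e1 : (fun m => cc F (m+1) * t ^ (m+1)) = fun i => (rq F - 1) * t * (rq F * t) ^ i := by
    funext m
    simp only [cc, Nat.succ_ne_zero, if_false, Nat.add_sub_cancel]; ring
  have e2 : (1 - t) / (1 - rq F * t) - ∑ i ∈ Finset.range 1, cc F i * t ^ i = (rq F - 1) * t * (1 - rq F * t)⁻¹ := by
    have : 1 - rq F * t ≠ 0 := by linarith
    simp only [Finset.sum_range_one, cc, if_true, pow_zero]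
    rw [← div_eq_mul_inv, sub_eq_iff_eq_add, div_eq_iff this, add_mul, div_mul_cancel₀ _ this]; ring
  rw [e1, e2]; exact this

lemma ws_sum {t : ℝ} (h0 : 0 ≤ t) (h1 : rq F * t < 1) :
    ∑' s : Multiset (Pr F), ENNReal.ofReal (t ^ ws s) = ENNReal.ofReal ((1 - t) / (1 - rq F * t)) := by
  rw [tsum_fib ws (fun m => ENNReal.ofReal (t ^ m))]
  simp_rw [← ecard_ws]
  have H := cc_sum (F := F) h0 h1
  rw [← H.tsum_eq, ENNReal.ofReal_tsum_of_nonneg (fun m => mul_nonneg (cc_nonneg m) (pow_nonneg h0 _)) H.summable]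
  refine tsum_congr fun m => ?_
  rw [ENNReal.ofReal_mul (cc_nonneg m), mul_comm]

open Classical in
lemma SJ (J k : ℕ) : ∑' D : Multiset (Pr F × ℕ), (if ∀ a ∈ D, a.2 < J then ENNReal.ofReal ((rq F)⁻¹ ^ WW (k+2) D) else 0)
    = ENNReal.ofReal ((1 - (rq F)⁻¹ ^ (k+1+J)) / (1 - (rq F)⁻¹ ^ (k+1))) := by
  have hq := rq_gt (F := F)
  have hr0 : 0 < (rq F)⁻¹ := by positivity
  have hr1 : (rq F)⁻¹ < 1 := inv_lt_one_of_one_lt₀ hq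
  have hp : ∀ k, 0 < 1 - (rq F)⁻¹ ^ (k+1) := fun k => sub_pos.2 (pow_lt_one₀ hr0.le hr1 (by omega))
  induction J generalizing k with
  | zero =>
    rw [tsum_eq_single 0]
    · simp only [Multiset.notMem_zero, false_imp_iff, implies_true, if_true, add_zero]
      rw [div_self (hp k).ne']; simp [WW]
    · intro D hD
      rw [if_neg]
      intro h
      obtain ⟨a, ha⟩ := Multiset.exists_mem_of_ne_zero hD
      exact absurd (h a ha) (by omega)
  | succ J ih =>
    rw [← (ofBijective _ (Th_bij (F := F))).tsum_eq, ENNReal.tsum_prod']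
    have : ∀ s : Multiset (Pr F), ∀ D : Multiset (Pr F × ℕ), (if ∀ a ∈ Th (s, D), a.2 < J + 1 then ENNReal.ofReal ((rq F)⁻¹ ^ WW (k+2) (Th (s, D))) else 0)
       = ENNReal.ofReal (((rq F)⁻¹ ^ (k+2)) ^ ws s) * (if ∀ a ∈ D, a.2 < J then ENNReal.ofReal ((rq F)⁻¹ ^ WW (k+1+2) D) else 0) := by
      intro s D
      have h1 : (∀ a ∈ Th (s, D), a.2 < J + 1) ↔ ∀ a ∈ D, a.2 < J := by
        simp only [Th, Multiset.mem_add, Multiset.mem_map]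
        constructor
        · intro h a ha
          have := h (a.1, a.2 + 1) (Or.inr ⟨a, ha, rfl⟩)
          simp only at this; omega
        · rintro h a (⟨P, _, rfl⟩ | ⟨b, hb, rfl⟩)
          · simp
          · have := h b hb; simp only; omega
      simp only [h1]
      split_ifs
      · rw [WW_Th, ← ENNReal.ofReal_mul (by positivity), ← pow_mul, ← pow_add]
      · rw [mul_zero]
    simp only [Equiv.ofBijective_apply]
    simp_rw [this, ENNReal.tsum_mul_left, ih, ENNReal.tsum_mul_right]
    have hqr : rq F * (rq F)⁻¹ ^ (k+2) = (rq F)⁻¹ ^ (k+1) := by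
      rw [pow_succ' _ (k+1), ← mul_assoc, mul_inv_cancel₀ (by positivity), one_mul]
    rw [ws_sum (by positivity) (by rw [hqr]; linarith [hp k]), hqr, ← ENNReal.ofReal_mul (div_nonneg (hp (k+1)).le (hp k).le)]
    congr 1
    have := (hp k).ne'
    have := (hp (k+1)).ne'
    rw [show k + 1 + 1 + J = k + 1 + (J + 1) by ring]
    rw [div_mul_div_comm, mul_comm (1 - (rq F)⁻¹ ^ (k + 1)), mul_div_mul_left _ _ this]

open Classical in
lemma S2 : ∑' D : Multiset (Pr F × ℕ), ENNReal.ofReal ((rq F)⁻¹ ^ WW 2 D) = ENNReal.ofReal (1 - (rq F)⁻¹)⁻¹ := by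
  have hq := rq_gt (F := F)
  have hr0 : 0 < (rq F)⁻¹ := by positivity
  have hr1 : (rq F)⁻¹ < 1 := inv_lt_one_of_one_lt₀ hq
  have hS := fun J => SJ (F := F) J 0
  simp only [zero_add, pow_one] at hS
  have hp : 0 < 1 - (rq F)⁻¹ := by linarith
  apply le_antisymm
  · rw [ENNReal.tsum_eq_iSup_sum]
    refine iSup_le fun t => ?_
    obtain ⟨J, hJ⟩ : ∃ J, ∀ D ∈ t, ∀ a ∈ D, a.2 < J := by
      refine ⟨(t.sup fun D => D.toFinset.sup fun a => a.2) + 1, fun D hD a ha => Nat.lt_succ_of_le ?_⟩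
      exact le_trans (Finset.le_sup (f := fun a : Pr F × ℕ => a.2) (Multiset.mem_toFinset.2 ha))
        (Finset.le_sup (f := fun D : Multiset (Pr F × ℕ) => D.toFinset.sup fun a => a.2) hD)
    calc _ = ∑ D ∈ t, (if ∀ a ∈ D, a.2 < J then ENNReal.ofReal ((rq F)⁻¹ ^ WW 2 D) else 0) :=
          sum_congr rfl fun D hD => (if_pos (hJ D hD)).symm
      _ ≤ _ := ENNReal.sum_le_tsum t
      _ = _ := hS J
      _ ≤ _ := by
        apply ENNReal.ofReal_le_ofReal
        rw [div_eq_mul_inv]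
        refine mul_le_of_le_one_left (by positivity) ?_
        have : 0 ≤ (rq F)⁻¹ ^ (1 + J) := by positivity
        linarith
  · have hl : Filter.Tendsto (fun J : ℕ => ENNReal.ofReal ((1 - (rq F)⁻¹ ^ (1+J)) / (1 - (rq F)⁻¹))) Filter.atTop
        (nhds (ENNReal.ofReal (1 - (rq F)⁻¹)⁻¹)) := by
      apply ENNReal.tendsto_ofReal
      have h1 := (tendsto_pow_atTop_nhds_zero_of_lt_one hr0.le hr1).comp (Filter.tendsto_atTop_mono (fun J : ℕ => Nat.le_add_left J 1) Filter.tendsto_id)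
      have h2 := (h1.const_sub 1).div_const (1 - (rq F)⁻¹)
      simpa [Function.comp_def] using h2
    refine le_of_tendsto' hl fun J => ?_
    rw [← hS J]
    refine ENNReal.tsum_le_tsum fun D => ?_
    split_ifs <;> simp

variable (F) in
noncomputable def kk (n : ℕ) : ℕ := Nat.card (ConjClasses (LG F n))

lemma kk_sum (n : ℕ) : ENNReal.ofReal (kk F n) = ∑' D : Multiset (Pr F × ℕ),
    if WW 2 D ≤ n then ENNReal.ofReal (cc F (n - WW 2 D)) else 0 := by
  classical
  haveI : Finite (LG F n) := inferInstance
  have h1 : kk F n = Nat.card {D : Multiset (Pr F × ℕ) // WW 1 D = n} := card_cls n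
  haveI hf : Finite {D : Multiset (Pr F × ℕ) // WW 1 D = n} := by
    refine Nat.finite_of_card_ne_zero ?_
    rw [← h1]
    haveI : Finite (ConjClasses (LG F n)) := Quot.finite _
    exact (Nat.card_pos (α := ConjClasses (LG F n))).ne'
  haveI := ofFinite {D : Multiset (Pr F × ℕ) // WW 1 D = n}
  have h2 : ENNReal.ofReal (kk F n) = ∑' D : {D : Multiset (Pr F × ℕ) // WW 1 D = n}, (1 : ENNReal) := by
    rw [h1, tsum_fintype]; simp
  have h3 : ∀ {α : Type} (w : α → ℕ) (n : ℕ), ∑' D : {D // w D = n}, (1 : ENNReal) = ∑' D, if w D = n then 1 else 0 := by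
    intro α w n
    rw [tsum_fib w (fun m => if m = n then 1 else 0), tsum_eq_single n]
    · simp
    · intro m hm; simp [hm]
  rw [h2, h3, ← (ofBijective _ (Th_bij (F := F))).tsum_eq, ENNReal.tsum_prod', ENNReal.tsum_comm]
  refine tsum_congr fun D => ?_
  simp only [Equiv.ofBijective_apply, WW_Th, one_mul, Nat.reduceAdd]
  split_ifs with h
  · rw [ecard_ws, h3]
    refine tsum_congr fun s => ?_
    congr 1
    apply propext; omega
  · rw [ENNReal.tsum_eq_zero]
    intro s
    rw [if_neg (by omega)]

theorem kk_lim : Filter.Tendsto (fun n => (kk F n : ℝ) / rq F ^ n) Filter.atTop (nhds 1) := by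
  have hq := rq_gt (F := F)
  have hr0 : 0 < (rq F)⁻¹ := by positivity
  have hr1 : (rq F)⁻¹ < 1 := inv_lt_one_of_one_lt₀ hq
  have hp : 0 < 1 - (rq F)⁻¹ := by linarith
  have hsum : Summable fun D : Multiset (Pr F × ℕ) => (rq F)⁻¹ ^ WW 2 D := by
    have := ENNReal.summable_toReal (f := fun D : Multiset (Pr F × ℕ) => ENNReal.ofReal ((rq F)⁻¹ ^ WW 2 D))
      (by rw [S2]; exact ENNReal.ofReal_ne_top)
    refine this.congr fun D => ?_
    exact ENNReal.toReal_ofReal (by positivity)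
  have htot : ∑' D : Multiset (Pr F × ℕ), (rq F)⁻¹ ^ WW 2 D = (1 - (rq F)⁻¹)⁻¹ := by
    have := S2 (F := F)
    rw [← ENNReal.ofReal_tsum_of_nonneg (fun D => by positivity) hsum] at this
    exact (ENNReal.ofReal_eq_ofReal_iff (tsum_nonneg fun D => by positivity) (by positivity)).1 this
  have hk : ∀ n, (kk F n : ℝ) / rq F ^ n = ∑' D : Multiset (Pr F × ℕ),
      (if WW 2 D ≤ n then cc F (n - WW 2 D) / rq F ^ (n - WW 2 D) else 0) * (rq F)⁻¹ ^ WW 2 D := by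
    intro n
    have h1 := congrArg ENNReal.toReal (kk_sum (F := F) n)
    rw [ENNReal.toReal_ofReal (by positivity), ENNReal.tsum_toReal_eq (fun D => by split_ifs <;> simp)] at h1
    rw [h1, ← tsum_div_const]
    refine tsum_congr fun D => ?_
    split_ifs with h
    · rw [ENNReal.toReal_ofReal (cc_nonneg _), inv_pow, ← div_eq_mul_inv, div_div, ← pow_add, Nat.sub_add_cancel h]
    · simp
  have hcc : ∀ m, cc F (m+1) / rq F ^ (m+1) = 1 - (rq F)⁻¹ := by
    intro m
    simp only [cc, Nat.succ_ne_zero, if_false, Nat.add_sub_cancel, pow_succ]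
    field_simp
  have hcb : ∀ m, |cc F m / rq F ^ m| ≤ 1 := by
    intro m
    rcases m with _ | m
    · simp [cc]
    · rw [hcc, abs_of_pos hp]; linarith
  simp_rw [hk]
  have hone : (1 : ℝ) = ∑' D : Multiset (Pr F × ℕ), (1 - (rq F)⁻¹) * (rq F)⁻¹ ^ WW 2 D := by
    rw [tsum_mul_left, htot, mul_inv_cancel₀ hp.ne']
  rw [hone]
  refine tendsto_tsum_of_dominated_convergence hsum ?_ ?_
  · intro D
    refine Filter.Tendsto.mul_const _ ?_
    refine Filter.Tendsto.congr' ?_ tendsto_const_nhds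
    filter_upwards [Filter.eventually_gt_atTop (WW 2 D)] with n hn
    rw [if_pos hn.le, show n - WW 2 D = (n - WW 2 D - 1) + 1 by omega, hcc]
  · refine Filter.Eventually.of_forall fun n D => ?_
    rw [Real.norm_eq_abs, abs_mul, abs_of_pos (show 0 < (rq F)⁻¹ ^ WW 2 D by positivity)]
    refine mul_le_of_le_one_left (by positivity) ?_
    split_ifs
    · exact hcb _
    · simp

end Cls
end GLp

theorem proportion_of_degrees_divisible_by_p
    (p : ℕ) (hp : p.Prime) (e : ℕ) (he : 0 < e) (q : ℕ) (hq : q = p ^ e)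
    (F : Type) [Field F] [Fintype F] (hFq : Fintype.card F = q) :
    Filter.Tendsto (fun n : ℕ =>
        (Nat.card {χ : GL (Fin n) F → ℂ // IsIrrChar _ χ ∧ NatDvdAlg p (χ 1)} : ℝ) /
          (Nat.card {χ : GL (Fin n) F → ℂ // IsIrrChar _ χ} : ℝ))
      Filter.atTop (nhds (1 / (q : ℝ))) := by
  classical
  haveI : Fact p.Prime := ⟨hp⟩
  haveI : CharP F p := charP_of_card_eq_prime_pow (f := e) (by rw [hFq, hq])
  have hqr : GLp.rq F = q := by rw [GLp.rq, Nat.card_eq_fintype_card, hFq]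
  have hq1 := GLp.rq_gt (F := F)
  have h1 : ∀ n, (Nat.card {χ : GL (Fin n) F → ℂ // IsIrrChar _ χ ∧ NatDvdAlg p (χ 1)} : ℝ) = GLp.kk F n - GLp.cc F n := by
    intro n
    have h := (GLp.card_split (F := F) hp n).1
    have hN : GLp.NN F n = ((GLp.cc F n : ℝ) : ℂ) := by
      rw [GLp.NN, GLp.cc, GLp.qq, GLp.rq]; split_ifs <;> push_cast <;> rfl
    rw [hN] at h
    have h' : (Nat.card {χ : GL (Fin n) F → ℂ // IsIrrChar _ χ ∧ NatDvdAlg p (χ 1)} : ℝ) + GLp.cc F n = GLp.kk F n := by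
      exact_mod_cast h
    linarith
  have h2 : ∀ n, (Nat.card {χ : GL (Fin n) F → ℂ // IsIrrChar _ χ} : ℝ) = GLp.kk F n := fun n => by
    rw [(GLp.card_split (F := F) hp n).2]; rfl
  simp_rw [h1, h2]
  have hk := GLp.kk_lim (F := F)
  have hc : Filter.Tendsto (fun n => GLp.cc F n / GLp.rq F ^ n) Filter.atTop (nhds (1 - (GLp.rq F)⁻¹)) := by
    refine Filter.Tendsto.congr' ?_ tendsto_const_nhds
    filter_upwards [Filter.eventually_gt_atTop 0] with n hn
    obtain ⟨m, rfl⟩ : ∃ m, n = m + 1 := ⟨n - 1, by omega⟩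
    simp only [GLp.cc, Nat.succ_ne_zero, if_false, Nat.add_sub_cancel, pow_succ]
    field_simp
  have h3 := (hk.sub hc).div hk one_ne_zero
  rw [← hqr]
  convert h3 using 1
  · funext n
    have : GLp.rq F ^ n ≠ 0 := by positivity
    simp only [Pi.div_apply]
    rw [← sub_div, div_div_div_cancel_right₀ this]
  · congr 1; rw [one_div]; ring
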